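/- Let Ω ⊂ ℝⁿ be a bounded open set, let μ be a Borel measure with finite total mass on ℝⁿ, and let g ∈ W^{s,p}_loc(ℝⁿ) ∩ L^{p−1}_{sp}(ℝⁿ). Then there exists a SOLA u of the Dirichlet problem −L_Φ u = μ in Ω, u = g on ℝⁿ∖Ω; in particular u ∈ W^{h,q}(Ω) for every h ∈ (0,s) and every q with max{1,p−1} ≤ q < min{n(p−1)/(n−s), p}. -/

import Mathlib

noncomputable section

open MeasureTheory Metric Set Filter Topology
open scoped ENNReal NNReal

/-- Euclidean space `ℝⁿ`. -/
abbrev Rn (n : ℕ) : Type := EuclideanSpace ℝ (Fin n)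

/-- `q_* = max {1, p-1}`. -/
def qStar (p : ℝ) : ℝ := max 1 (p - 1)

/-- `q̄ = min {n(p-1)/(n-s), p}`. -/
def qBar (n : ℕ) (s p : ℝ) : ℝ := min ((n : ℝ) * (p - 1) / ((n : ℝ) - s)) p

/-- Gagliardo seminorm raised to the power `p`, as an `ℝ≥0∞`-valued double integral. -/
def gagliardo (n : ℕ) (s p : ℝ) (O : Set (Rn n)) (v : Rn n → ℝ) : ℝ≥0∞ :=
  ∫⁻ x in O, ∫⁻ y in O, ENNReal.ofReal (|v x - v y| ^ p / ‖x - y‖ ^ ((n : ℝ) + s * p))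

/-- `v ∈ W^{s,p}(O)`. -/
def memWsp (n : ℕ) (s p : ℝ) (O : Set (Rn n)) (v : Rn n → ℝ) : Prop :=
  AEMeasurable v (volume.restrict O) ∧
    (∫⁻ x in O, ENNReal.ofReal (|v x| ^ p)) < ⊤ ∧ gagliardo n s p O v < ⊤

/-- `Tail(v; x₀, r)`. -/
def tailFn (n : ℕ) (s p : ℝ) (v : Rn n → ℝ) (x₀ : Rn n) (r : ℝ) : ℝ≥0∞ :=
  (ENNReal.ofReal (r ^ (s * p)) *
      ∫⁻ x in (ball x₀ r)ᶜ,
        ENNReal.ofReal (|v x| ^ (p - 1) / ‖x - x₀‖ ^ ((n : ℝ) + s * p))) ^ (1 / (p - 1))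

/-- `v ∈ L^{p-1}_{sp}(ℝⁿ)`. -/
def memTailSpace (n : ℕ) (s p : ℝ) (v : Rn n → ℝ) : Prop :=
  AEMeasurable v (volume : Measure (Rn n)) ∧
    (∀ R : ℝ, (∫⁻ x in ball (0 : Rn n) R, ENNReal.ofReal (|v x| ^ (p - 1))) < ⊤) ∧
    ∀ z : Rn n, ∀ r : ℝ, 0 < r → tailFn n s p v z r < ⊤

/-- `φ ∈ C_0^∞(O)`. -/
def IsTestFun (n : ℕ) (O : Set (Rn n)) (φ : Rn n → ℝ) : Prop :=
  ContDiff ℝ (⊤ : ℕ∞) φ ∧ HasCompactSupport φ ∧ tsupport φ ⊆ O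

/-- The nonlocal form `⟨-L_Φ u, φ⟩`. -/
def nonlocalForm (n : ℕ) (Φ : ℝ → ℝ) (K : Rn n → Rn n → ℝ) (u φ : Rn n → ℝ) : ℝ :=
  ∫ x : Rn n, ∫ y : Rn n, Φ (u x - u y) * (φ x - φ y) * K x y

/-- Ellipticity/coercivity bounds on the kernel `K`. -/
def KernelBounds (n : ℕ) (Λ s p : ℝ) (K : Rn n → Rn n → ℝ) : Prop :=
  Measurable (Function.uncurry K) ∧
    ∀ x y : Rn n, x ≠ y →
      1 / (Λ * ‖x - y‖ ^ ((n : ℝ) + s * p)) ≤ K x y ∧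
        K x y ≤ Λ / ‖x - y‖ ^ ((n : ℝ) + s * p)

/-- Structure conditions on `Φ`. -/
def PhiBounds (Λ p : ℝ) (Φ : ℝ → ℝ) : Prop :=
  Continuous Φ ∧ Φ 0 = 0 ∧
    ∀ t : ℝ, |t| ^ p / Λ ≤ Φ t * t ∧ Φ t * t ≤ Λ * |t| ^ p

/-- `∫ φ dμ` for a signed measure `μ`. -/
def sintegral (n : ℕ) (μ : MeasureTheory.SignedMeasure (Rn n)) (φ : Rn n → ℝ) : ℝ :=
  (∫ x, φ x ∂μ.toJordanDecomposition.posPart) -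
    ∫ x, φ x ∂μ.toJordanDecomposition.negPart

/-- Weak (energy) solution of `-L_Φ u = f` in `Ω`, `u = g` on `ℝⁿ ∖ Ω`. -/
def WeakSol (n : ℕ) (Φ : ℝ → ℝ) (K : Rn n → Rn n → ℝ) (s p : ℝ)
    (Ω : Set (Rn n)) (f g u : Rn n → ℝ) : Prop :=
  memWsp n s p univ u ∧ (∀ᵐ x : Rn n, x ∉ Ω → u x = g x) ∧
    ∀ φ : Rn n → ℝ, IsTestFun n Ω φ → nonlocalForm n Φ K u φ = ∫ x : Rn n, φ x * f x

/-- Weak subsolution of the homogeneous equation `-L_Φ w = 0` in `Ω`. -/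
def WeakSubSol (n : ℕ) (Φ : ℝ → ℝ) (K : Rn n → Rn n → ℝ) (s p : ℝ)
    (Ω : Set (Rn n)) (w : Rn n → ℝ) : Prop :=
  memWsp n s p univ w ∧
    ∀ φ : Rn n → ℝ, IsTestFun n Ω φ → (∀ x, 0 ≤ φ x) → nonlocalForm n Φ K w φ ≤ 0

/-- The approximation properties required of a SOLA. -/
def SOLAApprox (n : ℕ) (Φ : ℝ → ℝ) (K : Rn n → Rn n → ℝ) (s p : ℝ)
    (Ω : Set (Rn n)) (μ : MeasureTheory.SignedMeasure (Rn n)) (g u : Rn n → ℝ)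
    (uj μj gj : ℕ → Rn n → ℝ) : Prop :=
  (∀ j, ContDiff ℝ (⊤ : ℕ∞) (μj j) ∧ HasCompactSupport (μj j)) ∧
  (∀ j, ContDiff ℝ (⊤ : ℕ∞) (gj j) ∧ HasCompactSupport (gj j)) ∧
  (∀ j, WeakSol n Φ K s p Ω (μj j) (gj j) (uj j)) ∧
  (∀ᵐ x : Rn n, Tendsto (fun j => uj j x) atTop (𝓝 (u x))) ∧
  (∀ q : ℝ, qStar p ≤ q → q < qBar n s p → ∀ z : Rn n, ∀ r : ℝ, 0 < r →
    Tendsto (fun j => ∫⁻ x in ball z r, ENNReal.ofReal (|uj j x - u x| ^ q)) atTop (𝓝 0)) ∧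
  (∀ φ : Rn n → ℝ, Continuous φ → HasCompactSupport φ → tsupport φ ⊆ Ω →
    Tendsto (fun j => ∫ x : Rn n, φ x * μj j x) atTop (𝓝 (sintegral n μ φ))) ∧
  (∀ z : Rn n, ∀ r : ℝ, 0 < r →
    Filter.limsup (fun j => ∫⁻ x in ball z r, ENNReal.ofReal |μj j x|) atTop
      ≤ μ.totalVariation (closedBall z r)) ∧
  (∀ z : Rn n, ∀ r : ℝ, 0 < r →
    Tendsto (fun j =>
        (∫⁻ x in ball z r, ENNReal.ofReal (|gj j x - g x| ^ p)) +
          gagliardo n s p (ball z r) (fun x => gj j x - g x)) atTop (𝓝 0) ∧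
      Tendsto (fun j => tailFn n s p (fun x => gj j x - g x) z r) atTop (𝓝 0))

/-- SOLA of the Dirichlet problem `-L_Φ u = μ` in `Ω`, `u = g` on `ℝⁿ ∖ Ω`. -/
def IsSOLA (n : ℕ) (Φ : ℝ → ℝ) (K : Rn n → Rn n → ℝ) (s p : ℝ)
    (Ω : Set (Rn n)) (μ : MeasureTheory.SignedMeasure (Rn n)) (g u : Rn n → ℝ) : Prop :=
  (∀ h q : ℝ, 0 < h → h < s → qStar p ≤ q → q < qBar n s p → memWsp n h q Ω u) ∧
  (∀ φ : Rn n → ℝ, IsTestFun n Ω φ → nonlocalForm n Φ K u φ = sintegral n μ φ) ∧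
  (∀ᵐ x : Rn n, x ∉ Ω → u x = g x) ∧
  ∃ uj μj gj : ℕ → Rn n → ℝ, SOLAApprox n Φ K s p Ω μ g u uj μj gj

/-- Truncated Wolff potential `W^ν_{s,p}(x₀, r)`. -/
def wolff (n : ℕ) (s p : ℝ) (ν : Measure (Rn n)) (x₀ : Rn n) (r : ℝ) : ℝ≥0∞ :=
  ∫⁻ ρ in Ioc (0 : ℝ) r,
    (ν (ball x₀ ρ) / ENNReal.ofReal (ρ ^ ((n : ℝ) - s * p))) ^ (1 / (p - 1)) /
      ENNReal.ofReal ρ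

/-- Integral average of `u` over `B_r(x₀)`. -/
def ballAvg (n : ℕ) (u : Rn n → ℝ) (x₀ : Rn n) (r : ℝ) : ℝ :=
  ⨍ x in ball x₀ r, u x

/-- Local excess `A(f; x₀, r)`. -/
def locExcess (n : ℕ) (p : ℝ) (f : Rn n → ℝ) (x₀ : Rn n) (r : ℝ) : ℝ≥0∞ :=
  ((volume (ball x₀ r))⁻¹ *
      ∫⁻ x in ball x₀ r, ENNReal.ofReal (|f x - ballAvg n f x₀ r| ^ qStar p)) ^ (1 / qStar p)

/-- Global excess `E(f; x₀, r)`. -/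
def excess (n : ℕ) (s p : ℝ) (f : Rn n → ℝ) (x₀ : Rn n) (r : ℝ) : ℝ≥0∞ :=
  locExcess n p f x₀ r + tailFn n s p (fun x => f x - ballAvg n f x₀ r) x₀ r

/-- `g ∈ W^{s,p}_loc(ℝⁿ) ∩ L^{p-1}_{sp}(ℝⁿ)`. -/
def BoundaryDatum (n : ℕ) (s p : ℝ) (g : Rn n → ℝ) : Prop :=
  (∀ z : Rn n, ∀ r : ℝ, 0 < r → memWsp n s p (ball z r) g) ∧ memTailSpace n s p g

/-- Symmetric measurable kernel with ellipticity bounds. -/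
def SymKernel (n : ℕ) (Λ s p : ℝ) (Kt : Rn n → Rn n → ℝ) : Prop :=
  KernelBounds n Λ s p Kt ∧ ∀ x y : Rn n, Kt x y = Kt y x

/-- Weak solution of the kernel-`Kt` fractional `p`-Laplace equation with datum `f` in `O`. -/
def WeakSolP (n : ℕ) (Kt : Rn n → Rn n → ℝ) (s p : ℝ) (O : Set (Rn n))
    (f u : Rn n → ℝ) : Prop :=
  memWsp n s p univ u ∧
    ∀ φ : Rn n → ℝ, IsTestFun n O φ →
      (∫ x : Rn n, ∫ y : Rn n,
          |u x - u y| ^ (p - 2) * (u x - u y) * (φ x - φ y) * Kt x y) =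
        ∫ x : Rn n, φ x * f x

/-! ### Elementary inequalities -/

lemma exists_weighted_young {θ ε : ℝ} (h0 : 0 < θ) (h1 : θ < 1) (hε : 0 < ε) :
    ∃ C : ℝ, 0 < C ∧ ∀ X Y : ℝ, 0 ≤ X → 0 ≤ Y → X ^ θ * Y ^ (1 - θ) ≤ ε * X + C * Y := by
  refine ⟨ε ^ (-θ / (1 - θ)), by positivity, fun X Y hX hY => ?_⟩
  have h2 : (0:ℝ) < 1 - θ := by linarith
  set C := ε ^ (-θ / (1 - θ)) with hC
  have hC0 : 0 < C := by positivity
  have key := Real.geom_mean_le_arith_mean2_weighted h0.le h2.le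
    (mul_nonneg hε.le hX) (mul_nonneg hC0.le hY) (by ring)
  have hprod : (ε * X) ^ θ * (C * Y) ^ (1 - θ) = X ^ θ * Y ^ (1 - θ) := by
    rw [Real.mul_rpow hε.le hX, Real.mul_rpow hC0.le hY, hC, ← Real.rpow_mul hε.le,
      div_mul_cancel₀ _ h2.ne', Real.rpow_neg hε.le]
    field_simp
  rw [hprod] at key
  have e1 : θ * (ε * X) ≤ ε * X := by nlinarith [mul_nonneg hε.le hX]
  have e2 : (1 - θ) * (C * Y) ≤ C * Y := by nlinarith [mul_nonneg hC0.le hY]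
  linarith

lemma weighted_young {θ X Y : ℝ} (h0 : 0 < θ) (h1 : θ < 1) (hX : 0 ≤ X) (hY : 0 ≤ Y) :
    X ^ θ * Y ^ (1 - θ) ≤ X + Y := by
  have h2 : (0:ℝ) < 1 - θ := by linarith
  have key := Real.geom_mean_le_arith_mean2_weighted h0.le h2.le hX hY (by ring)
  nlinarith

lemma exists_rpow_le_eps_rpow {α β ε : ℝ} (h0 : 0 < α) (h1 : α < β) (hε : 0 < ε) :
    ∃ C : ℝ, 0 < C ∧ ∀ t : ℝ, 0 ≤ t → t ^ α ≤ ε * t ^ β + C := by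
  have hβ : 0 < β := h0.trans h1
  obtain ⟨C, hC, h⟩ := exists_weighted_young (θ := α / β) (by positivity)
    ((div_lt_one hβ).2 h1) hε
  refine ⟨C, hC, fun t ht => ?_⟩
  have := h (t ^ β) 1 (by positivity) zero_le_one
  rwa [← Real.rpow_mul ht, mul_div_cancel₀ _ hβ.ne', Real.one_rpow, mul_one, mul_one] at this

lemma rpow_le_one_add_rpow {α β t : ℝ} (h0 : 0 ≤ α) (h1 : α ≤ β) (ht : 0 ≤ t) :
    t ^ α ≤ 1 + t ^ β := by
  rcases le_total t 1 with h | h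
  · have := Real.rpow_le_one ht h h0
    have := Real.rpow_nonneg ht β
    linarith
  · have := Real.rpow_le_rpow_of_exponent_le h h1
    linarith

lemma add_rpow_le_two_rpow {p a b : ℝ} (hp : 0 ≤ p) (ha : 0 ≤ a) (hb : 0 ≤ b) :
    (a + b) ^ p ≤ 2 ^ p * (a ^ p + b ^ p) := by
  rcases le_total a b with h | h
  · calc (a + b) ^ p ≤ (2 * b) ^ p := by gcongr; linarith
      _ = 2 ^ p * b ^ p := Real.mul_rpow (by norm_num) hb
      _ ≤ _ := by gcongr; have := Real.rpow_nonneg ha p; linarith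
  · calc (a + b) ^ p ≤ (2 * a) ^ p := by gcongr; linarith
      _ = 2 ^ p * a ^ p := Real.mul_rpow (by norm_num) ha
      _ ≤ _ := by gcongr; have := Real.rpow_nonneg hb p; linarith

lemma abs_add_rpow_le {p : ℝ} (hp : 0 ≤ p) (a b : ℝ) :
    |a + b| ^ p ≤ 2 ^ p * (|a| ^ p + |b| ^ p) :=
  (Real.rpow_le_rpow (abs_nonneg _) (abs_add_le a b) hp).trans
    (add_rpow_le_two_rpow hp (abs_nonneg _) (abs_nonneg _))

lemma abs_sub_rpow_le {p : ℝ} (hp : 0 ≤ p) (a b : ℝ) :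
    |a - b| ^ p ≤ 2 ^ p * (|a| ^ p + |b| ^ p) := by
  simpa [sub_eq_add_neg] using abs_add_rpow_le hp a (-b)

lemma abs_rpow_sub_one_mul {p t : ℝ} (hp : 1 < p) : |t| ^ (p - 1) * |t| = |t| ^ p := by
  rcases eq_or_ne t 0 with rfl | h
  · simp [Real.zero_rpow (by linarith : p ≠ 0)]
  · have := abs_pos.2 h
    rw [Real.rpow_sub_one this.ne']; field_simp

lemma PhiBounds.mul_self_nonneg {Λ p : ℝ} {Φ : ℝ → ℝ} (hΦ : PhiBounds Λ p Φ) (hΛ : 1 ≤ Λ)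
    (t : ℝ) : 0 ≤ Φ t * t :=
  le_trans (by positivity) (hΦ.2.2 t).1

lemma PhiBounds.abs_le {Λ p : ℝ} {Φ : ℝ → ℝ} (hΦ : PhiBounds Λ p Φ) (hΛ : 1 ≤ Λ) (hp : 1 < p)
    (t : ℝ) : |Φ t| ≤ Λ * |t| ^ (p - 1) := by
  rcases eq_or_ne t 0 with rfl | h
  · simp [hΦ.2.1, Real.zero_rpow (by linarith : p - 1 ≠ 0)]
  have h1 := (hΦ.2.2 t).2
  rw [← abs_of_nonneg (hΦ.mul_self_nonneg hΛ t), abs_mul, ← abs_rpow_sub_one_mul hp,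
    ← mul_assoc] at h1
  exact le_of_mul_le_mul_right h1 (abs_pos.2 h)

lemma PhiBounds.le_abs {Λ p : ℝ} {Φ : ℝ → ℝ} (hΦ : PhiBounds Λ p Φ) (hΛ : 1 ≤ Λ) (hp : 1 < p)
    (t : ℝ) : |t| ^ (p - 1) / Λ ≤ |Φ t| := by
  rcases eq_or_ne t 0 with rfl | h
  · simp [hΦ.2.1, Real.zero_rpow (by linarith : p - 1 ≠ 0)]
  have h1 := (hΦ.2.2 t).1
  rw [← abs_of_nonneg (hΦ.mul_self_nonneg hΛ t), abs_mul, ← abs_rpow_sub_one_mul hp,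
    mul_div_right_comm] at h1
  exact le_of_mul_le_mul_right h1 (abs_pos.2 h)

lemma PhiBounds.exists_lower_bound {Λ p : ℝ} {Φ : ℝ → ℝ} (hΦ : PhiBounds Λ p Φ) (hΛ : 1 ≤ Λ)
    (hp : 1 < p) : ∃ c C : ℝ, 0 < c ∧ 0 < C ∧ ∀ a b : ℝ,
      c * |a - b| ^ p ≤ Φ a * (a - b) + C * (|b| ^ (p - 1) * |a - b|) ∧
      c * |a - b| ^ p ≤ Φ a * (a - b) + C * |b| ^ p := by
  have hΛ0 : 0 < Λ := by linarith
  set c : ℝ := (1 / 2) ^ (p - 1) / Λ with hc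
  have hc0 : 0 < c := by positivity
  set C : ℝ := 2 * (Λ * 3 ^ (p - 1) + c * 2 ^ (p - 1)) with hC
  have hC0 : 0 < C := by positivity
  refine ⟨c, C, hc0, hC0, fun a b => ?_⟩
  set t := a - b with ht
  have hp1 : 0 ≤ p - 1 := by linarith
  rcases le_or_gt (2 * |b|) |t| with h | h
  · have key : c * |t| ^ p ≤ Φ a * t := by
      have ha : |t| / 2 ≤ |a| := by
        have : |t| ≤ |a| + |b| := by rw [ht]; exact abs_sub a b
        linarith
      have hat : 0 ≤ a * t := by
        rcases abs_cases b with hb | hb <;> rcases abs_cases t with hb' | hb' <;> nlinarith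
      have hs : 0 ≤ Φ a * t := by
        rcases eq_or_ne a 0 with h0 | h0
        · simp [h0, hΦ.2.1]
        · have : 0 ≤ (Φ a * t) * (a * a) := by
            have := mul_nonneg (hΦ.mul_self_nonneg hΛ a) hat
            linarith [this]
          exact nonneg_of_mul_nonneg_left this (mul_self_pos.2 h0)
      rw [← abs_of_nonneg hs, abs_mul, ← abs_rpow_sub_one_mul hp, ← mul_assoc]
      gcongr
      refine le_trans ?_ (hΦ.le_abs hΛ hp a)
      rw [hc, div_mul_eq_mul_div, ← Real.mul_rpow (by norm_num) (abs_nonneg _)]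
      gcongr
      linarith
    constructor
    · have : 0 ≤ C * (|b| ^ (p - 1) * |t|) := by positivity
      linarith
    · have : 0 ≤ C * |b| ^ p := by positivity
      linarith
  · have ha : |a| ≤ 3 * |b| := by
      have : |a| ≤ |t| + |b| := by
        have := abs_add_le t b
        simpa [ht] using this
      linarith
    have h1 : -(Λ * 3 ^ (p - 1) * (|b| ^ (p - 1) * |t|)) ≤ Φ a * t := by
      have e1 : |Φ a| ≤ Λ * 3 ^ (p - 1) * |b| ^ (p - 1) := by
        rw [mul_assoc, ← Real.mul_rpow (by norm_num) (abs_nonneg _)]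
        exact (hΦ.abs_le hΛ hp a).trans (by gcongr)
      have e2 : |Φ a * t| ≤ Λ * 3 ^ (p - 1) * |b| ^ (p - 1) * |t| := by
        rw [abs_mul]; gcongr
      have := neg_abs_le (Φ a * t)
      nlinarith
    have h2 : c * |t| ^ p ≤ c * 2 ^ (p - 1) * (|b| ^ (p - 1) * |t|) := by
      rw [← abs_rpow_sub_one_mul hp, mul_assoc, ← mul_assoc (2 ^ (p - 1)),
        ← Real.mul_rpow (by norm_num) (abs_nonneg _)]
      gcongr
    have h3 : |b| ^ (p - 1) * |t| ≤ 2 * |b| ^ p := by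
      rw [← abs_rpow_sub_one_mul hp]
      have := Real.rpow_nonneg (abs_nonneg b) (p - 1)
      nlinarith
    have h4 : c * |t| ^ p ≤ Φ a * t + (C / 2) * (|b| ^ (p - 1) * |t|) := by
      rw [hC]; nlinarith
    have h5 : 0 ≤ |b| ^ (p - 1) * |t| := by positivity
    constructor <;> nlinarith

/-- A bounded increasing function whose difference quotients decay like `(1 + |t|) ^ (-ξ)`. -/
def slowTrunc (ξ t : ℝ) : ℝ := ∫ τ in (0 : ℝ)..t, (1 + |τ|) ^ (-ξ)

lemma continuous_one_add_abs_rpow (ξ : ℝ) : Continuous fun τ : ℝ => (1 + |τ|) ^ (-ξ) := by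
  refine Continuous.rpow_const (by fun_prop) fun x => Or.inl ?_
  positivity

lemma slowTrunc_zero (ξ : ℝ) : slowTrunc ξ 0 = 0 := by simp [slowTrunc]

lemma exists_slowTrunc_sub {ξ : ℝ} (hξ : 0 ≤ ξ) (a b : ℝ) :
    ∃ D : ℝ, (1 + |a| + |b|) ^ (-ξ) ≤ D ∧ D ≤ 1 ∧ slowTrunc ξ a - slowTrunc ξ b = D * (a - b) := by
  have hInt : ∀ a b : ℝ, IntervalIntegrable (fun τ : ℝ => (1 + |τ|) ^ (-ξ)) volume a b :=
    fun a b => (continuous_one_add_abs_rpow ξ).intervalIntegrable a b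
  have key : ∀ a b : ℝ, b < a → (1 + |a| + |b|) ^ (-ξ) * (a - b) ≤ slowTrunc ξ a - slowTrunc ξ b ∧
      slowTrunc ξ a - slowTrunc ξ b ≤ a - b := by
    intro a b hab
    have e : slowTrunc ξ a - slowTrunc ξ b = ∫ τ in b..a, (1 + |τ|) ^ (-ξ) := by
      rw [slowTrunc, slowTrunc, intervalIntegral.integral_interval_sub_left (hInt _ _) (hInt _ _)]
    rw [e]
    constructor
    · have : ∫ τ in b..a, (1 + |a| + |b|) ^ (-ξ) ≤ ∫ τ in b..a, (1 + |τ|) ^ (-ξ) := by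
        refine intervalIntegral.integral_mono_on hab.le (by simp) (hInt _ _) fun τ hτ => ?_
        refine Real.rpow_le_rpow_of_nonpos (by positivity) ?_ (by linarith)
        have : |τ| ≤ |a| + |b| := by
          rcases abs_cases τ with h | h <;> rcases abs_cases a with h' | h' <;>
            rcases abs_cases b with h'' | h'' <;> linarith [hτ.1, hτ.2]
        linarith
      simpa [mul_comm] using this
    · have : ∫ τ in b..a, (1 + |τ|) ^ (-ξ) ≤ ∫ τ in b..a, (1:ℝ) := by
        refine intervalIntegral.integral_mono_on hab.le (hInt _ _) (by simp) fun τ hτ => ?_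
        refine Real.rpow_le_one_of_one_le_of_nonpos ?_ (by linarith)
        have := abs_nonneg τ
        linarith
      simpa using this
  rcases lt_trichotomy a b with h | h | h
  · obtain ⟨h1, h2⟩ := key b a h
    have hb : 0 < b - a := by linarith
    refine ⟨(slowTrunc ξ b - slowTrunc ξ a) / (b - a), ?_, ?_, ?_⟩
    · rw [le_div_iff₀ hb, add_right_comm]; exact h1
    · rw [div_le_one hb]; exact h2
    · field_simp; ring
  · subst h
    exact ⟨1, Real.rpow_le_one_of_one_le_of_nonpos (by linarith [abs_nonneg a]) (by linarith),
      le_rfl, by simp⟩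
  · obtain ⟨h1, h2⟩ := key a b h
    have hb : 0 < a - b := by linarith
    refine ⟨(slowTrunc ξ a - slowTrunc ξ b) / (a - b), ?_, ?_, ?_⟩
    · rw [le_div_iff₀ hb]; exact h1
    · rw [div_le_one hb]; exact h2
    · field_simp

lemma abs_slowTrunc_sub_le {ξ : ℝ} (hξ : 0 ≤ ξ) (a b : ℝ) :
    |slowTrunc ξ a - slowTrunc ξ b| ≤ |a - b| := by
  obtain ⟨D, h1, h2, h3⟩ := exists_slowTrunc_sub hξ a b
  have h0 : 0 ≤ D := le_trans (by positivity) h1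
  rw [h3, abs_mul, abs_of_nonneg h0]
  nlinarith [abs_nonneg (a - b)]

lemma abs_slowTrunc_le {ξ : ℝ} (hξ : 0 ≤ ξ) (a : ℝ) : |slowTrunc ξ a| ≤ |a| := by
  simpa [slowTrunc_zero] using abs_slowTrunc_sub_le hξ a 0

lemma continuous_slowTrunc {ξ : ℝ} (hξ : 0 ≤ ξ) : Continuous (slowTrunc ξ) :=
  (LipschitzWith.of_dist_le_mul (K := 1) fun a b => by
    simpa [Real.dist_eq] using abs_slowTrunc_sub_le hξ a b).continuous

lemma exists_abs_slowTrunc_le {ξ : ℝ} (hξ : 1 < ξ) :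
    ∃ M : ℝ, 0 < M ∧ ∀ t, |slowTrunc ξ t| ≤ M := by
  have hInt : Integrable fun τ : ℝ => (1 + ‖τ‖) ^ (-ξ) :=
    integrable_one_add_norm (by simpa using hξ)
  refine ⟨(∫ τ : ℝ, (1 + ‖τ‖) ^ (-ξ)) + 1, ?_, fun t => ?_⟩
  · have : 0 ≤ ∫ τ : ℝ, (1 + ‖τ‖) ^ (-ξ) := integral_nonneg fun τ => by positivity
    linarith
  · have h1 : |slowTrunc ξ t| ≤ ∫ τ in Set.uIoc 0 t, ‖(1 + |τ|) ^ (-ξ)‖ := by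
      rw [slowTrunc, ← Real.norm_eq_abs]
      exact intervalIntegral.norm_integral_le_integral_norm_uIoc
    have h2 : ∫ τ in Set.uIoc 0 t, ‖(1 + |τ|) ^ (-ξ)‖ ≤ ∫ τ : ℝ, (1 + ‖τ‖) ^ (-ξ) := by
      have e : ∀ τ : ℝ, ‖(1 + |τ|) ^ (-ξ)‖ = (1 + ‖τ‖) ^ (-ξ) := fun τ => by
        rw [Real.norm_of_nonneg (by positivity)]; rfl
      simp_rw [e]
      exact setIntegral_le_integral hInt (Eventually.of_forall fun τ => by positivity)
    linarith

/-! ### Convergence of integrals -/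

lemma tendsto_lintegral_zero_of_small_remainder {α : Type*} [MeasurableSpace α] {ν : Measure α}
    {F : ℕ → α → ℝ≥0∞} (hF : ∀ k, AEMeasurable (F k) ν)
    (h0 : ∀ᵐ x ∂ν, Tendsto (fun k => F k x) atTop (𝓝 0))
    (h : ∀ ε : ℝ≥0∞, 0 < ε → ∃ (G : α → ℝ≥0∞) (S : ℕ → α → ℝ≥0∞), ∫⁻ x, G x ∂ν ≠ ⊤ ∧
      (∀ k, AEMeasurable (S k) ν) ∧ (∀ k, ∀ᵐ x ∂ν, F k x ≤ G x + S k x) ∧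
      ∀ᶠ k in atTop, ∫⁻ x, S k x ∂ν ≤ ε) :
    Tendsto (fun k => ∫⁻ x, F k x ∂ν) atTop (𝓝 0) := by
  rw [ENNReal.tendsto_nhds_zero]
  intro ε hε
  have hε2 : 0 < ε / 2 := ENNReal.half_pos hε.ne'
  obtain ⟨G, S, hG, hS, hFS, hSε⟩ := h (ε / 2) hε2
  have hlim : Tendsto (fun k => ∫⁻ x, (F k x - S k x) ∂ν) atTop (𝓝 (∫⁻ _, 0 ∂ν)) := by
    refine tendsto_lintegral_of_dominated_convergence' G (fun k => (hF k).sub (hS k)) ?_ hG ?_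
    · intro k
      filter_upwards [hFS k] with x hx
      exact tsub_le_iff_right.2 hx
    · filter_upwards [h0] with x hx
      exact tendsto_of_tendsto_of_tendsto_of_le_of_le tendsto_const_nhds hx
        (fun _ => zero_le) fun _ => tsub_le_self
  rw [lintegral_zero, ENNReal.tendsto_nhds_zero] at hlim
  filter_upwards [hlim (ε / 2) hε2, hSε] with k h1 h2
  calc ∫⁻ x, F k x ∂ν ≤ ∫⁻ x, ((F k x - S k x) + S k x) ∂ν :=
        lintegral_mono fun x => le_tsub_add
    _ = ∫⁻ x, (F k x - S k x) ∂ν + ∫⁻ x, S k x ∂ν := lintegral_add_right' _ (hS k)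
    _ ≤ ε / 2 + ε / 2 := add_le_add h1 h2
    _ = ε := ENNReal.add_halves ε

lemma lintegral_ofReal_liminf_le {α : Type*} [MeasurableSpace α] {ν : Measure α}
    {F : ℕ → α → ℝ} {G : α → ℝ} (hF : ∀ k, AEMeasurable (F k) ν)
    (h0 : ∀ᵐ x ∂ν, Tendsto (fun k => F k x) atTop (𝓝 (G x))) {C : ℝ≥0∞}
    (hC : ∀ k, ∫⁻ x, ENNReal.ofReal (F k x) ∂ν ≤ C) :
    ∫⁻ x, ENNReal.ofReal (G x) ∂ν ≤ C := by
  calc ∫⁻ x, ENNReal.ofReal (G x) ∂ν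
      = ∫⁻ x, liminf (fun k => ENNReal.ofReal (F k x)) atTop ∂ν := by
        refine lintegral_congr_ae ?_
        filter_upwards [h0] with x hx
        exact (((ENNReal.continuous_ofReal.tendsto _).comp hx).liminf_eq).symm
    _ ≤ liminf (fun k => ∫⁻ x, ENNReal.ofReal (F k x) ∂ν) atTop :=
        lintegral_liminf_le' fun k => (hF k).ennreal_ofReal
    _ ≤ C := by
        refine (liminf_le_limsup).trans (limsup_le_of_le (h := Eventually.of_forall hC))

/-! ### Riesz-type kernels on `ℝⁿ` -/

lemma lintegral_ball_norm_rpow_lt_top {n : ℕ} (hn : 1 ≤ n) {σ : ℝ} (hσ : 0 < σ) (R : ℝ) :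
    ∫⁻ y in ball (0 : Rn n) R, ENNReal.ofReal (‖y‖ ^ (σ - n)) < ⊤ := by
  have : Nontrivial (Rn n) := by
    have : Nonempty (Fin n) := ⟨⟨0, hn⟩⟩
    infer_instance
  have h : IntegrableOn (fun y : Rn n => ‖y‖ ^ (σ - n)) (ball 0 R) := by
    rw [integrableOn_fun_norm_addHaar (μ := volume) (f := fun r : ℝ => r ^ (σ - n))]
    have : IntegrableOn (fun y : ℝ => y ^ (σ - 1)) (Ioo 0 R) := by
      rcases le_or_gt R 0 with hR | hR
      · simp [Ioo_eq_empty (not_lt.2 hR)]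
      · rw [intervalIntegral.integrableOn_Ioo_rpow_iff hR]; linarith
    refine this.congr_fun (fun y hy => ?_) measurableSet_Ioo
    simp only [finrank_euclideanSpace, Fintype.card_fin, smul_eq_mul]
    rw [← Real.rpow_natCast, ← Real.rpow_add hy.1, Nat.cast_sub hn]
    congr 1; push_cast; ring
  have := h.2
  rw [hasFiniteIntegral_iff_ofReal (Eventually.of_forall fun y => by positivity)] at this
  exact this

lemma lintegral_compl_ball_rpow_lt_top {n : ℕ} {τ : ℝ} (hτ : 0 < τ) {R : ℝ} (hR : 1 ≤ R) :
    ∫⁻ y in (ball (0 : Rn n) R)ᶜ, ENNReal.ofReal (1 / ‖y‖ ^ (n + τ)) < ⊤ := by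
  have h : Integrable fun y : Rn n => 2 ^ (n + τ) * (1 + ‖y‖) ^ (-(n + τ)) :=
    (integrable_one_add_norm (by simpa using hτ)).const_mul _
  have h2 := h.2
  rw [hasFiniteIntegral_iff_ofReal (Eventually.of_forall fun y => by positivity)] at h2
  refine lt_of_le_of_lt ?_ h2
  refine le_trans (setLIntegral_mono' measurableSet_ball.compl fun y hy => ?_)
    (setLIntegral_le_lintegral _ _)
  refine ENNReal.ofReal_le_ofReal ?_
  have hy1 : 1 ≤ ‖y‖ := by
    simp at hy; linarith
  have hy0 : 0 < ‖y‖ := by linarith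
  rw [Real.rpow_neg (by positivity), ← div_eq_mul_inv, div_le_div_iff₀ (by positivity)
    (by positivity), one_mul, ← Real.mul_rpow (by norm_num) hy0.le]
  gcongr
  linarith

lemma exists_lintegral_ball_prod_le {n : ℕ} (hn : 1 ≤ n) {σ : ℝ} (hσ : 0 < σ) (R : ℝ) :
    ∃ C : ℝ≥0∞, C ≠ ⊤ ∧ ∀ W : Rn n → ℝ≥0∞,
      AEMeasurable W (volume.restrict (ball 0 R)) →
      ∫⁻ z in ball (0 : Rn n) R ×ˢ ball (0 : Rn n) R,
        W z.1 * ENNReal.ofReal (‖z.1 - z.2‖ ^ (σ - n)) ≤ C * ∫⁻ x in ball (0 : Rn n) R, W x := by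
  refine ⟨_, (lintegral_ball_norm_rpow_lt_top hn hσ (2 * R)).ne, fun W hW => ?_⟩
  have hmeas : Measurable fun z : Rn n × Rn n => ENNReal.ofReal (‖z.1 - z.2‖ ^ (σ - n)) := by
    fun_prop
  rw [Measure.volume_eq_prod, ← Measure.prod_restrict, lintegral_prod
    (fun z : Rn n × Rn n => W z.1 * ENNReal.ofReal (‖z.1 - z.2‖ ^ (σ - n)))
    (hW.comp_fst.mul hmeas.aemeasurable), ← lintegral_const_mul'' _ hW]
  refine setLIntegral_mono_ae' measurableSet_ball (Eventually.of_forall fun x hx => ?_)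
  dsimp only
  rw [lintegral_const_mul _ (by fun_prop), mul_comm]
  refine mul_le_mul_left ?_ _
  rw [← lintegral_indicator measurableSet_ball, ← lintegral_indicator measurableSet_ball,
    ← lintegral_sub_left_eq_self
      ((ball (0 : Rn n) (2 * R)).indicator fun y => ENNReal.ofReal (‖y‖ ^ (σ - n))) x]
  refine lintegral_mono fun y => ?_
  by_cases hy : y ∈ ball (0 : Rn n) R
  · have : x - y ∈ ball (0 : Rn n) (2 * R) := by
      simp only [mem_ball, dist_zero_right] at *
      have := norm_sub_le x y
      linarith
    simp [indicator_of_mem hy, indicator_of_mem this]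
  · simp [indicator_of_notMem hy]

lemma lintegral_prod_swap_set {n : ℕ} (A B : Set (Rn n)) (F : Rn n × Rn n → ℝ≥0∞) :
    ∫⁻ z in A ×ˢ B, F z = ∫⁻ z in B ×ˢ A, F z.swap := by
  have hmp : MeasurePreserving (MeasurableEquiv.prodComm : Rn n × Rn n ≃ᵐ Rn n × Rn n)
      (volume.restrict (B ×ˢ A)) (volume.restrict (A ×ˢ B)) := by
    have := (Measure.measurePreserving_swap (μ := (volume : Measure (Rn n)))
      (ν := (volume : Measure (Rn n)))).restrict_preimage_emb
        (MeasurableEquiv.prodComm : Rn n × Rn n ≃ᵐ Rn n × Rn n).measurableEmbedding (A ×ˢ B)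
    rwa [preimage_swap_prod] at this
  rw [← hmp.map_eq, lintegral_map_equiv]
  rfl

lemma lintegral_le_near_add_far {n : ℕ} {R : ℝ} (F : Rn n × Rn n → ℝ≥0∞)
    (hF : ∀ᵐ z : Rn n × Rn n, z.1 ∉ ball (0 : Rn n) R → z.2 ∉ ball (0 : Rn n) R → F z = 0) :
    ∫⁻ z, F z ≤ (∫⁻ z in ball (0 : Rn n) (2 * R) ×ˢ ball (0 : Rn n) (2 * R), F z) +
      ((∫⁻ z in ball (0 : Rn n) R ×ˢ (ball (0 : Rn n) (2 * R))ᶜ, F z) +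
       ∫⁻ z in (ball (0 : Rn n) (2 * R))ᶜ ×ˢ ball (0 : Rn n) R, F z) := by
  have hb : ∀ x : Rn n, x ∈ ball (0 : Rn n) R → x ∈ ball (0 : Rn n) (2 * R) := by
    intro x hx
    simp only [mem_ball, dist_zero_right] at *
    have := norm_nonneg x
    linarith
  set N : Set (Rn n × Rn n) := {z | z.1 ∉ ball (0 : Rn n) R ∧ z.2 ∉ ball (0 : Rn n) R} with hN
  have hNm : MeasurableSet N :=
    (measurable_fst measurableSet_ball.compl).inter (measurable_snd measurableSet_ball.compl)
  have h0 : ∫⁻ z in N, F z = 0 := by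
    rw [← lintegral_zero (μ := volume.restrict N)]
    refine setLIntegral_congr_fun_ae hNm ?_
    filter_upwards [hF] with z hz h
    exact hz h.1 h.2
  calc ∫⁻ z, F z = (∫⁻ z in N, F z) + ∫⁻ z in Nᶜ, F z := (lintegral_add_compl _ hNm).symm
    _ = ∫⁻ z in Nᶜ, F z := by rw [h0, zero_add]
    _ ≤ ∫⁻ z in (ball (0 : Rn n) (2 * R) ×ˢ ball (0 : Rn n) (2 * R)) ∪
        ((ball (0 : Rn n) R ×ˢ (ball (0 : Rn n) (2 * R))ᶜ) ∪
          ((ball (0 : Rn n) (2 * R))ᶜ ×ˢ ball (0 : Rn n) R)), F z := by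
        refine lintegral_mono_set fun z hz => ?_
        have h1 := hb z.1
        have h2 := hb z.2
        simp only [hN, mem_compl_iff, mem_ofPred_eq, not_and_or, not_not] at hz
        simp only [mem_union, mem_prod, mem_compl_iff]
        tauto
    _ ≤ _ := (lintegral_union_le _ _ _).trans
        (add_le_add_right (lintegral_union_le _ _ _) _)

lemma half_norm_le_norm_sub {n : ℕ} {R : ℝ} {x y : Rn n} (hx : x ∈ ball (0 : Rn n) R)
    (hy : y ∈ (ball (0 : Rn n) (2 * R))ᶜ) : ‖y‖ / 2 ≤ ‖x - y‖ ∧ 0 < ‖y‖ := by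
  simp only [mem_ball, dist_zero_right, mem_compl_iff, not_lt] at *
  have := norm_sub_norm_le y x
  rw [norm_sub_rev] at this
  have := norm_nonneg x
  constructor <;> linarith

lemma one_div_norm_sub_rpow_le {n : ℕ} {R τ : ℝ} (hτ : 0 ≤ τ) {x y : Rn n}
    (hx : x ∈ ball (0 : Rn n) R) (hy : y ∈ (ball (0 : Rn n) (2 * R))ᶜ) :
    1 / ‖x - y‖ ^ τ ≤ 2 ^ τ * (1 / ‖y‖ ^ τ) := by
  obtain ⟨h1, h2⟩ := half_norm_le_norm_sub hx hy
  have h3 : 0 < ‖x - y‖ := by linarith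
  rw [mul_one_div, div_le_div_iff₀ (by positivity) (by positivity), one_mul,
    ← Real.mul_rpow (by norm_num) h3.le]
  gcongr
  linarith

/-! ### Difference quotients and fractional Sobolev functions -/

/-- The integrand of the Gagliardo seminorm. -/
def diffQuot (n : ℕ) (s p : ℝ) (v : Rn n → ℝ) (z : Rn n × Rn n) : ℝ :=
  |v z.1 - v z.2| ^ p / ‖z.1 - z.2‖ ^ ((n : ℝ) + s * p)

section DiffQuot

variable {n : ℕ} {s p : ℝ}

lemma diffQuot_nonneg (v : Rn n → ℝ) (z : Rn n × Rn n) : 0 ≤ diffQuot n s p v z := by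
  unfold diffQuot; positivity

lemma aemeasurable_fst_sub_snd {v : Rn n → ℝ} (hv : AEMeasurable v) :
    AEMeasurable fun z : Rn n × Rn n => v z.1 - v z.2 :=
  (hv.comp_quasiMeasurePreserving Measure.quasiMeasurePreserving_fst).sub
    (hv.comp_quasiMeasurePreserving Measure.quasiMeasurePreserving_snd)

lemma aemeasurable_comp_fst {v : Rn n → ℝ} (hv : AEMeasurable v) :
    AEMeasurable fun z : Rn n × Rn n => v z.1 :=
  hv.comp_quasiMeasurePreserving Measure.quasiMeasurePreserving_fst

lemma aemeasurable_comp_snd {v : Rn n → ℝ} (hv : AEMeasurable v) :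
    AEMeasurable fun z : Rn n × Rn n => v z.2 :=
  hv.comp_quasiMeasurePreserving Measure.quasiMeasurePreserving_snd

lemma ae_comp_fst {P : Rn n → Prop} (h : ∀ᵐ x, P x) : ∀ᵐ z : Rn n × Rn n, P z.1 :=
  Measure.quasiMeasurePreserving_fst.ae h

lemma ae_comp_snd {P : Rn n → Prop} (h : ∀ᵐ x, P x) : ∀ᵐ z : Rn n × Rn n, P z.2 :=
  Measure.quasiMeasurePreserving_snd.ae h

lemma aemeasurable_diffQuot {v : Rn n → ℝ} (hv : AEMeasurable v) :
    AEMeasurable (diffQuot n s p v) := by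
  unfold diffQuot
  have := aemeasurable_fst_sub_snd hv
  have h2 : Measurable fun z : Rn n × Rn n => ‖z.1 - z.2‖ ^ ((n : ℝ) + s * p) := by fun_prop
  have h3 : AEMeasurable fun z : Rn n × Rn n => |v z.1 - v z.2| ^ p :=
    (continuous_abs.measurable.comp_aemeasurable this).pow_const p
  exact h3.div h2.aemeasurable

lemma aemeasurable_ofReal_diffQuot {v : Rn n → ℝ} (hv : AEMeasurable v) :
    AEMeasurable fun z => ENNReal.ofReal (diffQuot n s p v z) :=
  (aemeasurable_diffQuot hv).ennreal_ofReal

lemma aemeasurable_ofReal_abs_rpow {α : Type*} [MeasurableSpace α] {ν : Measure α} {v : α → ℝ}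
    (hv : AEMeasurable v ν) (q : ℝ) : AEMeasurable (fun x => ENNReal.ofReal (|v x| ^ q)) ν :=
  ((continuous_abs.measurable.comp_aemeasurable hv).pow_const q).ennreal_ofReal

lemma gagliardo_eq {v : Rn n → ℝ} (hv : AEMeasurable v) (O : Set (Rn n)) :
    gagliardo n s p O v = ∫⁻ z in O ×ˢ O, ENNReal.ofReal (diffQuot n s p v z) := by
  have hm : AEMeasurable (fun z => ENNReal.ofReal (diffQuot n s p v z))
      ((volume.restrict O).prod (volume.restrict O)) := by
    rw [Measure.prod_restrict, ← Measure.volume_eq_prod]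
    exact (aemeasurable_ofReal_diffQuot hv).restrict
  rw [Measure.volume_eq_prod, ← Measure.prod_restrict, lintegral_prod _ hm]
  rfl

lemma gagliardo_univ_eq {v : Rn n → ℝ} (hv : AEMeasurable v) :
    gagliardo n s p univ v = ∫⁻ z, ENNReal.ofReal (diffQuot n s p v z) := by
  rw [gagliardo_eq hv, univ_prod_univ, Measure.restrict_univ]

lemma memWsp_univ_iff {v : Rn n → ℝ} : memWsp n s p univ v ↔ AEMeasurable v ∧
    (∫⁻ x, ENNReal.ofReal (|v x| ^ p)) < ⊤ ∧
      ∫⁻ z, ENNReal.ofReal (diffQuot n s p v z) < ⊤ := by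
  unfold memWsp
  rw [Measure.restrict_univ]
  refine and_congr_right fun hv => and_congr_right fun _ => ?_
  rw [gagliardo_univ_eq hv]

lemma diffQuot_le_of_abs_le {v w : Rn n → ℝ} (hp : 0 ≤ p) {z : Rn n × Rn n}
    (h : |v z.1 - v z.2| ≤ |w z.1 - w z.2|) : diffQuot n s p v z ≤ diffQuot n s p w z := by
  unfold diffQuot
  gcongr

lemma diffQuot_add_le (hp : 0 ≤ p) (v w : Rn n → ℝ) (z : Rn n × Rn n) :
    diffQuot n s p (fun x => v x + w x) z ≤
      2 ^ p * (diffQuot n s p v z + diffQuot n s p w z) := by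
  unfold diffQuot
  rw [← add_div, ← mul_div_assoc]
  gcongr
  rw [show v z.1 + w z.1 - (v z.2 + w z.2) = (v z.1 - v z.2) + (w z.1 - w z.2) by ring]
  exact abs_add_rpow_le hp _ _

lemma diffQuot_sub_le (hp : 0 ≤ p) (v w : Rn n → ℝ) (z : Rn n × Rn n) :
    diffQuot n s p (fun x => v x - w x) z ≤
      2 ^ p * (diffQuot n s p v z + diffQuot n s p w z) := by
  unfold diffQuot
  rw [← add_div, ← mul_div_assoc]
  gcongr
  rw [show v z.1 - w z.1 - (v z.2 - w z.2) = (v z.1 - v z.2) - (w z.1 - w z.2) by ring]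
  exact abs_sub_rpow_le hp _ _

lemma diffQuot_const_mul (c : ℝ) (v : Rn n → ℝ) (z : Rn n × Rn n) :
    diffQuot n s p (fun x => c * v x) z = |c| ^ p * diffQuot n s p v z := by
  unfold diffQuot
  rw [← mul_sub, abs_mul, Real.mul_rpow (abs_nonneg _) (abs_nonneg _), mul_div_assoc]

lemma lintegral_ofReal_le_of_le_two_rpow {α : Type*} [MeasurableSpace α] {ν : Measure α}
    {f g h : α → ℝ} {c : ℝ} (hc : 0 ≤ c) (hg : ∀ x, 0 ≤ g x) (hh : ∀ x, 0 ≤ h x)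
    (hgm : AEMeasurable g ν) (hf : ∀ᵐ x ∂ν, f x ≤ c * (g x + h x)) :
    ∫⁻ x, ENNReal.ofReal (f x) ∂ν ≤ ENNReal.ofReal c *
      ((∫⁻ x, ENNReal.ofReal (g x) ∂ν) + ∫⁻ x, ENNReal.ofReal (h x) ∂ν) := by
  rw [← lintegral_add_left' hgm.ennreal_ofReal, ← lintegral_const_mul' _ _ ENNReal.ofReal_ne_top]
  refine lintegral_mono_ae ?_
  filter_upwards [hf] with x hx
  rw [← ENNReal.ofReal_add (hg x) (hh x), ← ENNReal.ofReal_mul hc]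
  exact ENNReal.ofReal_le_ofReal hx

lemma memWsp_univ_add (hp : 0 ≤ p) {v w : Rn n → ℝ} (hv : memWsp n s p univ v)
    (hw : memWsp n s p univ w) : memWsp n s p univ fun x => v x + w x := by
  rw [memWsp_univ_iff] at *
  refine ⟨hv.1.add hw.1, ?_, ?_⟩
  · refine lt_of_le_of_lt (lintegral_ofReal_le_of_le_two_rpow (c := 2 ^ p)
      (g := fun x => |v x| ^ p) (h := fun x => |w x| ^ p) (by positivity)
      (fun x => by positivity) (fun x => by positivity)
      ((continuous_abs.measurable.comp_aemeasurable hv.1).pow_const p)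
      (Eventually.of_forall fun x => abs_add_rpow_le hp (v x) (w x))) ?_
    exact ENNReal.mul_lt_top ENNReal.ofReal_lt_top (ENNReal.add_lt_top.2 ⟨hv.2.1, hw.2.1⟩)
  · refine lt_of_le_of_lt (lintegral_ofReal_le_of_le_two_rpow (c := 2 ^ p) (by positivity)
      (diffQuot_nonneg v) (diffQuot_nonneg w) (aemeasurable_diffQuot hv.1)
      (Eventually.of_forall fun x => diffQuot_add_le hp v w x)) ?_
    exact ENNReal.mul_lt_top ENNReal.ofReal_lt_top (ENNReal.add_lt_top.2 ⟨hv.2.2, hw.2.2⟩)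

lemma memWsp_univ_const_mul {v : Rn n → ℝ} (c : ℝ) (hv : memWsp n s p univ v) :
    memWsp n s p univ fun x => c * v x := by
  rw [memWsp_univ_iff] at *
  have hc : 0 ≤ |c| ^ p := by positivity
  refine ⟨hv.1.const_mul c, ?_, ?_⟩
  · simp_rw [abs_mul, Real.mul_rpow (abs_nonneg _) (abs_nonneg _), ENNReal.ofReal_mul hc]
    rw [lintegral_const_mul' _ _ ENNReal.ofReal_ne_top]
    exact ENNReal.mul_lt_top ENNReal.ofReal_lt_top hv.2.1
  · simp_rw [diffQuot_const_mul, ENNReal.ofReal_mul hc]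
    rw [lintegral_const_mul' _ _ ENNReal.ofReal_ne_top]
    exact ENNReal.mul_lt_top ENNReal.ofReal_lt_top hv.2.2

/-- A fractional Poincaré inequality for functions vanishing outside a ball. -/
lemma exists_poincare (hn : 1 ≤ n) (hs : 0 < s) (hp : 1 < p) {R : ℝ} (hR : 0 < R) :
    ∃ C : ℝ, 0 < C ∧ ∀ w : Rn n → ℝ, AEMeasurable w →
      (∀ᵐ x, x ∉ ball (0 : Rn n) R → w x = 0) →
      ∫⁻ x, ENNReal.ofReal (|w x| ^ p) ≤
        ENNReal.ofReal C * ∫⁻ z, ENNReal.ofReal (diffQuot n s p w z) := by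
  have : Nontrivial (Rn n) := by
    have : Nonempty (Fin n) := ⟨⟨0, hn⟩⟩
    infer_instance
  set A : Set (Rn n) := ball 0 (2 * R) \ ball 0 R with hA
  have hAm : MeasurableSet A := measurableSet_ball.diff measurableSet_ball
  have hA0 : 0 < volume A := by
    obtain ⟨v, hv⟩ := exists_norm_eq (Rn n) (c := 3 / 2 * R) (by positivity)
    refine lt_of_lt_of_le (measure_ball_pos volume v (r := R / 2) (by positivity))
      (measure_mono fun y hy => ?_)
    rw [mem_ball, dist_eq_norm] at hy
    have h1 := norm_sub_norm_le y v
    have h2 := norm_sub_norm_le v y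
    rw [norm_sub_rev] at h2
    simp only [hA, Set.mem_sdiff, mem_ball, dist_zero_right, not_lt]
    constructor <;> linarith
  have hAfin : volume A < ⊤ := lt_of_le_of_lt (measure_mono sdiff_subset) measure_ball_lt_top
  have hv : 0 < (volume A).toReal := ENNReal.toReal_pos hA0.ne' hAfin.ne
  set E : ℝ := n + s * p with hE
  have hE0 : 0 < E := by positivity
  refine ⟨(3 * R) ^ E / (volume A).toReal, by positivity, fun w hw hw0 => ?_⟩
  have hout : ∫⁻ x, ENNReal.ofReal (|w x| ^ p) =
      ∫⁻ x in ball (0 : Rn n) R, ENNReal.ofReal (|w x| ^ p) := by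
    rw [← lintegral_indicator measurableSet_ball]
    refine lintegral_congr_ae ?_
    filter_upwards [hw0] with x hx
    by_cases h : x ∈ ball (0 : Rn n) R
    · simp only [indicator_of_mem h]
    · simp [indicator_of_notMem h, hx h, Real.zero_rpow (by linarith : p ≠ 0)]
  have hprod : (∫⁻ x in ball (0 : Rn n) R, ENNReal.ofReal (|w x| ^ p)) * volume A =
      ∫⁻ z in ball (0 : Rn n) R ×ˢ A, ENNReal.ofReal (|w z.1| ^ p) := by
    have := lintegral_prod_mul (μ := (volume : Measure (Rn n)).restrict (ball 0 R))
      (ν := (volume : Measure (Rn n)).restrict A)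
      (f := fun x => ENNReal.ofReal (|w x| ^ p)) (g := fun _ => 1)
      (aemeasurable_ofReal_abs_rpow hw p).restrict aemeasurable_const
    simp only [mul_one, lintegral_const, Measure.restrict_apply_univ, one_mul] at this
    rw [Measure.volume_eq_prod, ← Measure.prod_restrict, this]
  have hle : ∫⁻ z in ball (0 : Rn n) R ×ˢ A, ENNReal.ofReal (|w z.1| ^ p) ≤
      ENNReal.ofReal ((3 * R) ^ E) * ∫⁻ z, ENNReal.ofReal (diffQuot n s p w z) := by
    rw [← lintegral_const_mul' _ _ ENNReal.ofReal_ne_top]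
    refine le_trans (setLIntegral_mono_ae' (measurableSet_ball.prod hAm) ?_)
      (setLIntegral_le_lintegral (ball (0 : Rn n) R ×ˢ A) _)
    filter_upwards [ae_comp_snd hw0] with z hz hzm
    have h2 : w z.2 = 0 := hz hzm.2.2
    rw [← ENNReal.ofReal_mul (by positivity)]
    refine ENNReal.ofReal_le_ofReal ?_
    have hz1 := hzm.1
    have hz2 := hzm.2
    simp only [hA, Set.mem_sdiff, mem_ball, dist_zero_right, not_lt] at hz1 hz2
    have hd0 : 0 < ‖z.1 - z.2‖ := by
      have := norm_sub_norm_le z.2 z.1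
      rw [norm_sub_rev] at this
      linarith
    have hd : ‖z.1 - z.2‖ ≤ 3 * R := (norm_sub_le _ _).trans (by linarith)
    unfold diffQuot
    rw [h2, sub_zero, ← hE, ← mul_div_assoc, le_div_iff₀ (by positivity), mul_comm]
    gcongr
  rw [hout, ENNReal.ofReal_div_of_pos hv, ENNReal.ofReal_toReal hAfin.ne,
    ← ENNReal.mul_div_right_comm, ENNReal.le_div_iff_mul_le (Or.inl hA0.ne') (Or.inl hAfin.ne),
    hprod]
  exact hle

/-- Passing from a weighted energy of order `(s, p)` to a seminorm of order `(h, q)`. -/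
lemma exists_lintegral_diffQuot_le (hn : 1 ≤ n) {h q ξ : ℝ} (hq : 0 < q) (hqp : q < p)
    (hhs : h < s) (hξ : 0 ≤ ξ) (R : ℝ) :
    ∃ C : ℝ≥0∞, C ≠ ⊤ ∧ ∀ w : Rn n → ℝ, AEMeasurable w →
      ∫⁻ z in ball (0 : Rn n) R ×ˢ ball (0 : Rn n) R, ENNReal.ofReal (diffQuot n h q w z) ≤
      (∫⁻ z in ball (0 : Rn n) R ×ˢ ball (0 : Rn n) R,
        ENNReal.ofReal (diffQuot n s p w z * (1 + |w z.1| + |w z.2|) ^ (-ξ))) +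
      C * ∫⁻ x in ball (0 : Rn n) R, ENNReal.ofReal (1 + |w x| ^ (ξ * q / (p - q))) := by
  have hp : 0 < p := hq.trans hqp
  have hpq : 0 < p - q := by linarith
  set r := ξ * q / (p - q) with hr
  have hr0 : 0 ≤ r := by positivity
  set σ := (s - h) * q * p / (p - q) with hσ
  have hσ0 : 0 < σ := by have : 0 < s - h := by linarith
                         positivity
  obtain ⟨C, hC, hCW⟩ := exists_lintegral_ball_prod_le hn hσ0 R
  refine ⟨ENNReal.ofReal (2 ^ r * 2 ^ r) * (C + C),
    ENNReal.mul_ne_top ENNReal.ofReal_ne_top (ENNReal.add_ne_top.2 ⟨hC, hC⟩), fun w hw => ?_⟩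
  set B := ball (0 : Rn n) R with hB
  set V : Rn n → ℝ≥0∞ := fun x => ENNReal.ofReal (1 + |w x| ^ r) with hV
  have hVm : AEMeasurable V := by
    have : AEMeasurable fun x => |w x| ^ r :=
      (continuous_abs.measurable.comp_aemeasurable hw).pow_const r
    exact (this.const_add 1).ennreal_ofReal
  have hker : Measurable fun z : Rn n × Rn n => ENNReal.ofReal (‖z.1 - z.2‖ ^ (σ - n)) := by
    fun_prop
  have hpt : ∀ z : Rn n × Rn n, diffQuot n h q w z ≤
      diffQuot n s p w z * (1 + |w z.1| + |w z.2|) ^ (-ξ) +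
        (2 ^ r * 2 ^ r) * ((1 + |w z.1| ^ r) * ‖z.1 - z.2‖ ^ (σ - n) +
          (1 + |w z.2| ^ r) * ‖z.1 - z.2‖ ^ (σ - n)) := by
    intro z
    rcases eq_or_ne z.1 z.2 with hz | hz
    · have : diffQuot n h q w z = 0 := by
        unfold diffQuot; simp [hz, Real.zero_rpow hq.ne']
      rw [this]
      have := diffQuot_nonneg (n := n) (s := s) (p := p) w z
      positivity
    set d := ‖z.1 - z.2‖ with hd
    have hd0 : 0 < d := norm_pos_iff.2 (sub_ne_zero.2 hz)
    set t := |w z.1 - w z.2| with ht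
    set W := 1 + |w z.1| + |w z.2| with hW
    have hW0 : 0 < W := by positivity
    have hy := weighted_young (θ := q / p) (X := t ^ p / d ^ (n + s * p) * W ^ (-ξ))
      (Y := W ^ r * d ^ (σ - n)) (by positivity) ((div_lt_one hp).2 hqp) (by positivity)
      (by positivity)
    have e : (t ^ p / d ^ (n + s * p) * W ^ (-ξ)) ^ (q / p) * (W ^ r * d ^ (σ - n)) ^ (1 - q / p) =
        t ^ q / d ^ (n + h * q) := by
      rw [Real.mul_rpow (by positivity) (by positivity), Real.div_rpow (by positivity)
        (by positivity), Real.mul_rpow (by positivity) (by positivity),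
        ← Real.rpow_mul (abs_nonneg _), ← Real.rpow_mul hd0.le, ← Real.rpow_mul hW0.le,
        ← Real.rpow_mul hW0.le, ← Real.rpow_mul hd0.le, mul_div_cancel₀ _ hp.ne']
      have e1 : r * (1 - q / p) = ξ * (q / p) := by rw [hr]; field_simp
      have e2 : (σ - n) * (1 - q / p) = (n + s * p) * (q / p) - (n + h * q) := by
        rw [hσ]; field_simp; ring
      rw [e1, e2, neg_mul, Real.rpow_neg hW0.le, Real.rpow_sub hd0]
      have : W ^ (ξ * (q / p)) ≠ 0 := by positivity
      have : d ^ ((n + s * p) * (q / p)) ≠ 0 := by positivity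
      field_simp
      rfl
    rw [e] at hy
    have hWr : W ^ r ≤ 2 ^ r * 2 ^ r * ((1 + |w z.1| ^ r) + (1 + |w z.2| ^ r)) := by
      have h1 := add_rpow_le_two_rpow hr0 (a := 1 + |w z.1|) (b := |w z.2|) (by positivity)
        (by positivity)
      have h2 := add_rpow_le_two_rpow hr0 (a := 1) (b := |w z.1|) (by positivity) (by positivity)
      rw [Real.one_rpow] at h2
      have h3 : (1:ℝ) ≤ 2 ^ r := Real.one_le_rpow (by norm_num) hr0
      have h4 : 0 ≤ |w z.2| ^ r := by positivity
      calc W ^ r ≤ 2 ^ r * ((1 + |w z.1|) ^ r + |w z.2| ^ r) := h1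
        _ ≤ 2 ^ r * (2 ^ r * (1 + |w z.1| ^ r) + 2 ^ r * (1 + |w z.2| ^ r)) := by
          gcongr
          nlinarith
        _ = _ := by ring
    have hfin : W ^ r * d ^ (σ - n) ≤ 2 ^ r * 2 ^ r * ((1 + |w z.1| ^ r) * d ^ (σ - n) +
        (1 + |w z.2| ^ r) * d ^ (σ - n)) := by
      rw [← add_mul, ← mul_assoc]
      gcongr
    exact hy.trans (by unfold diffQuot; linarith)
  have hm1 : AEMeasurable (fun z => ENNReal.ofReal (diffQuot n s p w z *
      (1 + |w z.1| + |w z.2|) ^ (-ξ))) (volume.restrict (B ×ˢ B)) := by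
    have h1 : AEMeasurable fun z : Rn n × Rn n => |w z.1| :=
      continuous_abs.measurable.comp_aemeasurable (aemeasurable_comp_fst hw)
    have h2 : AEMeasurable fun z : Rn n × Rn n => |w z.2| :=
      continuous_abs.measurable.comp_aemeasurable (aemeasurable_comp_snd hw)
    exact ((aemeasurable_diffQuot hw).mul
      (((h1.const_add 1).add h2).pow_const (-ξ))).ennreal_ofReal.restrict
  have hm2 : AEMeasurable (fun z : Rn n × Rn n => V z.1 * ENNReal.ofReal (‖z.1 - z.2‖ ^ (σ - n)))
      (volume.restrict (B ×ˢ B)) :=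
    ((hVm.comp_quasiMeasurePreserving Measure.quasiMeasurePreserving_fst).mul
      hker.aemeasurable).restrict
  have hsw : ∫⁻ z in B ×ˢ B, V z.2 * ENNReal.ofReal (‖z.1 - z.2‖ ^ (σ - n)) =
      ∫⁻ z in B ×ˢ B, V z.1 * ENNReal.ofReal (‖z.1 - z.2‖ ^ (σ - n)) := by
    rw [lintegral_prod_swap_set]
    simp only [Prod.fst_swap, Prod.snd_swap, norm_sub_rev]
  calc ∫⁻ z in B ×ˢ B, ENNReal.ofReal (diffQuot n h q w z)
      ≤ ∫⁻ z in B ×ˢ B, (ENNReal.ofReal (diffQuot n s p w z *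
        (1 + |w z.1| + |w z.2|) ^ (-ξ)) + ENNReal.ofReal (2 ^ r * 2 ^ r) *
          (V z.1 * ENNReal.ofReal (‖z.1 - z.2‖ ^ (σ - n)) +
            V z.2 * ENNReal.ofReal (‖z.1 - z.2‖ ^ (σ - n)))) := by
        refine lintegral_mono fun z => ?_
        have h0 := diffQuot_nonneg (n := n) (s := s) (p := p) w z
        simp only [hV]
        rw [← ENNReal.ofReal_mul (by positivity), ← ENNReal.ofReal_mul (by positivity),
          ← ENNReal.ofReal_add (by positivity) (by positivity),
          ← ENNReal.ofReal_mul (by positivity),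
          ← ENNReal.ofReal_add (by positivity) (by positivity)]
        exact ENNReal.ofReal_le_ofReal (hpt z)
    _ = (∫⁻ z in B ×ˢ B, ENNReal.ofReal (diffQuot n s p w z *
        (1 + |w z.1| + |w z.2|) ^ (-ξ))) + ENNReal.ofReal (2 ^ r * 2 ^ r) *
          ((∫⁻ z in B ×ˢ B, V z.1 * ENNReal.ofReal (‖z.1 - z.2‖ ^ (σ - n))) +
            ∫⁻ z in B ×ˢ B, V z.2 * ENNReal.ofReal (‖z.1 - z.2‖ ^ (σ - n))) := by
        rw [lintegral_add_left' hm1, lintegral_const_mul' _ _ ENNReal.ofReal_ne_top,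
          lintegral_add_left' hm2]
    _ ≤ _ := by
        rw [hsw, mul_assoc, add_mul]
        gcongr <;> exact hCW V hVm.restrict

end DiffQuot

/-! ### Compactness in `L¹` -/

section Compactness

variable {n : ℕ}

/-- The half-open cube of side `1 / m` with index `a`. -/
def gridCube (n m : ℕ) (a : Fin n → ℤ) : Set (Rn n) := {x | ∀ i, ⌊(m : ℝ) * x i⌋ = a i}

/-- The index of the cube of side `1 / m` containing `x`. -/
def gridIndex (n m : ℕ) (x : Rn n) : Fin n → ℤ := fun i => ⌊(m : ℝ) * x i⌋

lemma measurable_gridIndex (m : ℕ) : Measurable (gridIndex n m) := by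
  unfold gridIndex
  refine measurable_pi_lambda _ fun i => ?_
  have : Measurable fun x : Rn n => (m : ℝ) * x i := by fun_prop
  exact Int.measurable_floor.comp this

lemma measurableSet_gridCube (m : ℕ) (a : Fin n → ℤ) : MeasurableSet (gridCube n m a) := by
  have : gridCube n m a = gridIndex n m ⁻¹' {a} := by
    ext x; simp [gridCube, gridIndex, funext_iff]
  rw [this]
  exact measurable_gridIndex m (measurableSet_singleton a)

lemma volume_gridCube {m : ℕ} (hm : 0 < m) (a : Fin n → ℤ) :
    volume (gridCube n m a) = ENNReal.ofReal ((m : ℝ)⁻¹ ^ n) := by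
  have hm' : (0 : ℝ) < m := by exact_mod_cast hm
  have h : gridCube n m a = (WithLp.ofLp : Rn n → (Fin n → ℝ)) ⁻¹'
      (Set.pi univ fun i => Ico ((a i : ℝ) / m) (((a i : ℝ) + 1) / m)) := by
    ext x
    simp only [gridCube, mem_ofPred_eq, mem_preimage, Set.mem_pi, mem_univ, true_imp_iff, mem_Ico,
      Int.floor_eq_iff, div_le_iff₀ hm', lt_div_iff₀ hm', mul_comm]
  rw [h, (PiLp.volume_preserving_ofLp (Fin n)).measure_preimage
    (MeasurableSet.univ_pi fun _ => measurableSet_Ico).nullMeasurableSet, Real.volume_pi_Ico]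
  have : ∀ i, ((a i : ℝ) + 1) / m - (a i : ℝ) / m = (m : ℝ)⁻¹ := fun i => by field_simp; ring
  simp only [this, Finset.prod_const, Finset.card_univ, Fintype.card_fin]
  rw [ENNReal.ofReal_pow (by positivity)]

lemma norm_sub_le_of_mem_gridCube {m : ℕ} (hm : 0 < m) {a : Fin n → ℤ} {x y : Rn n}
    (hx : x ∈ gridCube n m a) (hy : y ∈ gridCube n m a) : ‖x - y‖ ≤ n / m := by
  have hm' : (0 : ℝ) < m := by exact_mod_cast hm
  have h : ∀ i, ‖(x - y) i‖ ≤ 1 / m := fun i => by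
    have h1 := Int.abs_sub_lt_one_of_floor_eq_floor ((hx i).trans (hy i).symm)
    rw [← mul_sub, abs_mul, abs_of_pos hm'] at h1
    rw [Real.norm_eq_abs, le_div_iff₀ hm', mul_comm]
    exact h1.le
  rw [EuclideanSpace.norm_eq]
  refine Real.sqrt_le_iff.2 ⟨by positivity, ?_⟩
  calc ∑ i, ‖(x - y) i‖ ^ 2 ≤ ∑ _i : Fin n, (1 / (m : ℝ)) ^ 2 :=
        Finset.sum_le_sum fun i _ => by gcongr; exact h i
    _ = n * (1 / (m : ℝ)) ^ 2 := by simp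
    _ ≤ (n * n) * (1 / (m : ℝ)) ^ 2 := by
        gcongr
        exact_mod_cast Nat.le_mul_self n
    _ = _ := by ring

/-- The function obtained by averaging on the cubes of side `1 / m`. -/
def gridAvg (m : ℕ) (w : Rn n → ℝ) (x : Rn n) : ℝ :=
  (m : ℝ) ^ n * ∫ y in gridCube n m (gridIndex n m x), w y

lemma mem_gridCube_gridIndex (m : ℕ) (x : Rn n) : x ∈ gridCube n m (gridIndex n m x) :=
  fun _ => rfl

lemma enorm_sub_gridAvg_le {m : ℕ} (hm : 0 < m) {h : ℝ} (hh : 0 < h) {w : Rn n → ℝ}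
    (hw : Integrable w) {R : ℝ} (hR : (n : ℝ) ≤ R) {x : Rn n} (hx : x ∈ ball 0 R) :
    ‖w x - gridAvg m w x‖ₑ ≤ ENNReal.ofReal ((n : ℝ) ^ (n + h) * (m : ℝ) ^ (-h)) *
      ∫⁻ y in ball (0 : Rn n) (2 * R),
        ENNReal.ofReal (|w x - w y| ^ (1 : ℝ) / ‖x - y‖ ^ (n + h * 1)) := by
  have hm' : (0 : ℝ) < m := by exact_mod_cast hm
  set Q := gridCube n m (gridIndex n m x) with hQ
  have hQm : MeasurableSet Q := measurableSet_gridCube _ _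
  have hvol : volume Q = ENNReal.ofReal ((m : ℝ)⁻¹ ^ n) := volume_gridCube hm _
  have hreal : (volume.restrict Q).real univ = (m : ℝ)⁻¹ ^ n := by
    rw [measureReal_def, Measure.restrict_apply_univ, hvol,
      ENNReal.toReal_ofReal (by positivity)]
  have : IsFiniteMeasure (volume.restrict Q) :=
    ⟨by rw [Measure.restrict_apply_univ, hvol]; exact ENNReal.ofReal_lt_top⟩
  have e : w x - gridAvg m w x = (m : ℝ) ^ n * ∫ y in Q, (w x - w y) := by
    rw [integral_sub (integrable_const _) hw.restrict, integral_const, hreal, gridAvg,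
      smul_eq_mul, mul_sub, ← mul_assoc, ← mul_pow, mul_inv_cancel₀ hm'.ne', one_pow, one_mul]
  have hsub : Q ⊆ ball (0 : Rn n) (2 * R) := fun y hy => by
    have h1 := norm_sub_le_of_mem_gridCube hm hy (mem_gridCube_gridIndex m x)
    rw [mem_ball_zero_iff] at hx ⊢
    have h2 : (n : ℝ) / m ≤ n := div_le_self (by positivity) (by exact_mod_cast hm)
    have h3 := norm_sub_norm_le y x
    linarith
  rw [e, enorm_mul]
  calc ‖(m : ℝ) ^ n‖ₑ * ‖∫ y in Q, (w x - w y)‖ₑ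
      ≤ ENNReal.ofReal ((m : ℝ) ^ n) * ∫⁻ y in Q, ‖w x - w y‖ₑ := by
        gcongr
        · rw [← ofReal_norm, Real.norm_of_nonneg (by positivity)]
        · exact enorm_integral_le_lintegral_enorm _
    _ ≤ ENNReal.ofReal ((m : ℝ) ^ n) * ∫⁻ y in Q, ENNReal.ofReal (((n : ℝ) / m) ^ (n + h)) *
        ENNReal.ofReal (|w x - w y| ^ (1 : ℝ) / ‖x - y‖ ^ (n + h * 1)) := by
        refine mul_le_mul_right (setLIntegral_mono' hQm ?_) _
        intro y hy
        rw [← ofReal_norm, Real.norm_eq_abs, ← ENNReal.ofReal_mul (by positivity)]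
        refine ENNReal.ofReal_le_ofReal ?_
        rcases eq_or_ne x y with hxy | hxy
        · simp [hxy]
        have hd : 0 < ‖x - y‖ := norm_pos_iff.2 (sub_ne_zero.2 hxy)
        rw [Real.rpow_one, mul_one, ← mul_div_assoc, le_div_iff₀ (by positivity), mul_comm]
        gcongr
        exact norm_sub_le_of_mem_gridCube hm (mem_gridCube_gridIndex m x) hy
    _ = ENNReal.ofReal ((n : ℝ) ^ (n + h) * (m : ℝ) ^ (-h)) * ∫⁻ y in Q,
        ENNReal.ofReal (|w x - w y| ^ (1 : ℝ) / ‖x - y‖ ^ (n + h * 1)) := by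
        rw [lintegral_const_mul' _ _ ENNReal.ofReal_ne_top, ← mul_assoc,
          ← ENNReal.ofReal_mul (by positivity)]
        congr 2
        rw [Real.div_rpow (by positivity) hm'.le, Real.rpow_add hm', Real.rpow_natCast,
          Real.rpow_neg hm'.le]
        field_simp
    _ ≤ _ := by gcongr

lemma aemeasurable_gridAvg (m : ℕ) (w : Rn n → ℝ) : Measurable (gridAvg m w) := by
  have h : Measurable fun a : Fin n → ℤ => (m : ℝ) ^ n * ∫ y in gridCube n m a, w y :=
    measurable_of_countable _
  exact h.comp (measurable_gridIndex m)

/-- A sequence with summable `L¹` increments converges almost everywhere. -/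
lemma ae_exists_tendsto_of_lintegral_le {α : Type*} [MeasurableSpace α] {ν : Measure α}
    {w : ℕ → α → ℝ} (hw : ∀ k, AEMeasurable (w k) ν)
    (h : ∀ k, ∫⁻ x, ‖w k x - w (k + 1) x‖ₑ ∂ν ≤ 2⁻¹ ^ k) :
    ∀ᵐ x ∂ν, ∃ l, Tendsto (fun k => w k x) atTop (𝓝 l) := by
  have hfin : ∫⁻ x, ∑' k, ‖w k x - w (k + 1) x‖ₑ ∂ν ≠ ⊤ := by
    have e := lintegral_tsum (μ := ν) (f := fun k x => ‖w k x - w (k + 1) x‖ₑ)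
      fun k => ((hw k).sub (hw (k + 1))).enorm
    rw [e]
    refine ne_top_of_le_ne_top ?_ (ENNReal.tsum_le_tsum h)
    rw [ENNReal.tsum_geometric, ENNReal.one_sub_inv_two, inv_inv]
    exact ENNReal.ofNat_ne_top
  filter_upwards [ae_lt_top' (AEMeasurable.tsum
    fun k => ((hw k).sub (hw (k + 1))).enorm) hfin] with x hx
  refine cauchySeq_tendsto_of_complete (cauchySeq_of_edist_le_of_tsum_ne_top _
    (fun k => ?_) hx.ne)
  rw [edist_eq_enorm_sub]
  rfl

lemma exists_subseq_ae_tendsto {h : ℝ} (hh : 0 < h) {R : ℝ} (hR : (n : ℝ) ≤ R)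
    {w : ℕ → Rn n → ℝ} (hw : ∀ k, AEMeasurable (w k))
    (hw0 : ∀ k, ∀ᵐ x, x ∉ ball (0 : Rn n) R → w k x = 0) {C : ℝ≥0∞} (hC : C ≠ ⊤)
    (hw1 : ∀ k, ∫⁻ x, ENNReal.ofReal |w k x| ≤ C)
    (hw2 : ∀ k, ∫⁻ z in ball (0 : Rn n) (2 * R) ×ˢ ball (0 : Rn n) (2 * R),
      ENNReal.ofReal (diffQuot n h 1 (w k) z) ≤ C) :
    ∃ φ : ℕ → ℕ, StrictMono φ ∧ ∃ w₀ : Rn n → ℝ, Measurable w₀ ∧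
      ∀ᵐ x, Tendsto (fun k => w (φ k) x) atTop (𝓝 (w₀ x)) := by
  have hwi : ∀ k, Integrable (w k) := fun k => by
    refine ⟨(hw k).aestronglyMeasurable, lt_of_le_of_lt ?_ hC.lt_top⟩
    refine le_trans (le_of_eq (lintegral_congr fun x => ?_)) (hw1 k)
    rw [← ofReal_norm, Real.norm_eq_abs]
  set B := ball (0 : Rn n) R with hB
  set CR := C.toReal with hCR
  have hInt : ∀ k, ∫ x, |w k x| ≤ CR := fun k => by
    rw [integral_eq_lintegral_of_nonneg_ae (Eventually.of_forall fun x => abs_nonneg _)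
      (hwi k).abs.aestronglyMeasurable]
    exact ENNReal.toReal_mono hC (hw1 k)
  have hbd : ∀ k (m : ℕ) (a : Fin n → ℤ), |(m : ℝ) ^ n * ∫ y in gridCube n m a, w k y| ≤
      (m : ℝ) ^ n * CR := fun k m a => by
    rw [abs_mul, abs_of_nonneg (by positivity : (0:ℝ) ≤ (m:ℝ) ^ n)]
    gcongr
    exact (abs_integral_le_integral_abs).trans ((setIntegral_le_integral (hwi k).abs
      (Eventually.of_forall fun x => abs_nonneg _)).trans (hInt k))
  -- extraction of a subsequence along which all averages converge
  have hcomp : IsCompact (Set.pi univ fun i : ℕ × (Fin n → ℤ) =>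
      Icc (-((i.1 : ℝ) ^ n * CR)) ((i.1 : ℝ) ^ n * CR)) :=
    isCompact_univ_pi fun _ => isCompact_Icc
  obtain ⟨L, -, φ, hφ, hL⟩ := hcomp.tendsto_subseq
    (x := fun k i => (i.1 : ℝ) ^ n * ∫ y in gridCube n i.1 i.2, w k y)
    (fun k i _ => abs_le.1 (hbd k i.1 i.2))
  rw [tendsto_pi_nhds] at hL
  have havg : ∀ (m : ℕ) x, Tendsto (fun k => gridAvg m (w (φ k)) x) atTop
      (𝓝 (L (m, gridIndex n m x))) := fun m x => hL (m, gridIndex n m x)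
  have happ : ∀ m : ℕ, 0 < m → ∀ k, ∫⁻ x in B, ‖w k x - gridAvg m (w k) x‖ₑ ≤
      ENNReal.ofReal ((n : ℝ) ^ (n + h) * (m : ℝ) ^ (-h)) * C := fun m hm k => by
    refine (setLIntegral_mono' measurableSet_ball fun x hx =>
      enorm_sub_gridAvg_le hm hh (hwi k) hR hx).trans ?_
    rw [lintegral_const_mul' _ _ ENNReal.ofReal_ne_top]
    gcongr
    have h0 : (0:ℝ) ≤ n := by positivity
    have h1 := hw2 k
    rw [← gagliardo_eq (hw k)] at h1
    exact (lintegral_mono_set (ball_subset_ball (by linarith))).trans h1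
  have hcauchy : ∀ ε : ℝ≥0∞, 0 < ε → ∃ N, ∀ k ≥ N, ∀ l ≥ N,
      ∫⁻ x in B, ‖w (φ k) x - w (φ l) x‖ₑ ≤ ε := by
    intro ε hε
    have hε4 : (0 : ℝ≥0∞) < ε / 4 := ENNReal.div_pos hε.ne' (by norm_num)
    have hlim : Tendsto (fun m : ℕ => ENNReal.ofReal ((n : ℝ) ^ (n + h) * (m : ℝ) ^ (-h)) * C)
        atTop (𝓝 0) := by
      have h1 : Tendsto (fun m : ℕ => (n : ℝ) ^ (n + h) * (m : ℝ) ^ (-h)) atTop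
          (𝓝 ((n : ℝ) ^ (n + h) * 0)) :=
        ((tendsto_rpow_neg_atTop hh).comp tendsto_natCast_atTop_atTop).const_mul _
      have h2 := ENNReal.Tendsto.mul_const (b := C) (ENNReal.tendsto_ofReal h1) (Or.inr hC)
      simpa using h2
    obtain ⟨m, hm, hmε⟩ := ((eventually_gt_atTop 0).and
      (hlim.eventually_le_const hε4)).exists
    have hdom : Tendsto (fun k => ∫⁻ x in B,
        ‖gridAvg m (w (φ k)) x - L (m, gridIndex n m x)‖ₑ) atTop (𝓝 0) := by
      have hLm : Measurable fun x => L (m, gridIndex n m x) :=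
        (measurable_of_countable fun a => L (m, a)).comp (measurable_gridIndex m)
      have := tendsto_lintegral_of_dominated_convergence (μ := volume.restrict B)
        (F := fun k x => ‖gridAvg m (w (φ k)) x - L (m, gridIndex n m x)‖ₑ) (f := fun _ => 0)
        (fun _ => ENNReal.ofReal (2 * ((m : ℝ) ^ n * CR)))
        (fun k => ((aemeasurable_gridAvg m (w (φ k))).sub hLm).enorm)
        (fun k => Eventually.of_forall fun x => ?_) ?_ (Eventually.of_forall fun x => ?_)
      · simpa using this
      · beta_reduce
        rw [← ofReal_norm]
        refine ENNReal.ofReal_le_ofReal ((norm_sub_le _ _).trans ?_)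
        have h1 : ‖gridAvg m (w (φ k)) x‖ ≤ (m : ℝ) ^ n * CR := hbd _ _ _
        have h2 : ‖L (m, gridIndex n m x)‖ ≤ (m : ℝ) ^ n * CR :=
          le_of_tendsto (havg m x).norm (Eventually.of_forall fun k => hbd _ _ _)
        linarith
      · rw [lintegral_const]
        exact ENNReal.mul_ne_top ENNReal.ofReal_ne_top (by
          rw [Measure.restrict_apply_univ]; exact measure_ball_lt_top.ne)
      · have := ((havg m x).sub_const (L (m, gridIndex n m x))).enorm
        simpa using this
    obtain ⟨N, hN⟩ := eventually_atTop.1 (hdom.eventually_le_const hε4)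
    refine ⟨N, fun k hk l hl => ?_⟩
    have hms : ∀ k, AEMeasurable (fun x => ‖w (φ k) x - gridAvg m (w (φ k)) x‖ₑ)
        (volume.restrict B) := fun k =>
      ((hw _).sub (aemeasurable_gridAvg m (w (φ k))).aemeasurable).enorm.restrict
    have hms2 : ∀ k, AEMeasurable (fun x => ‖gridAvg m (w (φ k)) x - L (m, gridIndex n m x)‖ₑ)
        (volume.restrict B) := fun k =>
      ((aemeasurable_gridAvg m (w (φ k))).sub ((measurable_of_countable fun a => L (m, a)).comp
        (measurable_gridIndex m))).enorm.aemeasurable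
    calc ∫⁻ x in B, ‖w (φ k) x - w (φ l) x‖ₑ
        ≤ ∫⁻ x in B, ((‖w (φ k) x - gridAvg m (w (φ k)) x‖ₑ +
          ‖gridAvg m (w (φ k)) x - L (m, gridIndex n m x)‖ₑ) +
          (‖w (φ l) x - gridAvg m (w (φ l)) x‖ₑ +
          ‖gridAvg m (w (φ l)) x - L (m, gridIndex n m x)‖ₑ)) := by
          refine lintegral_mono fun x => ?_
          simp only [← edist_eq_enorm_sub]
          calc edist (w (φ k) x) (w (φ l) x) ≤ edist (w (φ k) x) (L (m, gridIndex n m x)) +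
                edist (L (m, gridIndex n m x)) (w (φ l) x) := edist_triangle _ _ _
            _ ≤ _ := by
                rw [edist_comm (L (m, gridIndex n m x)) (w (φ l) x)]
                exact add_le_add (edist_triangle _ _ _) (edist_triangle _ _ _)
      _ = ((∫⁻ x in B, ‖w (φ k) x - gridAvg m (w (φ k)) x‖ₑ) +
          ∫⁻ x in B, ‖gridAvg m (w (φ k)) x - L (m, gridIndex n m x)‖ₑ) +
          ((∫⁻ x in B, ‖w (φ l) x - gridAvg m (w (φ l)) x‖ₑ) +
          ∫⁻ x in B, ‖gridAvg m (w (φ l)) x - L (m, gridIndex n m x)‖ₑ) := by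
          rw [lintegral_add_left' (show AEMeasurable (fun _ => _ + _) _ from (hms k).add (hms2 k)),
            lintegral_add_left' (hms k),
            lintegral_add_left' (hms l)]
      _ ≤ (ε / 4 + ε / 4) + (ε / 4 + ε / 4) := by
          gcongr
          · exact (happ m hm _).trans hmε
          · exact hN k hk
          · exact (happ m hm _).trans hmε
          · exact hN l hl
      _ = ε := by
          rw [← mul_two, ← mul_two, mul_assoc, show (2 : ℝ≥0∞) * 2 = 4 by norm_num]
          exact ENNReal.div_mul_cancel (by norm_num) (by norm_num)
  choose N hN using fun j : ℕ => hcauchy (2⁻¹ ^ j) (ENNReal.pow_pos (by norm_num) j)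
  obtain ⟨ψ, hψ, hψN⟩ : ∃ ψ : ℕ → ℕ, StrictMono ψ ∧ ∀ j, N j ≤ ψ j :=
    extraction_forall_of_eventually fun j => eventually_ge_atTop (N j)
  have hconv : ∀ᵐ x ∂(volume.restrict B), ∃ l, Tendsto (fun k => w (φ (ψ k)) x) atTop (𝓝 l) :=
    ae_exists_tendsto_of_lintegral_le (fun k => (hw _).restrict) fun k =>
      hN k _ (hψN k) _ ((hψN k).trans (hψ (Nat.lt_succ_self k)).le)
  have hall : ∀ᵐ x, ∃ l, Tendsto (fun k => w (φ (ψ k)) x) atTop (𝓝 l) := by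
    filter_upwards [(ae_restrict_iff' measurableSet_ball).1 hconv, ae_all_iff.2 hw0] with x h1 h2
    by_cases hx : x ∈ B
    · exact h1 hx
    · exact ⟨0, by simp [h2 _ hx]⟩
  obtain ⟨w₀, hw₀, hlim⟩ := measurable_limit_of_tendsto_metrizable_ae (fun k => hw (φ (ψ k))) hall
  exact ⟨φ ∘ ψ, hφ.comp hψ, w₀, hw₀, hlim⟩

end Compactness

/-! ### Test functions, kernels and the energy functional -/

section Energy

variable {n : ℕ} {s p : ℝ}

lemma lintegral_prod_mul_set {a b : Rn n → ℝ≥0∞} (ha : AEMeasurable a) (hb : AEMeasurable b)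
    (A D : Set (Rn n)) :
    ∫⁻ z in A ×ˢ D, a z.1 * b z.2 = (∫⁻ x in A, a x) * ∫⁻ y in D, b y := by
  rw [Measure.volume_eq_prod, ← Measure.prod_restrict,
    lintegral_prod_mul ha.restrict hb.restrict]

lemma diffQuot_swap (v : Rn n → ℝ) (z : Rn n × Rn n) :
    diffQuot n s p v z.swap = diffQuot n s p v z := by
  unfold diffQuot
  rw [Prod.fst_swap, Prod.snd_swap, norm_sub_rev, abs_sub_comm]

lemma memWsp_univ_of_contDiff (hn : 1 ≤ n) (hs : 0 < s) (hs1 : s < 1) (hp : 1 < p)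
    {φ : Rn n → ℝ} (hφ : ContDiff ℝ (⊤ : ℕ∞) φ) (hc : HasCompactSupport φ) :
    memWsp n s p univ φ := by
  have hp0 : 0 < p := by linarith
  obtain ⟨L, hL⟩ := hφ.lipschitzWith_of_hasCompactSupport hc (by simp)
  obtain ⟨M, hM⟩ := hφ.continuous.bounded_above_of_compact_support hc
  obtain ⟨R₀, hR₀⟩ := hc.isBounded.subset_ball (0 : Rn n)
  set R := max R₀ 1 with hR
  have hR1 : 1 ≤ R := le_max_right _ _
  have hout : ∀ x, x ∉ ball (0 : Rn n) R → φ x = 0 := fun x hx =>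
    image_eq_zero_of_notMem_tsupport fun h => hx (ball_subset_ball (le_max_left _ _) (hR₀ h))
  have hM0 : 0 ≤ M := (norm_nonneg _).trans (hM 0)
  have hm : AEMeasurable φ := hφ.continuous.measurable.aemeasurable
  rw [memWsp_univ_iff]
  refine ⟨hm, ?_, ?_⟩
  · calc ∫⁻ x, ENNReal.ofReal (|φ x| ^ p)
        ≤ ∫⁻ x, (ball (0 : Rn n) R).indicator (fun _ => ENNReal.ofReal (M ^ p)) x := by
          refine lintegral_mono fun x => ?_
          by_cases hx : x ∈ ball (0 : Rn n) R
          · rw [indicator_of_mem hx]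
            have := hM x
            rw [Real.norm_eq_abs] at this
            exact ENNReal.ofReal_le_ofReal (by gcongr)
          · simp [hout x hx, Real.zero_rpow hp0.ne']
      _ < ⊤ := by
          rw [lintegral_indicator measurableSet_ball, setLIntegral_const]
          exact ENNReal.mul_lt_top ENNReal.ofReal_lt_top measure_ball_lt_top
  have hσ : 0 < p * (1 - s) := mul_pos hp0 (by linarith)
  obtain ⟨C, hC, hCW⟩ := exists_lintegral_ball_prod_le hn hσ (2 * R)
  have hfar : ∫⁻ z in ball (0 : Rn n) R ×ˢ (ball (0 : Rn n) (2 * R))ᶜ,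
      ENNReal.ofReal (diffQuot n s p φ z) < ⊤ := by
    have hsp : 0 < s * p := by positivity
    calc ∫⁻ z in ball (0 : Rn n) R ×ˢ (ball (0 : Rn n) (2 * R))ᶜ,
          ENNReal.ofReal (diffQuot n s p φ z)
        ≤ ∫⁻ z in ball (0 : Rn n) R ×ˢ (ball (0 : Rn n) (2 * R))ᶜ,
          ENNReal.ofReal (M ^ p * 2 ^ (n + s * p)) *
            ENNReal.ofReal (1 / ‖z.2‖ ^ (n + s * p)) := by
          refine setLIntegral_mono' (measurableSet_ball.prod measurableSet_ball.compl) ?_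
          intro z hz
          have h2 : φ z.2 = 0 := hout _ fun h => hz.2 (ball_subset_ball (by linarith) h)
          rw [← ENNReal.ofReal_mul (by positivity)]
          refine ENNReal.ofReal_le_ofReal ?_
          have h3 := one_div_norm_sub_rpow_le (τ := n + s * p) (by positivity) hz.1 hz.2
          have h4 := hM z.1
          rw [Real.norm_eq_abs] at h4
          unfold diffQuot
          rw [h2, sub_zero, div_eq_mul_one_div, mul_assoc]
          gcongr
      _ = (∫⁻ _ in ball (0 : Rn n) R, ENNReal.ofReal (M ^ p * 2 ^ (n + s * p))) *
          ∫⁻ y in (ball (0 : Rn n) (2 * R))ᶜ, ENNReal.ofReal (1 / ‖y‖ ^ (n + s * p)) :=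
          lintegral_prod_mul_set (b := fun y : Rn n => ENNReal.ofReal (1 / ‖y‖ ^ (n + s * p)))
            aemeasurable_const (by fun_prop) _ _
      _ < ⊤ := by
          rw [setLIntegral_const]
          exact ENNReal.mul_lt_top (ENNReal.mul_lt_top ENNReal.ofReal_lt_top measure_ball_lt_top)
            (lintegral_compl_ball_rpow_lt_top hsp (by linarith))
  refine lt_of_le_of_lt (lintegral_le_near_add_far (R := R) _
    (Eventually.of_forall fun z h1 h2 => ?_)) (ENNReal.add_lt_top.2 ⟨?_,
      ENNReal.add_lt_top.2 ⟨hfar, ?_⟩⟩)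
  · simp [diffQuot, hout _ h1, hout _ h2, Real.zero_rpow hp0.ne']
  · refine lt_of_le_of_lt (le_trans (lintegral_mono fun z => ?_)
      (hCW (fun _ => ENNReal.ofReal (L ^ p)) aemeasurable_const)) ?_
    · rw [← ENNReal.ofReal_mul (by positivity)]
      refine ENNReal.ofReal_le_ofReal ?_
      unfold diffQuot
      rcases eq_or_ne z.1 z.2 with h | h
      · rw [h]; simp only [sub_self, abs_zero, Real.zero_rpow hp0.ne', zero_div]
        positivity
      have hd : 0 < ‖z.1 - z.2‖ := norm_pos_iff.2 (sub_ne_zero.2 h)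
      have h1 := hL.dist_le_mul z.1 z.2
      rw [Real.dist_eq, dist_eq_norm] at h1
      calc |φ z.1 - φ z.2| ^ p / ‖z.1 - z.2‖ ^ (n + s * p)
          ≤ (L * ‖z.1 - z.2‖) ^ p / ‖z.1 - z.2‖ ^ (n + s * p) := by gcongr
        _ = L ^ p * ‖z.1 - z.2‖ ^ (p * (1 - s) - n) := by
          rw [Real.mul_rpow (by positivity) hd.le, mul_div_assoc, ← Real.rpow_sub hd]
          ring_nf
    · rw [setLIntegral_const]
      exact ENNReal.mul_lt_top hC.lt_top (ENNReal.mul_lt_top ENNReal.ofReal_lt_top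
        measure_ball_lt_top)
  · rw [lintegral_prod_swap_set]
    simpa only [diffQuot_swap] using hfar

lemma ae_fst_ne_snd (hn : 1 ≤ n) : ∀ᵐ z : Rn n × Rn n, z.1 ≠ z.2 := by
  have : Nonempty (Fin n) := ⟨⟨0, hn⟩⟩
  have hm : MeasurableSet {z : Rn n × Rn n | z.1 ≠ z.2} :=
    (measurableSet_eq_fun measurable_fst measurable_snd).compl
  rw [Measure.volume_eq_prod, Measure.ae_prod_iff_ae_ae hm]
  refine Eventually.of_forall fun x => ?_
  have h : ∀ᵐ y : Rn n, y ∈ ({x} : Set (Rn n))ᶜ := compl_mem_ae_iff.2 (measure_singleton x)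
  filter_upwards [h] with y hy
  exact fun h => hy h.symm

lemma KernelBounds.ae_bounds {Λ : ℝ} {K : Rn n → Rn n → ℝ} (hK : KernelBounds n Λ s p K)
    (hn : 1 ≤ n) (hΛ : 1 ≤ Λ) : ∀ᵐ z : Rn n × Rn n, 0 < ‖z.1 - z.2‖ ∧ 0 ≤ K z.1 z.2 ∧
      1 / ‖z.1 - z.2‖ ^ (n + s * p) ≤ Λ * K z.1 z.2 ∧
      K z.1 z.2 ≤ Λ * (1 / ‖z.1 - z.2‖ ^ (n + s * p)) := by
  filter_upwards [ae_fst_ne_snd hn] with z hz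
  have hd : 0 < ‖z.1 - z.2‖ := norm_pos_iff.2 (sub_ne_zero.2 hz)
  obtain ⟨h1, h2⟩ := hK.2 z.1 z.2 hz
  have hΛ0 : 0 < Λ := by linarith
  refine ⟨hd, le_trans (by positivity) h1, ?_, by rw [mul_one_div]; exact h2⟩
  rw [one_div, mul_inv, ← one_div, one_div_mul_eq_div, div_le_iff₀ hΛ0] at h1
  rw [one_div]; linarith

/-- The primitive of `Φ` vanishing at the origin. -/
def primitive (Φ : ℝ → ℝ) (t : ℝ) : ℝ := ∫ τ in (0 : ℝ)..t, Φ τ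

lemma PhiBounds.hasDerivAt_primitive {Λ : ℝ} {Φ : ℝ → ℝ} (hΦ : PhiBounds Λ p Φ) (t : ℝ) :
    HasDerivAt (primitive Φ) (Φ t) t :=
  intervalIntegral.integral_hasDerivAt_right (hΦ.1.intervalIntegrable _ _)
    (hΦ.1.stronglyMeasurableAtFilter _ _) hΦ.1.continuousAt

lemma PhiBounds.continuous_primitive {Λ : ℝ} {Φ : ℝ → ℝ} (hΦ : PhiBounds Λ p Φ) :
    Continuous (primitive Φ) :=
  continuous_iff_continuousAt.2 fun t => (hΦ.hasDerivAt_primitive t).continuousAt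

lemma PhiBounds.neg_comp_neg {Λ : ℝ} {Φ : ℝ → ℝ} (hΦ : PhiBounds Λ p Φ) :
    PhiBounds Λ p fun t => -Φ (-t) := by
  refine ⟨(hΦ.1.comp continuous_neg).neg, by simp [hΦ.2.1], fun t => ?_⟩
  have := hΦ.2.2 (-t)
  rw [abs_neg] at this
  rwa [show -Φ (-t) * t = Φ (-t) * -t by ring]

lemma PhiBounds.primitive_bounds {Λ : ℝ} {Φ : ℝ → ℝ} (hΦ : PhiBounds Λ p Φ) (hΛ : 1 ≤ Λ)
    (hp : 1 < p) (t : ℝ) : |t| ^ p / (p * Λ) ≤ primitive Φ t ∧ primitive Φ t ≤ Λ * |t| ^ p := by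
  have hp0 : 0 < p := by linarith
  have hΛ0 : 0 < Λ := by linarith
  have key : ∀ Ψ : ℝ → ℝ, PhiBounds Λ p Ψ → ∀ t : ℝ, 0 ≤ t →
      t ^ p / (p * Λ) ≤ primitive Ψ t ∧ primitive Ψ t ≤ Λ * t ^ p := by
    intro Ψ hΨ t ht
    constructor
    · have h1 : ∫ τ in (0 : ℝ)..t, τ ^ (p - 1) / Λ = t ^ p / (p * Λ) := by
        rw [intervalIntegral.integral_div, integral_rpow (Or.inl (by linarith)),
          sub_add_cancel, Real.zero_rpow hp0.ne', sub_zero, div_div]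
      rw [← h1]
      refine intervalIntegral.integral_mono_on ht ?_ (hΨ.1.intervalIntegrable _ _) ?_
      · exact (intervalIntegral.intervalIntegrable_rpow' (by linarith)).div_const _
      · intro τ hτ
        have h2 := hΨ.le_abs hΛ hp τ
        rw [abs_of_nonneg hτ.1] at h2
        rcases hτ.1.eq_or_lt with h | h
        · rw [← h, hΨ.2.1, Real.zero_rpow (by linarith), zero_div]
        · have h3 := hΨ.mul_self_nonneg hΛ τ
          rwa [abs_of_nonneg (nonneg_of_mul_nonneg_left h3 h)] at h2
    · calc primitive Ψ t ≤ ∫ _ in (0 : ℝ)..t, Λ * t ^ (p - 1) := by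
            refine intervalIntegral.integral_mono_on ht (hΨ.1.intervalIntegrable _ _)
              (by simp) fun τ hτ => ?_
            refine (le_abs_self _).trans ((hΨ.abs_le hΛ hp τ).trans ?_)
            rw [abs_of_nonneg hτ.1]
            have := hτ.1
            have := hτ.2
            have : 0 ≤ p - 1 := by linarith
            gcongr
        _ = Λ * t ^ p := by
            rw [intervalIntegral.integral_const, smul_eq_mul, sub_zero]
            have := abs_rpow_sub_one_mul (t := t) hp
            rw [abs_of_nonneg ht] at this
            rw [← this]; ring
  rcases le_total 0 t with ht | ht
  · rw [abs_of_nonneg ht]; exact key Φ hΦ t ht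
  · have h1 := key _ hΦ.neg_comp_neg (-t) (by linarith)
    have h2 : primitive (fun t => -Φ (-t)) (-t) = primitive Φ t := by
      unfold primitive
      rw [intervalIntegral.integral_neg, intervalIntegral.integral_comp_neg (fun x => Φ x),
        neg_neg, neg_zero, intervalIntegral.integral_symm, neg_neg]
    rwa [h2, ← abs_of_nonpos ht] at h1

end Energy

/-! ### The space of finite energy functions vanishing outside a bounded set -/

section ZeroSpace

variable {n : ℕ} {s p : ℝ}

/-- Functions in `W^{s,p}(ℝⁿ)` vanishing almost everywhere outside `Ω`. -/
def memWspZero (n : ℕ) (s p : ℝ) (Ω : Set (Rn n)) (w : Rn n → ℝ) : Prop :=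
  memWsp n s p univ w ∧ ∀ᵐ x, x ∉ Ω → w x = 0

lemma memWspZero.add {Ω : Set (Rn n)} (hp : 0 ≤ p) {v w : Rn n → ℝ} (hv : memWspZero n s p Ω v)
    (hw : memWspZero n s p Ω w) : memWspZero n s p Ω fun x => v x + w x := by
  refine ⟨memWsp_univ_add hp hv.1 hw.1, ?_⟩
  filter_upwards [hv.2, hw.2] with x h1 h2 hx
  rw [h1 hx, h2 hx, add_zero]

lemma memWspZero.const_mul {Ω : Set (Rn n)} {v : Rn n → ℝ} (c : ℝ)
    (hv : memWspZero n s p Ω v) : memWspZero n s p Ω fun x => c * v x := by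
  refine ⟨memWsp_univ_const_mul c hv.1, ?_⟩
  filter_upwards [hv.2] with x h1 hx
  rw [h1 hx, mul_zero]

lemma memWspZero_zero (Ω : Set (Rn n)) (hp : 0 < p) : memWspZero n s p Ω fun _ => 0 := by
  refine ⟨memWsp_univ_iff.2 ⟨aemeasurable_const, ?_, ?_⟩, by simp⟩ <;>
  simp [diffQuot, Real.zero_rpow hp.ne']

lemma lintegral_eq_setLIntegral_of_ae_zero {α : Type*} [MeasurableSpace α] {ν : Measure α}
    {A : Set α} (hA : MeasurableSet A) {F : α → ℝ≥0∞} (h : ∀ᵐ x ∂ν, x ∉ A → F x = 0) :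
    ∫⁻ x, F x ∂ν = ∫⁻ x in A, F x ∂ν := by
  rw [← lintegral_indicator hA]
  refine lintegral_congr_ae ?_
  filter_upwards [h] with x hx
  by_cases hxA : x ∈ A
  · rw [indicator_of_mem hxA]
  · rw [indicator_of_notMem hxA, hx hxA]

/-- Functions bounded in `W^{s,p}` and vanishing outside `Ω` form a sequentially compact set with
respect to convergence in `L¹` and almost everywhere. -/
lemma exists_subseq_memWspZero (hn : 1 ≤ n) (hs : 0 < s) (hp : 1 < p) {Ω : Set (Rn n)}
    (hΩ : MeasurableSet Ω) (hΩb : Bornology.IsBounded Ω) {w : ℕ → Rn n → ℝ}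
    (hw : ∀ k, memWspZero n s p Ω (w k)) {C : ℝ≥0∞} (hC : C ≠ ⊤)
    (hwC : ∀ k, ∫⁻ z, ENNReal.ofReal (diffQuot n s p (w k) z) ≤ C) :
    ∃ φ : ℕ → ℕ, StrictMono φ ∧ ∃ w₀ : Rn n → ℝ, memWspZero n s p Ω w₀ ∧
      (∀ᵐ x, Tendsto (fun k => w (φ k) x) atTop (𝓝 (w₀ x))) ∧
      Tendsto (fun k => ∫⁻ x, ENNReal.ofReal |w (φ k) x - w₀ x|) atTop (𝓝 0) := by
  have hp0 : 0 < p := by linarith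
  obtain ⟨R₀, hR₀⟩ := hΩb.subset_ball (0 : Rn n)
  set R := max R₀ (max n 1) with hR
  have hRn : (n : ℝ) ≤ R := (le_max_left _ _).trans (le_max_right _ _)
  have hR1 : 1 ≤ R := (le_max_right _ _).trans (le_max_right _ _)
  have hΩR : Ω ⊆ ball 0 R := hR₀.trans (ball_subset_ball (le_max_left _ _))
  have hwm : ∀ k, AEMeasurable (w k) := fun k => (memWsp_univ_iff.1 (hw k).1).1
  have hw0 : ∀ k, ∀ᵐ x, x ∉ ball (0 : Rn n) R → w k x = 0 := fun k => by
    filter_upwards [(hw k).2] with x hx h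
    exact hx fun h' => h (hΩR h')
  obtain ⟨Cp, hCp, hpoin⟩ := exists_poincare (s := s) hn hs hp (show 0 < R by linarith)
  set C₁ : ℝ≥0∞ := ENNReal.ofReal Cp * C with hC₁
  have hC₁f : C₁ ≠ ⊤ := ENNReal.mul_ne_top ENNReal.ofReal_ne_top hC
  have hLp : ∀ k, ∫⁻ x, ENNReal.ofReal (|w k x| ^ p) ≤ C₁ := fun k =>
    (hpoin _ (hwm k) (hw0 k)).trans (mul_le_mul_right (hwC k) _)
  have hΩv : volume Ω ≠ ⊤ := (measure_mono hΩR).trans_lt measure_ball_lt_top |>.ne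
  have hL1 : ∀ k, ∫⁻ x, ENNReal.ofReal |w k x| ≤ C₁ + volume Ω := fun k => by
    rw [lintegral_eq_setLIntegral_of_ae_zero hΩ (by
      filter_upwards [(hw k).2] with x hx h; simp [hx h])]
    calc ∫⁻ x in Ω, ENNReal.ofReal |w k x| ≤ ∫⁻ x in Ω, (ENNReal.ofReal (|w k x| ^ p) + 1) := by
          refine lintegral_mono fun x => ?_
          rw [← ENNReal.ofReal_one, ← ENNReal.ofReal_add (by positivity) zero_le_one]
          refine ENNReal.ofReal_le_ofReal ?_
          have := rpow_le_one_add_rpow zero_le_one hp.le (abs_nonneg (w k x))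
          rw [Real.rpow_one] at this
          linarith
      _ = (∫⁻ x in Ω, ENNReal.ofReal (|w k x| ^ p)) + volume Ω := by
          rw [lintegral_add_right _ measurable_const, setLIntegral_const, one_mul]
      _ ≤ _ := by gcongr; exact (setLIntegral_le_lintegral _ _).trans (hLp k)
  obtain ⟨C₂, hC₂, hCq⟩ := exists_lintegral_diffQuot_le (n := n) (s := s) (p := p) hn
    (h := s / 2) (q := 1) (ξ := 0) one_pos hp (by linarith) le_rfl (2 * R)
  set C₃ := C + C₂ * ∫⁻ _ in ball (0 : Rn n) (2 * R), ENNReal.ofReal 2 with hC₃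
  have hC₃f : C₃ ≠ ⊤ := by
    rw [hC₃, setLIntegral_const]
    exact ENNReal.add_ne_top.2 ⟨hC, ENNReal.mul_ne_top hC₂
      (ENNReal.mul_ne_top ENNReal.ofReal_ne_top measure_ball_lt_top.ne)⟩
  have hW : ∀ k, ∫⁻ z in ball (0 : Rn n) (2 * R) ×ˢ ball (0 : Rn n) (2 * R),
      ENNReal.ofReal (diffQuot n (s / 2) 1 (w k) z) ≤ C₃ := fun k => by
    refine (hCq _ (hwm k)).trans ?_
    simp only [neg_zero, Real.rpow_zero, mul_one, zero_div]
    rw [hC₃, show (1 : ℝ) + 1 = 2 by norm_num]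
    gcongr
    exact (setLIntegral_le_lintegral _ _).trans (hwC k)
  obtain ⟨φ, hφ, w₀, hw₀m, hlim⟩ := exists_subseq_ae_tendsto (half_pos hs) hRn hwm hw0
    (C := max C₃ (C₁ + volume Ω)) (max_ne_top hC₃f (ENNReal.add_ne_top.2 ⟨hC₁f, hΩv⟩))
    (fun k => (hL1 k).trans (le_max_right _ _)) (fun k => (hW k).trans (le_max_left _ _))
  have hlimp : ∀ᵐ x, Tendsto (fun k => |w (φ k) x| ^ p) atTop (𝓝 (|w₀ x| ^ p)) := by
    filter_upwards [hlim] with x hx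
    exact (hx.abs).rpow_const (Or.inr hp0.le)
  have hlimd : ∀ᵐ z, Tendsto (fun k => diffQuot n s p (w (φ k)) z) atTop
      (𝓝 (diffQuot n s p w₀ z)) := by
    filter_upwards [ae_comp_fst hlim, ae_comp_snd hlim] with z h1 h2
    exact (((h1.sub h2).abs).rpow_const (Or.inr hp0.le)).div_const _
  have hLp₀ : ∫⁻ x, ENNReal.ofReal (|w₀ x| ^ p) ≤ C₁ := lintegral_ofReal_liminf_le
    (fun k => (continuous_abs.measurable.comp_aemeasurable (hwm (φ k))).pow_const p) hlimp
    fun k => hLp (φ k)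
  have hw₀0 : ∀ᵐ x, x ∉ Ω → w₀ x = 0 := by
    filter_upwards [hlim, ae_all_iff.2 fun k => (hw k).2] with x h1 h2 hx
    exact tendsto_nhds_unique h1 (by simp [h2 _ hx])
  refine ⟨φ, hφ, w₀, ⟨memWsp_univ_iff.2 ⟨hw₀m.aemeasurable, hLp₀.trans_lt hC₁f.lt_top, ?_⟩,
    hw₀0⟩, hlim, ?_⟩
  · exact (lintegral_ofReal_liminf_le (fun k => aemeasurable_diffQuot (hwm (φ k))) hlimd
      fun k => hwC (φ k)).trans_lt hC.lt_top
  refine tendsto_lintegral_zero_of_small_remainder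
    (fun k => (continuous_abs.measurable.comp_aemeasurable
      ((hwm (φ k)).sub hw₀m.aemeasurable)).ennreal_ofReal) ?_ fun ε hε => ?_
  · filter_upwards [hlim] with x hx
    have := ENNReal.tendsto_ofReal (hx.sub_const (w₀ x)).abs
    simpa using this
  -- choice of the small parameter in Young's inequality
  have hT : ENNReal.ofReal (2 ^ p) * (C₁ + C₁) ≠ ⊤ :=
    ENNReal.mul_ne_top ENNReal.ofReal_ne_top (ENNReal.add_ne_top.2 ⟨hC₁f, hC₁f⟩)
  obtain ⟨η, hη, hηε⟩ : ∃ η : ℝ, 0 < η ∧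
      ENNReal.ofReal η * (ENNReal.ofReal (2 ^ p) * (C₁ + C₁)) ≤ ε := by
    obtain ⟨η, hη, h⟩ := ENNReal.exists_nnreal_pos_mul_lt hT hε.ne'
    exact ⟨η, hη, by rw [ENNReal.ofReal_coe_nnreal]; exact h.le⟩
  obtain ⟨Cη, hCη, hyoung⟩ := exists_rpow_le_eps_rpow one_pos hp hη
  have hSm : ∀ k, AEMeasurable fun x => |w (φ k) x - w₀ x| ^ p := fun k =>
    (continuous_abs.measurable.comp_aemeasurable
      ((hwm (φ k)).sub hw₀m.aemeasurable)).pow_const p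
  refine ⟨Ω.indicator fun _ => ENNReal.ofReal Cη,
    fun k x => ENNReal.ofReal (η * |w (φ k) x - w₀ x| ^ p), ?_,
    fun k => ((hSm k).const_mul η).ennreal_ofReal, fun k => ?_, Eventually.of_forall fun k => ?_⟩
  · rw [lintegral_indicator hΩ, setLIntegral_const]
    exact ENNReal.mul_ne_top ENNReal.ofReal_ne_top hΩv
  · filter_upwards [hw₀0, (hw (φ k)).2] with x h1 h2
    by_cases hx : x ∈ Ω
    · rw [indicator_of_mem hx, ← ENNReal.ofReal_add hCη.le (by positivity)]
      have := hyoung |w (φ k) x - w₀ x| (abs_nonneg _)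
      rw [Real.rpow_one] at this
      exact ENNReal.ofReal_le_ofReal (by linarith)
    · simp [h1 hx, h2 hx]
  · simp_rw [ENNReal.ofReal_mul hη.le]
    rw [lintegral_const_mul' _ _ ENNReal.ofReal_ne_top]
    refine le_trans ?_ hηε
    gcongr
    refine (lintegral_ofReal_le_of_le_two_rpow (c := 2 ^ p) (g := fun x => |w (φ k) x| ^ p)
      (h := fun x => |w₀ x| ^ p) (by positivity) (fun x => by positivity)
      (fun x => by positivity) ((continuous_abs.measurable.comp_aemeasurable
        (hwm (φ k))).pow_const p) (Eventually.of_forall fun x => abs_sub_rpow_le hp0.le _ _)).trans ?_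
    gcongr
    exact hLp (φ k)

end ZeroSpace

/-! ### Weak solutions by minimization -/

section Minimization

variable {n : ℕ} {s p Λ : ℝ} {Φ : ℝ → ℝ} {K : Rn n → Rn n → ℝ}

lemma memWsp.aemeasurable {v : Rn n → ℝ} (hv : memWsp n s p univ v) : AEMeasurable v :=
  (memWsp_univ_iff.1 hv).1

lemma memWsp.integrable_diffQuot {v : Rn n → ℝ} (hv : memWsp n s p univ v) :
    Integrable (diffQuot n s p v) := by
  obtain ⟨h1, -, h3⟩ := memWsp_univ_iff.1 hv
  refine ⟨(aemeasurable_diffQuot h1).aestronglyMeasurable, ?_⟩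
  rw [hasFiniteIntegral_iff_ofReal (Eventually.of_forall (diffQuot_nonneg v))]
  exact h3

lemma memWsp.lintegral_diffQuot {v : Rn n → ℝ} (hv : memWsp n s p univ v) :
    ∫⁻ z, ENNReal.ofReal (diffQuot n s p v z) = ENNReal.ofReal (∫ z, diffQuot n s p v z) :=
  (ofReal_integral_eq_lintegral_ofReal hv.integrable_diffQuot
    (Eventually.of_forall (diffQuot_nonneg v))).symm

lemma memWsp.integrable_rpow {v : Rn n → ℝ} (hv : memWsp n s p univ v) :
    Integrable fun x => |v x| ^ p := by
  obtain ⟨h1, h2, -⟩ := memWsp_univ_iff.1 hv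
  refine ⟨((continuous_abs.measurable.comp_aemeasurable h1).pow_const p).aestronglyMeasurable, ?_⟩
  rw [hasFiniteIntegral_iff_ofReal (Eventually.of_forall fun x => by positivity)]
  exact h2

lemma memWspZero.integrable {Ω : Set (Rn n)} (hΩ : MeasurableSet Ω) (hΩv : volume Ω ≠ ⊤)
    (hp : 1 ≤ p) {w : Rn n → ℝ} (hw : memWspZero n s p Ω w) : Integrable w := by
  have h1 : Integrable (Ω.indicator fun _ => (1 : ℝ)) :=
    (integrable_indicator_iff hΩ).2 (integrableOn_const hΩv)
  refine (h1.add hw.1.integrable_rpow).mono' hw.1.aemeasurable.aestronglyMeasurable ?_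
  filter_upwards [hw.2] with x hx
  by_cases h : x ∈ Ω
  · have := rpow_le_one_add_rpow zero_le_one hp (abs_nonneg (w x))
    rw [Real.rpow_one] at this
    simpa [h] using this
  · simp only [hx h, norm_zero, Pi.add_apply, indicator_of_notMem h, zero_add]
    positivity

lemma rpow_sub_one_mul_le (hp : 1 < p) {a b : ℝ} (ha : 0 ≤ a) (hb : 0 ≤ b) :
    a ^ (p - 1) * b ≤ a ^ p + b ^ p := by
  have e : ∀ c : ℝ, 0 ≤ c → c ^ (p - 1) * c = c ^ p := fun c hc => by
    have := abs_rpow_sub_one_mul (t := c) hp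
    rwa [abs_of_nonneg hc] at this
  have hp1 : 0 ≤ p - 1 := by linarith
  have h1 : 0 ≤ a ^ p := by positivity
  have h2 : 0 ≤ b ^ p := by positivity
  rcases le_total a b with h | h
  · have : a ^ (p - 1) * b ≤ b ^ (p - 1) * b := by gcongr
    linarith [e b hb]
  · have : a ^ (p - 1) * b ≤ a ^ (p - 1) * a := by gcongr
    linarith [e a ha]

lemma aemeasurable_form (hΦ : Continuous Φ) (hK : Measurable (Function.uncurry K))
    {u φ : Rn n → ℝ} (hu : AEMeasurable u) (hφ : AEMeasurable φ) :
    AEMeasurable fun z : Rn n × Rn n => Φ (u z.1 - u z.2) * (φ z.1 - φ z.2) * K z.1 z.2 :=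
  ((hΦ.measurable.comp_aemeasurable (aemeasurable_fst_sub_snd hu)).mul
    (aemeasurable_fst_sub_snd hφ)).mul hK.aemeasurable

lemma abs_mul_kernel_le (hn : 1 ≤ n) (hΛ : 1 ≤ Λ) (hK : KernelBounds n Λ s p K) :
    ∀ᵐ z : Rn n × Rn n, ∀ a b : ℝ, |a| ≤ b →
      |a * K z.1 z.2| ≤ Λ * (b / ‖z.1 - z.2‖ ^ (n + s * p)) := by
  filter_upwards [hK.ae_bounds hn hΛ] with z hz a b hab
  have hb : 0 ≤ b := (abs_nonneg a).trans hab
  rw [abs_mul, abs_of_nonneg hz.2.1]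
  calc |a| * K z.1 z.2 ≤ b * (Λ * (1 / ‖z.1 - z.2‖ ^ (n + s * p))) := by
        gcongr
        · exact hz.2.1
        · exact hz.2.2.2
    _ = _ := by ring

lemma integrable_form (hn : 1 ≤ n) (hp : 1 < p) (hΛ : 1 ≤ Λ) (hK : KernelBounds n Λ s p K)
    (hΦ : PhiBounds Λ p Φ) {u φ : Rn n → ℝ} (hu : memWsp n s p univ u)
    (hφ : memWsp n s p univ φ) :
    Integrable fun z : Rn n × Rn n => Φ (u z.1 - u z.2) * (φ z.1 - φ z.2) * K z.1 z.2 := by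
  refine (((hu.integrable_diffQuot.add hφ.integrable_diffQuot).const_mul (Λ * Λ))).mono'
    (aemeasurable_form hΦ.1 hK.1 hu.aemeasurable hφ.aemeasurable).aestronglyMeasurable ?_
  filter_upwards [abs_mul_kernel_le hn hΛ hK] with z hz
  have hΛ0 : 0 < Λ := by linarith
  have h1 : |Φ (u z.1 - u z.2) * (φ z.1 - φ z.2)| ≤
      Λ * (|u z.1 - u z.2| ^ p + |φ z.1 - φ z.2| ^ p) := by
    rw [abs_mul]
    calc _ ≤ Λ * |u z.1 - u z.2| ^ (p - 1) * |φ z.1 - φ z.2| := by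
          gcongr; exact hΦ.abs_le hΛ hp _
      _ ≤ _ := by
          rw [mul_assoc]
          gcongr
          exact rpow_sub_one_mul_le hp (abs_nonneg _) (abs_nonneg _)
  refine (hz _ _ h1).trans (le_of_eq ?_)
  simp only [Pi.add_apply, diffQuot]
  ring

/-- The energy `∫∫ (∫₀^{u(x)-u(y)} Φ) K(x,y) dx dy`. -/
def energy (n : ℕ) (Φ : ℝ → ℝ) (K : Rn n → Rn n → ℝ) (u : Rn n → ℝ) : ℝ :=
  ∫ z : Rn n × Rn n, primitive Φ (u z.1 - u z.2) * K z.1 z.2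

lemma integrable_energy (hn : 1 ≤ n) (hp : 1 < p) (hΛ : 1 ≤ Λ) (hK : KernelBounds n Λ s p K)
    (hΦ : PhiBounds Λ p Φ) {u : Rn n → ℝ} (hu : memWsp n s p univ u) :
    Integrable fun z : Rn n × Rn n => primitive Φ (u z.1 - u z.2) * K z.1 z.2 := by
  refine (hu.integrable_diffQuot.const_mul (Λ * Λ)).mono'
    (((hΦ.continuous_primitive.measurable.comp_aemeasurable
      (aemeasurable_fst_sub_snd hu.aemeasurable)).mul hK.1.aemeasurable).aestronglyMeasurable) ?_
  filter_upwards [abs_mul_kernel_le hn hΛ hK] with z hz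
  have hb := hΦ.primitive_bounds hΛ hp (u z.1 - u z.2)
  have h0 : 0 ≤ primitive Φ (u z.1 - u z.2) := le_trans (by positivity) hb.1
  refine (hz _ _ ((abs_of_nonneg h0).le.trans hb.2)).trans (le_of_eq ?_)
  simp only [diffQuot]
  ring

lemma energy_integrand_nonneg (hn : 1 ≤ n) (hp : 1 < p) (hΛ : 1 ≤ Λ)
    (hK : KernelBounds n Λ s p K) (hΦ : PhiBounds Λ p Φ) (u : Rn n → ℝ) :
    ∀ᵐ z : Rn n × Rn n, diffQuot n s p u z / (p * Λ * Λ) ≤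
      primitive Φ (u z.1 - u z.2) * K z.1 z.2 := by
  filter_upwards [hK.ae_bounds hn hΛ] with z hz
  have hb := hΦ.primitive_bounds hΛ hp (u z.1 - u z.2)
  have hΛ0 : 0 < Λ := by linarith
  have hp0 : 0 < p := by linarith
  calc diffQuot n s p u z / (p * Λ * Λ) = |u z.1 - u z.2| ^ p / (p * Λ) *
        (1 / ‖z.1 - z.2‖ ^ (n + s * p) / Λ) := by unfold diffQuot; field_simp
    _ ≤ _ := by
        gcongr
        · exact le_trans (by positivity) hb.1
        · exact hb.1
        · rw [div_le_iff₀' hΛ0]; exact hz.2.2.1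

lemma integral_diffQuot_le_energy (hn : 1 ≤ n) (hp : 1 < p) (hΛ : 1 ≤ Λ)
    (hK : KernelBounds n Λ s p K) (hΦ : PhiBounds Λ p Φ) {u : Rn n → ℝ}
    (hu : memWsp n s p univ u) :
    (∫ z, diffQuot n s p u z) / (p * Λ * Λ) ≤ energy n Φ K u := by
  rw [← integral_div]
  exact integral_mono_ae (hu.integrable_diffQuot.div_const _)
    (integrable_energy hn hp hΛ hK hΦ hu) (energy_integrand_nonneg hn hp hΛ hK hΦ u)

lemma exists_integral_abs_le (hn : 1 ≤ n) (hs : 0 < s) (hp : 1 < p) {Ω : Set (Rn n)}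
    (hΩ : MeasurableSet Ω) (hΩb : Bornology.IsBounded Ω) {ε : ℝ} (hε : 0 < ε) :
    ∃ C : ℝ, ∀ w, memWspZero n s p Ω w → ∫ x, |w x| ≤ ε * (∫ z, diffQuot n s p w z) + C := by
  obtain ⟨R₀, hR₀⟩ := hΩb.subset_ball (0 : Rn n)
  have hΩR : Ω ⊆ ball 0 (max R₀ 1) := hR₀.trans (ball_subset_ball (le_max_left _ _))
  have hΩv : volume Ω ≠ ⊤ := (measure_mono hΩR).trans_lt measure_ball_lt_top |>.ne
  obtain ⟨Cp, hCp, hpoin⟩ := exists_poincare (n := n) (s := s) (p := p) hn hs hp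
    (show 0 < max R₀ 1 by positivity)
  obtain ⟨C, hC, hy⟩ := exists_rpow_le_eps_rpow one_pos hp (div_pos hε hCp)
  refine ⟨C * (volume Ω).toReal, fun w hw => ?_⟩
  have h1 : Integrable (Ω.indicator fun _ => C) :=
    (integrable_indicator_iff hΩ).2 (integrableOn_const hΩv)
  have h2 : ∫ x, |w x| ^ p ≤ Cp * ∫ z, diffQuot n s p w z := by
    have h3 := hpoin w hw.1.aemeasurable (by
      filter_upwards [hw.2] with x hx h
      exact hx fun h' => h (hΩR h'))
    rw [← ofReal_integral_eq_lintegral_ofReal hw.1.integrable_rpow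
      (Eventually.of_forall fun x => by positivity), hw.1.lintegral_diffQuot,
      ← ENNReal.ofReal_mul hCp.le] at h3
    exact (ENNReal.ofReal_le_ofReal_iff
      (mul_nonneg hCp.le (integral_nonneg (diffQuot_nonneg w)))).1 h3
  calc ∫ x, |w x| ≤ ∫ x, (ε / Cp * |w x| ^ p + Ω.indicator (fun _ => C) x) := by
        refine integral_mono_ae (hw.integrable hΩ hΩv hp.le).abs
          ((hw.1.integrable_rpow.const_mul _).add h1) ?_
        filter_upwards [hw.2] with x hx
        by_cases h : x ∈ Ω
        · have := hy |w x| (abs_nonneg _)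
          rw [Real.rpow_one] at this
          simpa [h] using this
        · simp only [hx h, abs_zero, indicator_of_notMem h, add_zero]
          positivity
    _ = ε / Cp * (∫ x, |w x| ^ p) + C * (volume Ω).toReal := by
        rw [integral_add (hw.1.integrable_rpow.const_mul _) h1, integral_const_mul,
          integral_indicator hΩ, setIntegral_const, smul_eq_mul, measureReal_def, mul_comm C]
    _ ≤ ε / Cp * (Cp * ∫ z, diffQuot n s p w z) + C * (volume Ω).toReal := by
        gcongr
    _ = _ := by rw [← mul_assoc, div_mul_cancel₀ _ hCp.ne']

lemma integral_diffQuot_le_of_add (hp : 0 ≤ p) {w g : Rn n → ℝ} (hw : memWsp n s p univ w)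
    (hg : memWsp n s p univ g) : ∫ z, diffQuot n s p w z ≤
      2 ^ p * ((∫ z, diffQuot n s p (fun x => w x + g x) z) + ∫ z, diffQuot n s p g z) := by
  have hwg := memWsp_univ_add hp hw hg
  rw [← integral_add hwg.integrable_diffQuot hg.integrable_diffQuot, ← integral_const_mul]
  refine integral_mono hw.integrable_diffQuot
    ((hwg.integrable_diffQuot.add hg.integrable_diffQuot).const_mul _) fun z => ?_
  have := diffQuot_sub_le (s := s) hp (fun x => w x + g x) g z
  simpa using this

/-- Existence of a minimizer of `w ↦ energy (w + g) - ∫ w f`. -/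
lemma exists_minimizer (hn : 1 ≤ n) (hs : 0 < s) (hp : 1 < p) (hΛ : 1 ≤ Λ)
    (hK : KernelBounds n Λ s p K) (hΦ : PhiBounds Λ p Φ) {Ω : Set (Rn n)}
    (hΩ : MeasurableSet Ω) (hΩb : Bornology.IsBounded Ω) {g : Rn n → ℝ}
    (hg : memWsp n s p univ g) {f : Rn n → ℝ} (hf : AEMeasurable f) {M : ℝ}
    (hM : ∀ x, |f x| ≤ M) :
    ∃ w₀, memWspZero n s p Ω w₀ ∧ ∀ w, memWspZero n s p Ω w →
      energy n Φ K (fun x => w₀ x + g x) - ∫ x, w₀ x * f x ≤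
        energy n Φ K (fun x => w x + g x) - ∫ x, w x * f x := by
  have hp0 : 0 < p := by linarith
  have hΛ0 : 0 < Λ := by linarith
  have hM0 : 0 ≤ M := (abs_nonneg _).trans (hM 0)
  obtain ⟨R₀, hR₀⟩ := hΩb.subset_ball (0 : Rn n)
  have hΩv : volume Ω ≠ ⊤ := (measure_mono hR₀).trans_lt measure_ball_lt_top |>.ne
  set J : (Rn n → ℝ) → ℝ := fun w => energy n Φ K (fun x => w x + g x) - ∫ x, w x * f x with hJ
  set D : (Rn n → ℝ) → ℝ := fun w => ∫ z, diffQuot n s p w z with hD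
  have hD0 : ∀ w, 0 ≤ D w := fun w => integral_nonneg (diffQuot_nonneg w)
  set c := 1 / (p * Λ * Λ) with hc
  have hc0 : 0 < c := by positivity
  have hlin : ∀ w, memWspZero n s p Ω w → Integrable (fun x => w x * f x) := fun w hw =>
    (hw.integrable hΩ hΩv hp.le).mul_bdd hf.aestronglyMeasurable (Eventually.of_forall hM)
  have hlin_le : ∀ w, memWspZero n s p Ω w → ∫ x, w x * f x ≤ M * ∫ x, |w x| := fun w hw => by
    rw [← integral_const_mul]
    refine integral_mono (hlin w hw) ((hw.integrable hΩ hΩv hp.le).abs.const_mul M) fun x => ?_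
    refine (le_abs_self _).trans ?_
    rw [abs_mul, mul_comm]
    gcongr
    exact hM x
  obtain ⟨C, hC⟩ := exists_integral_abs_le (n := n) (s := s) hn hs hp hΩ hΩb
    (ε := c / (2 ^ p * 2 * (M + 1))) (by positivity)
  have hcoer : ∀ w, memWspZero n s p Ω w → c / 2 ^ p / 2 * D w ≤ J w + (c * D g + M * C) := by
    intro w hw
    have hwg := memWsp_univ_add hp0.le hw.1 hg
    have h1 := integral_diffQuot_le_energy hn hp hΛ hK hΦ hwg
    have h2 : D w ≤ 2 ^ p * (D (fun x => w x + g x) + D g) :=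
      integral_diffQuot_le_of_add hp0.le hw.1 hg
    have h3 := hlin_le w hw
    have h4 : M * ∫ x, |w x| ≤ M * (c / (2 ^ p * 2 * (M + 1)) * D w + C) :=
      mul_le_mul_of_nonneg_left (hC w hw) hM0
    have h5 : M * (c / (2 ^ p * 2 * (M + 1)) * D w) ≤ c / 2 ^ p / 2 * D w := by
      have : M * (c / (2 ^ p * 2 * (M + 1)) * D w) = c / 2 ^ p / 2 * D w * (M / (M + 1)) := by
        field_simp
      rw [this]
      refine mul_le_of_le_one_right (by have := hD0 w; positivity) ?_
      rw [div_le_one (by positivity)]; linarith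
    have h6 : c / 2 ^ p * D w ≤ c * (D (fun x => w x + g x) + D g) := by
      rw [div_mul_eq_mul_div, div_le_iff₀ (by positivity)]
      calc c * D w ≤ c * (2 ^ p * (D (fun x => w x + g x) + D g)) := by gcongr
        _ = _ := by ring
    have h7 : c * D (fun x => w x + g x) ≤ energy n Φ K (fun x => w x + g x) := by
      rw [hc, one_div_mul_eq_div]; exact h1
    have h8 : M * (c / (2 ^ p * 2 * (M + 1)) * D w + C) =
      M * (c / (2 ^ p * 2 * (M + 1)) * D w) + M * C := by ring
    simp only [hJ]
    linarith
  have hbdd : BddBelow (J '' {w | memWspZero n s p Ω w}) := by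
    refine ⟨-(c * D g + M * C), ?_⟩
    rintro _ ⟨w, hw, rfl⟩
    have h1 := hcoer w hw
    have h2 : 0 ≤ c / 2 ^ p / 2 * D w := by have := hD0 w; positivity
    linarith
  obtain ⟨a, ha, halim, hamem⟩ := exists_seq_tendsto_sInf
    (⟨_, _, memWspZero_zero Ω hp0, rfl⟩ : (J '' {w | memWspZero n s p Ω w}).Nonempty) hbdd
  choose w hw hwa using hamem
  have hDw : ∀ k, ∫⁻ z, ENNReal.ofReal (diffQuot n s p (w k) z) ≤
      ENNReal.ofReal ((a 0 + (c * D g + M * C)) / (c / 2 ^ p / 2)) := fun k => by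
    rw [(hw k).1.lintegral_diffQuot]
    refine ENNReal.ofReal_le_ofReal ?_
    rw [le_div_iff₀ (by positivity), mul_comm]
    have h1 := hcoer _ (hw k)
    have h2 : J (w k) ≤ a 0 := (hwa k).le.trans (ha (Nat.zero_le k))
    linarith
  obtain ⟨φ, hφ, w₀, hw₀, hlim, hL1⟩ := exists_subseq_memWspZero hn hs hp hΩ hΩb hw
    ENNReal.ofReal_ne_top hDw
  refine ⟨w₀, hw₀, fun v hv => ?_⟩
  change J w₀ ≤ J v
  refine le_trans ?_ (csInf_le hbdd ⟨v, hv, rfl⟩)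
  set m := sInf (J '' {w | memWspZero n s p Ω w}) with hm
  have hlinlim : Tendsto (fun k => ∫ x, w (φ k) x * f x) atTop (𝓝 (∫ x, w₀ x * f x)) := by
    refine tendsto_integral_of_L1 _ (hlin w₀ hw₀).aestronglyMeasurable
      (Eventually.of_forall fun k => hlin _ (hw (φ k))) ?_
    have h1 := ENNReal.Tendsto.const_mul (a := ENNReal.ofReal M) hL1
      (Or.inr ENNReal.ofReal_ne_top)
    rw [mul_zero] at h1
    refine tendsto_of_tendsto_of_tendsto_of_le_of_le tendsto_const_nhds h1
      (fun _ => zero_le) fun k => ?_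
    beta_reduce
    rw [← lintegral_const_mul' _ _ ENNReal.ofReal_ne_top]
    refine lintegral_mono fun x => ?_
    rw [← ofReal_norm, ← ENNReal.ofReal_mul hM0, ← sub_mul, norm_mul, Real.norm_eq_abs,
      Real.norm_eq_abs, mul_comm]
    exact ENNReal.ofReal_le_ofReal (by gcongr; exact hM x)
  have hu₀ := memWsp_univ_add hp0.le hw₀.1 hg
  have hgood : ∀ ε : ℝ, 0 < ε → energy n Φ K (fun x => w₀ x + g x) ≤ m + (∫ x, w₀ x * f x) + ε := by
    intro ε hε
    have hEk : Tendsto (fun k => a (φ k) + ∫ x, w (φ k) x * f x) atTop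
        (𝓝 (m + ∫ x, w₀ x * f x)) := (halim.comp hφ.tendsto_atTop).add hlinlim
    obtain ⟨N, hN⟩ := eventually_atTop.1
      (hEk.eventually_le_const (show m + (∫ x, w₀ x * f x) < m + (∫ x, w₀ x * f x) + ε by linarith))
    have hE : ∀ k, energy n Φ K (fun x => w (φ k) x + g x) =
        a (φ k) + ∫ x, w (φ k) x * f x := fun k => by
      rw [← hwa (φ k)]; simp only [hJ]; ring
    have hnn : ∀ u : Rn n → ℝ, 0 ≤ᵐ[volume]
        fun z : Rn n × Rn n => primitive Φ (u z.1 - u z.2) * K z.1 z.2 := fun u => by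
      filter_upwards [energy_integrand_nonneg hn hp hΛ hK hΦ u] with z hz
      exact le_trans (div_nonneg (diffQuot_nonneg u z) (by positivity)) hz
    have hfat := lintegral_ofReal_liminf_le (ν := volume)
      (F := fun k (z : Rn n × Rn n) => primitive Φ ((w (φ (k + N)) z.1 + g z.1) -
        (w (φ (k + N)) z.2 + g z.2)) * K z.1 z.2)
      (G := fun z => primitive Φ ((w₀ z.1 + g z.1) - (w₀ z.2 + g z.2)) * K z.1 z.2)
      (fun k => (integrable_energy hn hp hΛ hK hΦ
        (memWsp_univ_add hp0.le (hw (φ (k + N))).1 hg)).aestronglyMeasurable.aemeasurable) ?_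
      (C := ENNReal.ofReal (m + (∫ x, w₀ x * f x) + ε)) fun k => ?_
    · rw [← ofReal_integral_eq_lintegral_ofReal (integrable_energy hn hp hΛ hK hΦ hu₀)
        (hnn fun x => w₀ x + g x)] at hfat
      refine (ENNReal.ofReal_le_ofReal_iff ?_).1 hfat
      have h1 : 0 ≤ energy n Φ K (fun x => w (φ N) x + g x) :=
        integral_nonneg_of_ae (hnn fun x => w (φ N) x + g x)
      rw [hE] at h1
      exact h1.trans (hN N le_rfl)
    · filter_upwards [ae_comp_fst hlim, ae_comp_snd hlim] with z h1 h2
      have h3 := ((h1.add_const (g z.1)).sub (h2.add_const (g z.2))).comp (tendsto_add_atTop_nat N)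
      exact ((hΦ.continuous_primitive.tendsto _).comp h3).mul_const _
    · rw [← ofReal_integral_eq_lintegral_ofReal (integrable_energy hn hp hΛ hK hΦ
        (memWsp_univ_add hp0.le (hw (φ (k + N))).1 hg)) (hnn fun x => w (φ (k + N)) x + g x)]
      refine ENNReal.ofReal_le_ofReal ?_
      have := hE (k + N)
      unfold energy at this
      rw [this]
      exact hN _ (by omega)
  have := le_of_forall_pos_le_add hgood
  simp only [hJ]
  linarith

end Minimization

/-! ### The Euler–Lagrange equation -/

section EulerLagrange

variable {n : ℕ} {s p Λ : ℝ} {Φ : ℝ → ℝ} {K : Rn n → Rn n → ℝ}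

lemma nonlocalForm_eq (hn : 1 ≤ n) (hp : 1 < p) (hΛ : 1 ≤ Λ) (hK : KernelBounds n Λ s p K)
    (hΦ : PhiBounds Λ p Φ) {u φ : Rn n → ℝ} (hu : memWsp n s p univ u)
    (hφ : memWsp n s p univ φ) :
    nonlocalForm n Φ K u φ =
      ∫ z : Rn n × Rn n, Φ (u z.1 - u z.2) * (φ z.1 - φ z.2) * K z.1 z.2 :=
  (integral_prod _ (integrable_form hn hp hΛ hK hΦ hu hφ)).symm

lemma hasDerivAt_energy (hn : 1 ≤ n) (hp : 1 < p) (hΛ : 1 ≤ Λ) (hK : KernelBounds n Λ s p K)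
    (hΦ : PhiBounds Λ p Φ) {u φ : Rn n → ℝ} (hu : memWsp n s p univ u)
    (hφ : memWsp n s p univ φ) :
    HasDerivAt (fun t => energy n Φ K fun x => u x + t * φ x) (nonlocalForm n Φ K u φ) 0 := by
  have hp0 : 0 ≤ p := by linarith
  have hΛ0 : 0 < Λ := by linarith
  have hut : ∀ t : ℝ, memWsp n s p univ fun x => u x + t * φ x := fun t =>
    memWsp_univ_add hp0 hu (memWsp_univ_const_mul t hφ)
  have key := hasDerivAt_integral_of_dominated_loc_of_deriv_le (μ := volume) (x₀ := (0 : ℝ))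
    (F := fun t (z : Rn n × Rn n) =>
      primitive Φ ((u z.1 + t * φ z.1) - (u z.2 + t * φ z.2)) * K z.1 z.2)
    (F' := fun t z => Φ ((u z.1 + t * φ z.1) - (u z.2 + t * φ z.2)) * (φ z.1 - φ z.2) * K z.1 z.2)
    (bound := fun z => Λ * (Λ * 2 ^ p) * (diffQuot n s p u z + diffQuot n s p φ z))
    (ball_mem_nhds 0 one_pos)
    (Eventually.of_forall fun t => (integrable_energy hn hp hΛ hK hΦ (hut t)).aestronglyMeasurable)
    (integrable_energy hn hp hΛ hK hΦ (hut 0))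
    (integrable_form hn hp hΛ hK hΦ (hut 0) hφ).aestronglyMeasurable ?_
    ((hu.integrable_diffQuot.add hφ.integrable_diffQuot).const_mul _) ?_
  · have := key.2
    simp only [zero_mul, add_zero] at this
    rw [nonlocalForm_eq hn hp hΛ hK hΦ hu hφ]
    exact this
  · filter_upwards [abs_mul_kernel_le hn hΛ hK] with z hz t ht
    have ht : |t| ≤ 1 := by simpa using (mem_ball_zero_iff.1 ht).le
    set a := u z.1 - u z.2 with ha
    set b := φ z.1 - φ z.2 with hb
    have e : (u z.1 + t * φ z.1) - (u z.2 + t * φ z.2) = a + t * b := by rw [ha, hb]; ring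
    rw [e]
    have h0 : |a + t * b| ≤ |a| + |b| := by
      refine (abs_add_le _ _).trans (add_le_add le_rfl ?_)
      rw [abs_mul]
      exact mul_le_of_le_one_left (abs_nonneg _) ht
    have h1 : |Φ (a + t * b) * b| ≤ Λ * 2 ^ p * (|a| ^ p + |b| ^ p) := by
      have hab : 0 ≤ |a| + |b| := by positivity
      rw [abs_mul]
      have hp1 : 0 ≤ p - 1 := by linarith
      calc |Φ (a + t * b)| * |b| ≤ Λ * (|a| + |b|) ^ (p - 1) * (|a| + |b|) := by
            gcongr
            · refine (hΦ.abs_le hΛ hp _).trans ?_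
              gcongr
            · linarith [abs_nonneg a]
        _ = Λ * (|a| + |b|) ^ p := by
            have := abs_rpow_sub_one_mul (t := |a| + |b|) hp
            rw [abs_of_nonneg hab] at this
            rw [mul_assoc, this]
        _ ≤ Λ * (2 ^ p * (|a| ^ p + |b| ^ p)) := by
            gcongr
            have := abs_add_rpow_le hp0 |a| |b|
            rwa [abs_abs, abs_abs, abs_of_nonneg hab] at this
        _ = _ := by ring
    refine (hz _ _ h1).trans (le_of_eq ?_)
    simp only [diffQuot]
    ring
  · refine Eventually.of_forall fun z t _ => ?_
    have h1 : HasDerivAt (fun t => (u z.1 + t * φ z.1) - (u z.2 + t * φ z.2))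
        (φ z.1 - φ z.2) t := by
      have := ((hasDerivAt_mul_const (x := t) (φ z.1)).const_add (u z.1)).sub
        ((hasDerivAt_mul_const (x := t) (φ z.2)).const_add (u z.2))
      exact this
    exact ((hΦ.hasDerivAt_primitive _).comp t h1).mul_const _

/-- Solvability of the Dirichlet problem with bounded data and zero exterior values of `u - g`. -/
lemma exists_weakSol (hn : 1 ≤ n) (hs : 0 < s) (hp : 1 < p) (hΛ : 1 ≤ Λ)
    (hK : KernelBounds n Λ s p K) (hΦ : PhiBounds Λ p Φ) {Ω : Set (Rn n)}
    (hΩ : MeasurableSet Ω) (hΩb : Bornology.IsBounded Ω) {g : Rn n → ℝ}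
    (hg : memWsp n s p univ g) {f : Rn n → ℝ} (hf : AEMeasurable f) {M : ℝ}
    (hM : ∀ x, |f x| ≤ M) :
    ∃ w, memWspZero n s p Ω w ∧ ∀ φ, memWspZero n s p Ω φ →
      nonlocalForm n Φ K (fun x => w x + g x) φ = ∫ x, φ x * f x := by
  have hp0 : 0 ≤ p := by linarith
  obtain ⟨w, hw, hmin⟩ := exists_minimizer hn hs hp hΛ hK hΦ hΩ hΩb hg hf hM
  refine ⟨w, hw, fun φ hφ => ?_⟩
  obtain ⟨R₀, hR₀⟩ := hΩb.subset_ball (0 : Rn n)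
  have hΩv : volume Ω ≠ ⊤ := (measure_mono hR₀).trans_lt measure_ball_lt_top |>.ne
  have hInt : ∀ v, memWspZero n s p Ω v → Integrable fun x => v x * f x := fun v hv =>
    (hv.integrable hΩ hΩv hp.le).mul_bdd hf.aestronglyMeasurable (Eventually.of_forall hM)
  have hd := hasDerivAt_energy hn hp hΛ hK hΦ (memWsp_univ_add hp0 hw.1 hg) hφ.1
  have hd2 := hd.sub ((hasDerivAt_mul_const (x := (0 : ℝ)) (∫ x, φ x * f x)).const_add
    (∫ x, w x * f x))
  refine sub_eq_zero.1 (IsLocalMin.hasDerivAt_eq_zero (Eventually.of_forall fun t => ?_) hd2)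
  have h := hmin _ (hw.add hp0 (hφ.const_mul t))
  have e1 : ∫ x, (w x + t * φ x) * f x = (∫ x, w x * f x) + t * ∫ x, φ x * f x := by
    rw [← integral_const_mul, ← integral_add (hInt w hw) ((hInt φ hφ).const_mul t)]
    congr 1 with x
    ring
  have e2 : (fun x => w x + t * φ x + g x) = fun x => w x + g x + t * φ x := by
    ext x; ring
  rw [e1, e2] at h
  simpa using h

end EulerLagrange

/-! ### The weighted energy estimate -/

section WeightedEnergy

variable {n : ℕ} {s p Λ : ℝ} {Φ : ℝ → ℝ} {K : Rn n → Rn n → ℝ}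

/-- The contribution of `g` to the interaction of `B_R` with the complement of `B_{2R}`. -/
def farTerm (n : ℕ) (s p R : ℝ) (g : Rn n → ℝ) : Rn n × Rn n → ℝ :=
  (ball (0 : Rn n) R ×ˢ (ball (0 : Rn n) (2 * R))ᶜ).indicator fun z =>
    (|g z.1| ^ (p - 1) + |g z.2| ^ (p - 1)) * (1 / ‖z.2‖ ^ (n + s * p))

lemma farTerm_nonneg (R : ℝ) (g : Rn n → ℝ) (z : Rn n × Rn n) : 0 ≤ farTerm n s p R g z :=
  indicator_nonneg (fun z _ => by positivity) z

lemma aemeasurable_farTerm (R : ℝ) {g : Rn n → ℝ} (hg : AEMeasurable g) :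
    AEMeasurable (farTerm n s p R g) := by
  have h : AEMeasurable fun x => |g x| ^ (p - 1) :=
    (continuous_abs.measurable.comp_aemeasurable hg).pow_const _
  refine AEMeasurable.indicator ?_ (measurableSet_ball.prod measurableSet_ball.compl)
  refine ((aemeasurable_comp_fst h).add (aemeasurable_comp_snd h)).mul ?_
  exact Measurable.aemeasurable (by fun_prop)

/-- The full contribution of `g` to the weighted energy estimate. -/
def dataTerm (n : ℕ) (s p R : ℝ) (g : Rn n → ℝ) (z : Rn n × Rn n) : ℝ :=
  (ball (0 : Rn n) (2 * R) ×ˢ ball (0 : Rn n) (2 * R)).indicator (diffQuot n s p g) z +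
    (farTerm n s p R g z + farTerm n s p R g z.swap)

lemma dataTerm_nonneg (R : ℝ) (g : Rn n → ℝ) (z : Rn n × Rn n) : 0 ≤ dataTerm n s p R g z :=
  add_nonneg (indicator_nonneg (fun z _ => diffQuot_nonneg g z) z)
    (add_nonneg (farTerm_nonneg R g z) (farTerm_nonneg R g _))

lemma aemeasurable_dataTerm (R : ℝ) {g : Rn n → ℝ} (hg : AEMeasurable g) :
    AEMeasurable (dataTerm n s p R g) := by
  refine ((aemeasurable_diffQuot hg).indicator (measurableSet_ball.prod measurableSet_ball)).add
    ((aemeasurable_farTerm R hg).add ?_)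
  exact (aemeasurable_farTerm R hg).comp_quasiMeasurePreserving
    (Measure.measurePreserving_swap (μ := volume) (ν := volume)).quasiMeasurePreserving

lemma far_bound (hn : 1 ≤ n) (hs : 0 < s) (hp : 1 < p) (hΛ : 1 ≤ Λ) {R k b₁ b₂ : ℝ} {x y : Rn n}
    (hx : x ∈ ball (0 : Rn n) R) (hy : y ∈ (ball (0 : Rn n) (2 * R))ᶜ)
    (hk : k ≤ Λ * (1 / ‖x - y‖ ^ (n + s * p))) :
    k * |b₁ - b₂| ^ (p - 1) ≤ Λ * 2 ^ (n + s * p) * 2 ^ (p - 1) *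
      ((|b₁| ^ (p - 1) + |b₂| ^ (p - 1)) * (1 / ‖y‖ ^ (n + s * p))) := by
  have h1 := one_div_norm_sub_rpow_le (τ := n + s * p) (by positivity) hx hy
  have hp1 : 0 ≤ p - 1 := by linarith
  have h2 := abs_sub_rpow_le hp1 b₁ b₂
  calc k * |b₁ - b₂| ^ (p - 1) ≤ (Λ * (2 ^ (n + s * p) * (1 / ‖y‖ ^ (n + s * p)))) *
        (2 ^ (p - 1) * (|b₁| ^ (p - 1) + |b₂| ^ (p - 1))) := by
        gcongr
        exact hk.trans (by gcongr)
    _ = _ := by ring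

lemma exists_weighted_diffQuot_le (hn : 1 ≤ n) (hs : 0 < s) (hp : 1 < p) (hΛ : 1 ≤ Λ)
    (hK : KernelBounds n Λ s p K) (hΦ : PhiBounds Λ p Φ) {ξ : ℝ} (hξ : 1 < ξ) (R : ℝ) :
    ∃ A B : ℝ, 0 < A ∧ 0 < B ∧ ∀ w g : Rn n → ℝ, (∀ᵐ x, x ∉ ball (0 : Rn n) R → w x = 0) →
      ∀ᵐ z : Rn n × Rn n, diffQuot n s p w z * (1 + |w z.1| + |w z.2|) ^ (-ξ) ≤
        A * (Φ ((w z.1 + g z.1) - (w z.2 + g z.2)) *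
          (slowTrunc ξ (w z.1) - slowTrunc ξ (w z.2)) * K z.1 z.2) +
        B * dataTerm n s p R g z := by
  obtain ⟨c, C, hc, hC, hlow⟩ := hΦ.exists_lower_bound hΛ hp
  obtain ⟨M, hM, hMle⟩ := exists_abs_slowTrunc_le hξ
  have hΛ0 : 0 < Λ := by linarith
  have hp0 : 0 < p := by linarith
  set T := Λ * 2 ^ (n + s * p) * 2 ^ (p - 1) with hT
  have hT0 : 0 < T := by positivity
  refine ⟨Λ / c, Λ * C / c * (Λ + 2 * M * T), by positivity, by positivity,
    fun w g hw => ?_⟩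
  filter_upwards [hK.ae_bounds hn hΛ, ae_comp_fst hw, ae_comp_snd hw] with z hz hw1 hw2
  obtain ⟨-, hk0, hkl, hku⟩ := hz
  obtain ⟨D, hDl, hD1, hD⟩ := exists_slowTrunc_sub (by linarith : 0 ≤ ξ) (w z.1) (w z.2)
  set δ := w z.1 - w z.2 with hδ
  set b := g z.1 - g z.2 with hb
  set k := K z.1 z.2 with hk
  set H := dataTerm n s p R g z with hH
  have hH0 : 0 ≤ H := dataTerm_nonneg R g z
  set a := (w z.1 + g z.1) - (w z.2 + g z.2) with ha
  have hab : a - b = δ := by rw [ha, hb, hδ]; ring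
  have hP0 : 0 ≤ (1 + |w z.1| + |w z.2|) ^ (-ξ) := by positivity
  have hD0 : 0 ≤ D := hP0.trans hDl
  have hI : diffQuot n s p w z * (1 + |w z.1| + |w z.2|) ^ (-ξ) ≤ Λ * k * D * |δ| ^ p := by
    calc diffQuot n s p w z * (1 + |w z.1| + |w z.2|) ^ (-ξ)
        = |δ| ^ p * (1 / ‖z.1 - z.2‖ ^ (n + s * p)) * (1 + |w z.1| + |w z.2|) ^ (-ξ) := by
          unfold diffQuot; ring
      _ ≤ |δ| ^ p * (Λ * k) * D := by gcongr
      _ = _ := by ring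
  have main : ∀ X : ℝ, c * |δ| ^ p ≤ Φ a * δ + C * X → k * D * X ≤ (Λ + 2 * M * T) * H →
      diffQuot n s p w z * (1 + |w z.1| + |w z.2|) ^ (-ξ) ≤
        Λ / c * (Φ a * (slowTrunc ξ (w z.1) - slowTrunc ξ (w z.2)) * k) +
          Λ * C / c * (Λ + 2 * M * T) * H := by
    intro X h1 h2
    refine hI.trans ?_
    rw [hD]
    have h3 : Λ * k * D * |δ| ^ p ≤ Λ * k * D * ((Φ a * δ + C * X) / c) := by
      gcongr
      rw [le_div_iff₀ hc, mul_comm]; exact h1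
    have h4 : Λ * C / c * (k * D * X) ≤ Λ * C / c * ((Λ + 2 * M * T) * H) := by gcongr
    calc _ ≤ _ := h3
      _ = Λ / c * (Φ a * (D * δ) * k) + Λ * C / c * (k * D * X) := by ring
      _ ≤ _ := by rw [mul_assoc (Λ * C / c)]; gcongr
  obtain ⟨hfar, hnear⟩ := hlow a b
  rw [hab] at hfar hnear
  have hDδ : D * |δ| ≤ 2 * M := by
    rw [← abs_of_nonneg hD0, ← abs_mul, ← hD]
    exact (abs_sub _ _).trans (by linarith [hMle (w z.1), hMle (w z.2)])
  have hfarT : k * |b| ^ (p - 1) ≤ T * H → k * D * (|b| ^ (p - 1) * |δ|) ≤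
      (Λ + 2 * M * T) * H := fun h => by
    calc k * D * (|b| ^ (p - 1) * |δ|) = k * |b| ^ (p - 1) * (D * |δ|) := by ring
      _ ≤ T * H * (2 * M) := by gcongr
      _ ≤ (Λ + 2 * M * T) * H := by nlinarith [mul_nonneg hΛ0.le hH0]
  have hzero : z.1 ∉ ball (0 : Rn n) R → z.2 ∉ ball (0 : Rn n) R →
      k * D * (|b| ^ (p - 1) * |δ|) ≤ (Λ + 2 * M * T) * H := fun h1 h2 => by
    have : δ = 0 := by rw [hδ, hw1 h1, hw2 h2, sub_zero]
    rw [this, abs_zero, mul_zero, mul_zero]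
    positivity
  by_cases h1 : z.1 ∈ ball (0 : Rn n) (2 * R)
  · by_cases h2 : z.2 ∈ ball (0 : Rn n) (2 * R)
    · refine main _ hnear ?_
      have hHge : diffQuot n s p g z ≤ H := by
        rw [hH, dataTerm, indicator_of_mem (Set.mk_mem_prod h1 h2)]
        linarith [farTerm_nonneg (s := s) (p := p) R g z,
          farTerm_nonneg (s := s) (p := p) R g z.swap]
      calc k * D * |b| ^ p ≤ (Λ * (1 / ‖z.1 - z.2‖ ^ (n + s * p))) * 1 * |b| ^ p := by gcongr
        _ = Λ * diffQuot n s p g z := by unfold diffQuot; ring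
        _ ≤ (Λ + 2 * M * T) * H := by
            have := mul_pos hM hT0
            refine mul_le_mul (by linarith) hHge (diffQuot_nonneg g z) (by linarith)
    · refine main _ hfar ?_
      by_cases h3 : z.1 ∈ ball (0 : Rn n) R
      · refine hfarT ((far_bound hn hs hp hΛ h3 h2 hku).trans ?_)
        refine mul_le_mul_of_nonneg_left ?_ hT0.le
        have e : farTerm n s p R g z = (|g z.1| ^ (p - 1) + |g z.2| ^ (p - 1)) *
            (1 / ‖z.2‖ ^ (n + s * p)) := indicator_of_mem (Set.mk_mem_prod h3 h2) _
        rw [← e, hH, dataTerm]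
        linarith [farTerm_nonneg (s := s) (p := p) R g z.swap, indicator_nonneg
          (s := ball (0 : Rn n) (2 * R) ×ˢ ball (0 : Rn n) (2 * R))
          (fun z _ => diffQuot_nonneg (s := s) (p := p) g z) z]
      · refine hzero h3 fun h4 => h2 (ball_subset_ball ?_ h4)
        have := pos_of_mem_ball h4
        linarith
  · refine main _ hfar ?_
    by_cases h3 : z.2 ∈ ball (0 : Rn n) R
    · rw [norm_sub_rev] at hku
      have h4 := far_bound (b₁ := g z.2) (b₂ := g z.1) hn hs hp hΛ h3 h1 hku
      rw [abs_sub_comm] at h4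
      refine hfarT (h4.trans ?_)
      refine mul_le_mul_of_nonneg_left ?_ hT0.le
      have e : farTerm n s p R g z.swap = (|g z.2| ^ (p - 1) + |g z.1| ^ (p - 1)) *
          (1 / ‖z.1‖ ^ (n + s * p)) := indicator_of_mem (Set.mk_mem_prod h3 h1) _
      rw [← e, hH, dataTerm]
      linarith [farTerm_nonneg (s := s) (p := p) R g z, indicator_nonneg
        (s := ball (0 : Rn n) (2 * R) ×ˢ ball (0 : Rn n) (2 * R))
        (fun z _ => diffQuot_nonneg (s := s) (p := p) g z) z]
    · refine hzero (fun h4 => h1 (ball_subset_ball ?_ h4)) h3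
      have := pos_of_mem_ball h4
      linarith

/-- The weighted energy estimate obtained by testing with a truncation of `u - g`. -/
lemma exists_weighted_energy_le (hn : 1 ≤ n) (hs : 0 < s) (hp : 1 < p) (hΛ : 1 ≤ Λ)
    (hK : KernelBounds n Λ s p K) (hΦ : PhiBounds Λ p Φ) {Ω : Set (Rn n)}
    (hΩ : MeasurableSet Ω) {ξ : ℝ} (hξ : 1 < ξ) {R : ℝ}
    (hΩR : Ω ⊆ ball (0 : Rn n) R) :
    ∃ C : ℝ≥0∞, C ≠ ⊤ ∧ ∀ w g f : Rn n → ℝ, memWspZero n s p Ω w → memWsp n s p univ g →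
      (∀ φ, memWspZero n s p Ω φ →
        nonlocalForm n Φ K (fun x => w x + g x) φ = ∫ x, φ x * f x) →
      ∫⁻ z, ENNReal.ofReal (diffQuot n s p w z * (1 + |w z.1| + |w z.2|) ^ (-ξ)) ≤
        C * ((∫⁻ x in Ω, ENNReal.ofReal |f x|) +
          ∫⁻ z, ENNReal.ofReal (dataTerm n s p R g z)) := by
  obtain ⟨A, B, hA, hB, hAB⟩ := exists_weighted_diffQuot_le hn hs hp hΛ hK hΦ hξ R
  obtain ⟨M, hM, hMle⟩ := exists_abs_slowTrunc_le hξ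
  have hξ0 : 0 ≤ ξ := by linarith
  have hp0 : 0 ≤ p := by linarith
  have hne : ENNReal.ofReal (A * M + B) ≠ 0 := by
    rw [Ne, ENNReal.ofReal_eq_zero, not_le]; positivity
  refine ⟨ENNReal.ofReal (A * M + B), ENNReal.ofReal_ne_top, fun w g f hw hg heq => ?_⟩
  by_cases htop : ∫⁻ z, ENNReal.ofReal (dataTerm n s p R g z) = ⊤
  · rw [htop, add_top, ENNReal.mul_top hne]; exact le_top
  have hH : Integrable (dataTerm n s p R g) := by
    refine ⟨(aemeasurable_dataTerm R hg.aemeasurable).aestronglyMeasurable, ?_⟩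
    rw [hasFiniteIntegral_iff_ofReal (Eventually.of_forall (dataTerm_nonneg R g))]
    exact Ne.lt_top htop
  have hφ : memWspZero n s p Ω fun x => slowTrunc ξ (w x) := by
    refine ⟨?_, ?_⟩
    · obtain ⟨h1, h2, h3⟩ := memWsp_univ_iff.1 hw.1
      refine memWsp_univ_iff.2 ⟨(continuous_slowTrunc hξ0).measurable.comp_aemeasurable h1,
        lt_of_le_of_lt (lintegral_mono fun x => ?_) h2,
        lt_of_le_of_lt (lintegral_mono fun z => ?_) h3⟩
      · exact ENNReal.ofReal_le_ofReal
          (Real.rpow_le_rpow (abs_nonneg _) (abs_slowTrunc_le hξ0 _) hp0)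
      · exact ENNReal.ofReal_le_ofReal (diffQuot_le_of_abs_le hp0 (abs_slowTrunc_sub_le hξ0 _ _))
    · filter_upwards [hw.2] with x hx h
      rw [hx h, slowTrunc_zero]
  have hwg := memWsp_univ_add hp0 hw.1 hg
  have hF := integrable_form hn hp hΛ hK hΦ hwg hφ.1
  have hle := hAB w g (by
    filter_upwards [hw.2] with x hx h
    exact hx fun h' => h (hΩR h'))
  have h1 : ENNReal.ofReal (nonlocalForm n Φ K (fun x => w x + g x) fun x => slowTrunc ξ (w x)) ≤
      ENNReal.ofReal M * ∫⁻ x in Ω, ENNReal.ofReal |f x| := by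
    rw [heq _ hφ]
    refine (ENNReal.ofReal_le_ofReal (Real.le_norm_self _)).trans ?_
    rw [ofReal_norm]
    refine (enorm_integral_le_lintegral_enorm _).trans ?_
    rw [lintegral_eq_setLIntegral_of_ae_zero (A := Ω)
      (F := fun x => ‖slowTrunc ξ (w x) * f x‖ₑ) hΩ (by
        filter_upwards [hφ.2] with x hx h
        rw [hx h, zero_mul, enorm_zero]),
      ← lintegral_const_mul' _ _ ENNReal.ofReal_ne_top]
    refine lintegral_mono fun x => ?_
    rw [← ENNReal.ofReal_mul hM.le, ← ofReal_norm, norm_mul]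
    exact ENNReal.ofReal_le_ofReal (by gcongr; exacts [hMle _, le_rfl])
  calc _ ≤ ∫⁻ z : Rn n × Rn n, ENNReal.ofReal (A * (Φ ((w z.1 + g z.1) - (w z.2 + g z.2)) *
          (slowTrunc ξ (w z.1) - slowTrunc ξ (w z.2)) * K z.1 z.2) +
        B * dataTerm n s p R g z) :=
        lintegral_mono_ae (hle.mono fun z hz => ENNReal.ofReal_le_ofReal hz)
    _ = ENNReal.ofReal (A * nonlocalForm n Φ K (fun x => w x + g x)
          (fun x => slowTrunc ξ (w x)) + B * ∫ z, dataTerm n s p R g z) := by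
        refine (ofReal_integral_eq_lintegral_ofReal
          ((hF.const_mul A).add (hH.const_mul B)) ?_).symm.trans ?_
        swap
        · rw [integral_add' (hF.const_mul A) (hH.const_mul B), integral_const_mul,
            integral_const_mul, nonlocalForm_eq hn hp hΛ hK hΦ hwg hφ.1]
        filter_upwards [hle] with z hz
        exact le_trans (mul_nonneg (diffQuot_nonneg w z) (by positivity)) hz
    _ ≤ ENNReal.ofReal A * (ENNReal.ofReal M * ∫⁻ x in Ω, ENNReal.ofReal |f x|) +
        ENNReal.ofReal B * ∫⁻ z, ENNReal.ofReal (dataTerm n s p R g z) := by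
        refine ENNReal.ofReal_add_le.trans (add_le_add ?_ (le_of_eq ?_))
        · rw [ENNReal.ofReal_mul hA.le]
          gcongr
        · rw [ENNReal.ofReal_mul hB.le, ofReal_integral_eq_lintegral_ofReal hH
            (Eventually.of_forall (dataTerm_nonneg R g))]
    _ ≤ _ := by
        rw [← mul_assoc, ← ENNReal.ofReal_mul hA.le, mul_add]
        have := mul_pos hA hM
        refine add_le_add (mul_le_mul_left (ENNReal.ofReal_le_ofReal ?_) _)
          (mul_le_mul_left (ENNReal.ofReal_le_ofReal ?_) _) <;> linarith

end WeightedEnergy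

/-! ### Moment bounds from weighted energies -/

section Moments

variable {n : ℕ} {s p : ℝ}

/-- The weighted Gagliardo integrand. -/
def weightedQuot (n : ℕ) (s p ξ : ℝ) (w : Rn n → ℝ) (z : Rn n × Rn n) : ℝ :=
  diffQuot n s p w z * (1 + |w z.1| + |w z.2|) ^ (-ξ)

lemma aemeasurable_weightedQuot (ξ : ℝ) {w : Rn n → ℝ} (hw : AEMeasurable w) :
    AEMeasurable (weightedQuot n s p ξ w) := by
  refine (aemeasurable_diffQuot hw).mul (AEMeasurable.pow_const ?_ _)
  exact ((aemeasurable_comp_fst (continuous_abs.measurable.comp_aemeasurable hw)).const_add 1).add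
    (aemeasurable_comp_snd (continuous_abs.measurable.comp_aemeasurable hw))

lemma exists_le_lintegral_weightedQuot (hn : 1 ≤ n) (hs : 0 < s) (hp : 0 < p) {ξ : ℝ}
    (hξ : 0 ≤ ξ) (hξp : ξ ≤ p) : ∃ c : ℝ, 0 < c ∧ ∀ (w : Rn n → ℝ) (x : Rn n) (t V : ℝ),
      1 ≤ t → t ≤ |w x| → 0 < V → volume {y | t / 2 < |w y|} ≤ ENNReal.ofReal V →
      ENNReal.ofReal (c * (t ^ (p - ξ) * V ^ (-(s * p / n)))) ≤
        ∫⁻ y, ENNReal.ofReal (weightedQuot n s p ξ w (x, y)) := by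
  have hn0 : (0 : ℝ) < n := by exact_mod_cast hn
  have : Nonempty (Fin n) := ⟨⟨0, hn⟩⟩
  set ω := (volume (ball (0 : Rn n) 1)).toReal with hω
  have hω0 : 0 < ω := ENNReal.toReal_pos (measure_ball_pos volume _ one_pos).ne'
    measure_ball_lt_top.ne
  refine ⟨(1 / 2 : ℝ) ^ p * 3 ^ (-ξ) * (ω / 2) * (2 / ω) ^ (-(s * p / n)), by positivity,
    fun w x t V ht htw hV hA => ?_⟩
  set ρ := (2 / ω * V) ^ (1 / n : ℝ) with hρ
  have hρ0 : 0 < ρ := by positivity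
  have hρn : ρ ^ n = 2 / ω * V := by
    rw [hρ, ← Real.rpow_natCast, ← Real.rpow_mul (by positivity), one_div_mul_cancel hn0.ne',
      Real.rpow_one]
  have hball : volume (ball x ρ) = ENNReal.ofReal (2 * V) := by
    rw [Measure.addHaar_ball _ _ hρ0.le, finrank_euclideanSpace_fin, hρn,
      ← ENNReal.ofReal_toReal (measure_ball_lt_top (x := (0 : Rn n)) (r := 1)).ne, ← hω,
      ← ENNReal.ofReal_mul (by positivity)]
    congr 1
    field_simp
  set A := toMeasurable volume {y | t / 2 < |w y|} with hAdef
  have hAs : {y | t / 2 < |w y|} ⊆ A := subset_toMeasurable _ _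
  have hS : ENNReal.ofReal V ≤ volume (ball x ρ \ A) := by
    refine le_trans ?_ le_measure_sdiff
    rw [hball, measure_toMeasurable]
    refine ENNReal.le_sub_of_add_le_right (ne_top_of_le_ne_top ENNReal.ofReal_ne_top hA) ?_
    calc _ ≤ ENNReal.ofReal V + ENNReal.ofReal V := by gcongr
      _ = _ := by rw [← ENNReal.ofReal_add hV.le hV.le, two_mul]
  have hpt : ∀ y ∈ ball x ρ \ A, (1 / 2 : ℝ) ^ p * 3 ^ (-ξ) * t ^ (p - ξ) * (1 / ρ ^ (n + s * p)) ≤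
      weightedQuot n s p ξ w (x, y) := by
    rintro y ⟨hy, hyA⟩
    have hwy : |w y| ≤ t / 2 := not_lt.1 fun h => hyA (hAs h)
    set a := |w x| with ha
    have ha0 : 0 < a := by linarith
    have hxy : 0 < ‖x - y‖ := by
      rw [norm_pos_iff, sub_ne_zero]
      rintro rfl
      linarith
    have hxyρ : ‖x - y‖ ≤ ρ := by
      rw [← dist_eq_norm, dist_comm]; exact (mem_ball.1 hy).le
    have h1 : 1 / 2 * a ≤ |w x - w y| := by
      have := abs_sub_abs_le_abs_sub (w x) (w y)
      linarith
    have h2 : (3 * a) ^ (-ξ) ≤ (1 + |w x| + |w y|) ^ (-ξ) :=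
      Real.rpow_le_rpow_of_nonpos (by positivity) (by linarith) (by linarith)
    have h3 : t ^ (p - ξ) ≤ a ^ (p - ξ) := by
      have : 0 ≤ p - ξ := by linarith
      gcongr
    calc (1 / 2 : ℝ) ^ p * 3 ^ (-ξ) * t ^ (p - ξ) * (1 / ρ ^ (n + s * p))
        ≤ (1 / 2 : ℝ) ^ p * 3 ^ (-ξ) * a ^ (p - ξ) * (1 / ρ ^ (n + s * p)) := by gcongr
      _ = (1 / 2 * a) ^ p * (1 / ρ ^ (n + s * p)) * (3 * a) ^ (-ξ) := by
          rw [Real.mul_rpow (by norm_num) ha0.le, Real.mul_rpow (by norm_num) ha0.le,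
            sub_eq_add_neg, Real.rpow_add ha0]
          ring
      _ ≤ |w x - w y| ^ p * (1 / ‖x - y‖ ^ (n + s * p)) * (1 + |w x| + |w y|) ^ (-ξ) := by
          gcongr
      _ = _ := by simp only [weightedQuot, diffQuot]; ring
  have hmeas : MeasurableSet (ball x ρ \ A) :=
    measurableSet_ball.diff (measurableSet_toMeasurable _ _)
  refine le_trans ?_ (setLIntegral_le_lintegral (ball x ρ \ A) _)
  refine le_trans ?_ (setLIntegral_mono' hmeas fun y hy => ENNReal.ofReal_le_ofReal (hpt y hy))
  rw [setLIntegral_const]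
  refine le_trans (le_of_eq ?_) (mul_le_mul_right hS _)
  rw [← ENNReal.ofReal_mul (by positivity)]
  congr 1
  have e1 : (2 / ω) ^ (-(s * p / n)) * V ^ (-(s * p / n)) = ρ ^ (-(s * p)) := by
    rw [← Real.mul_rpow (by positivity) hV.le, hρ, ← Real.rpow_mul (by positivity)]
    congr 1
    ring
  have e2 : ω / 2 * ρ ^ (-(s * p)) = 1 / ρ ^ (n + s * p) * V := by
    have : V = ω / 2 * ρ ^ n := by rw [hρn]; field_simp
    rw [this, Real.rpow_add hρ0, Real.rpow_natCast, Real.rpow_neg hρ0.le]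
    field_simp
  calc _ = (1 / 2 : ℝ) ^ p * 3 ^ (-ξ) * t ^ (p - ξ) *
        (ω / 2 * ((2 / ω) ^ (-(s * p / n)) * V ^ (-(s * p / n)))) := by ring
    _ = (1 / 2 : ℝ) ^ p * 3 ^ (-ξ) * t ^ (p - ξ) * (1 / ρ ^ (n + s * p) * V) := by
        rw [e1, ← e2]
    _ = _ := by ring

lemma exists_le_of_le_add_mul_rpow {θ : ℝ} (hθ : 0 < θ) (hθ1 : θ < 1) {a b : ℝ} (ha : 0 ≤ a)
    (hb : 0 ≤ b) : ∃ C : ℝ, 0 ≤ C ∧ ∀ X : ℝ, 0 ≤ X → X ≤ a + b * X ^ θ → X ≤ C := by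
  obtain ⟨C, hC, h⟩ := exists_rpow_le_eps_rpow hθ hθ1 (ε := 1 / (2 * (b + 1))) (by positivity)
  refine ⟨2 * a + 2 * b * C, by positivity, fun X hX hle => ?_⟩
  have h1 := h X hX
  rw [Real.rpow_one] at h1
  have h2 : b * X ^ θ ≤ b * (1 / (2 * (b + 1)) * X + C) := by gcongr
  have h3 : b * (1 / (2 * (b + 1)) * X) ≤ X / 2 := by
    have : b * (1 / (2 * (b + 1)) * X) = X / 2 * (b / (b + 1)) := by field_simp
    rw [this]
    refine mul_le_of_le_one_right (by positivity) ?_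
    rw [div_le_one (by positivity)]; linarith
  linarith

/-- A bound on the weighted energy controls the moment of order `(p - ξ) / (1 - θ)`. -/
lemma exists_moment_le (hn : 1 ≤ n) (hs : 0 < s) (hp : 0 < p) {ξ θ R : ℝ}
    (hξ : 0 ≤ ξ) (hξp : ξ < p) (hθ : 0 < θ) (hθ1 : θ < 1) (hθs : θ ≤ s * p / n) (hR : 0 < R)
    {E : ℝ≥0∞} (hE : E ≠ ⊤) :
    ∃ C : ℝ≥0∞, C ≠ ⊤ ∧ ∀ w : Rn n → ℝ, AEMeasurable w →
      (∀ᵐ x, x ∉ ball (0 : Rn n) R → w x = 0) →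
      ∫⁻ z, ENNReal.ofReal (weightedQuot n s p ξ w z) ≤ E →
      ∫⁻ x, ENNReal.ofReal (|w x| ^ ((p - ξ) / (1 - θ))) ≤ C := by
  have : Nonempty (Fin n) := ⟨⟨0, hn⟩⟩
  obtain ⟨c, hc, hlow⟩ := exists_le_lintegral_weightedQuot (n := n) (s := s) hn hs hp hξ hξp.le
  set m := (p - ξ) / (1 - θ) with hm
  have hm0 : 0 < m := div_pos (by linarith) (by linarith)
  have hmθ : p - ξ + m * θ = m := by
    rw [hm]; field_simp [show (1 - θ) ≠ 0 by linarith]; ring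
  set β := (volume (ball (0 : Rn n) R)).toReal with hβ
  have hβ0 : 0 < β := ENNReal.toReal_pos (measure_ball_pos volume _ hR).ne' measure_ball_lt_top.ne
  have hβe : volume (ball (0 : Rn n) R) = ENNReal.ofReal β :=
    (ENNReal.ofReal_toReal measure_ball_lt_top.ne).symm
  set c' := c * (β ^ (-(s * p / n - θ)) * 2 ^ (-(m * θ))) with hc'
  have hc'0 : 0 < c' := by positivity
  obtain ⟨C, hC, hCX⟩ := exists_le_of_le_add_mul_rpow hθ hθ1 hβ0.le
    (show 0 ≤ E.toReal / c' by positivity)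
  refine ⟨ENNReal.ofReal C, ENNReal.ofReal_ne_top, fun w hwm hw0 hwE => ?_⟩
  have habs : AEMeasurable fun x => |w x| := continuous_abs.measurable.comp_aemeasurable hwm
  refine lintegral_ofReal_liminf_le (F := fun (N : ℕ) x => (min |w x| N) ^ m)
    (fun N => (habs.min aemeasurable_const).pow_const m) (Eventually.of_forall fun x => ?_)
    fun N => ?_
  · refine tendsto_const_nhds.congr' ?_
    filter_upwards [eventually_ge_atTop ⌈|w x|⌉₊] with N hN
    rw [min_eq_left ((Nat.le_ceil _).trans (by exact_mod_cast hN))]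
  set v : Rn n → ℝ := fun x => min |w x| N with hv
  have hv0 : ∀ x, 0 ≤ v x := fun x => le_min (abs_nonneg _) (Nat.cast_nonneg N)
  have hvm : AEMeasurable v := habs.min aemeasurable_const
  change ∫⁻ x, ENNReal.ofReal (v x ^ m) ≤ _
  set I := ∫⁻ x, ENNReal.ofReal (v x ^ m) with hI
  have hvball : ∀ᵐ x, x ∉ ball (0 : Rn n) R → v x = 0 := by
    filter_upwards [hw0] with x hx h
    simp [hv, hx h]
  have hIball : I = ∫⁻ x in ball (0 : Rn n) R, ENNReal.ofReal (v x ^ m) :=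
    lintegral_eq_setLIntegral_of_ae_zero measurableSet_ball (by
      filter_upwards [hvball] with x hx h
      rw [hx h, Real.zero_rpow hm0.ne', ENNReal.ofReal_zero])
  have hItop : I ≠ ⊤ := by
    rw [hIball]
    refine ne_top_of_le_ne_top (b := ENNReal.ofReal ((N : ℝ) ^ m) * volume (ball (0 : Rn n) R))
      (ENNReal.mul_ne_top ENNReal.ofReal_ne_top measure_ball_lt_top.ne) ?_
    rw [← setLIntegral_const]
    exact lintegral_mono fun x => ENNReal.ofReal_le_ofReal
      (Real.rpow_le_rpow (hv0 x) (min_le_right _ _) hm0.le)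
  rcases eq_or_ne I 0 with hI0 | hI0
  · rw [hI0]; exact zero_le
  set X := I.toReal with hX
  have hX0 : 0 < X := ENNReal.toReal_pos hI0 hItop
  have hXI : I = ENNReal.ofReal X := (ENNReal.ofReal_toReal hItop).symm
  have hpt : ∀ x, 1 ≤ v x → ENNReal.ofReal (c' * X ^ (-θ)) * ENNReal.ofReal (v x ^ m) ≤
      ∫⁻ y, ENNReal.ofReal (weightedQuot n s p ξ w (x, y)) := by
    intro x hx
    have hvx : 0 < v x := by linarith
    have hvN : v x / 2 < N := by
      have : v x ≤ N := min_le_right _ _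
      linarith
    set V := min ((2 / v x) ^ m * X) β with hV
    have hV0 : 0 < V := lt_min (by positivity) hβ0
    have hA : volume {y | v x / 2 < |w y|} ≤ ENNReal.ofReal V := by
      rw [hV, ENNReal.ofReal_min]
      refine le_min ?_ ?_
      · have hcheb := mul_meas_ge_le_lintegral₀ (μ := volume) (hvm.pow_const m).ennreal_ofReal
          (ENNReal.ofReal ((v x / 2) ^ m))
        have h1 : {y | v x / 2 < |w y|} ⊆
            {y | ENNReal.ofReal ((v x / 2) ^ m) ≤ ENNReal.ofReal (v y ^ m)} := fun y hy =>
          ENNReal.ofReal_le_ofReal (Real.rpow_le_rpow (by positivity)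
            (le_min (le_of_lt hy) hvN.le) hm0.le)
        have h2 := (mul_le_mul_right (measure_mono h1) _).trans hcheb
        have h3 : 0 < (v x / 2) ^ m := by positivity
        rw [ENNReal.ofReal_mul (by positivity), ← hXI]
        calc _ = ENNReal.ofReal ((2 / v x) ^ m) * (ENNReal.ofReal ((v x / 2) ^ m) *
              volume {y | v x / 2 < |w y|}) := by
              rw [← mul_assoc, ← ENNReal.ofReal_mul (by positivity),
                ← Real.mul_rpow (by positivity) (by positivity),
                show 2 / v x * (v x / 2) = 1 by field_simp, Real.one_rpow, ENNReal.ofReal_one,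
                one_mul]
          _ ≤ _ := mul_le_mul_right h2 _
      · rw [← hβe]
        refine measure_mono_ae ?_
        filter_upwards [hw0] with y hy h
        by_contra h'
        have h : v x / 2 < |w y| := h
        rw [hy h', abs_zero] at h
        linarith
    refine le_trans ?_ (hlow w x (v x) V hx (min_le_left _ _) hV0 hA)
    rw [← ENNReal.ofReal_mul (by positivity)]
    refine ENNReal.ofReal_le_ofReal ?_
    have h1 : β ^ (-(s * p / n - θ)) ≤ V ^ (-(s * p / n - θ)) :=
      Real.rpow_le_rpow_of_nonpos hV0 (min_le_right _ _) (by linarith)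
    have h2 : ((2 / v x) ^ m * X) ^ (-θ) ≤ V ^ (-θ) :=
      Real.rpow_le_rpow_of_nonpos hV0 (min_le_left _ _) (by linarith)
    have h3 : V ^ (-(s * p / n)) = V ^ (-(s * p / n - θ)) * V ^ (-θ) := by
      rw [← Real.rpow_add hV0]; congr 1; ring
    have h4 : ((2 / v x) ^ m * X) ^ (-θ) = 2 ^ (-(m * θ)) * v x ^ (m * θ) * X ^ (-θ) := by
      rw [Real.mul_rpow (by positivity) hX0.le, ← Real.rpow_mul (by positivity),
        Real.div_rpow (by norm_num) hvx.le, mul_neg, Real.rpow_neg hvx.le (m * θ), div_inv_eq_mul]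
    rw [h3]
    calc c' * X ^ (-θ) * v x ^ m = c * (v x ^ (p - ξ) * (β ^ (-(s * p / n - θ)) *
          ((2 / v x) ^ m * X) ^ (-θ))) := by
          rw [h4, hc', ← hmθ, Real.rpow_add hvx]
          simp only [hmθ]
          ring
      _ ≤ _ := by gcongr
  have hbig : ENNReal.ofReal (c' * X ^ (-θ)) * ∫⁻ x in {x | 1 ≤ v x}, ENNReal.ofReal (v x ^ m) ≤
      E := by
    rw [← lintegral_const_mul' _ _ ENNReal.ofReal_ne_top]
    refine le_trans ?_ hwE
    have hprod : ∫⁻ z : Rn n × Rn n, ENNReal.ofReal (weightedQuot n s p ξ w z) =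
        ∫⁻ x, ∫⁻ y, ENNReal.ofReal (weightedQuot n s p ξ w (x, y)) :=
      lintegral_prod _ (aemeasurable_weightedQuot ξ hwm).ennreal_ofReal
    rw [hprod, ← lintegral_indicator₀ (nullMeasurableSet_le aemeasurable_const hvm)]
    refine lintegral_mono fun x => ?_
    by_cases hx : 1 ≤ v x
    · rw [indicator_of_mem (show x ∈ {x | 1 ≤ v x} from hx)]
      exact hpt x hx
    · rw [indicator_of_notMem (show x ∉ {x | 1 ≤ v x} from hx)]
      exact zero_le
  have hsmall : I ≤ ENNReal.ofReal β + ∫⁻ x in {x | 1 ≤ v x}, ENNReal.ofReal (v x ^ m) := by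
    rw [← hβe, ← setLIntegral_one, ← lintegral_indicator measurableSet_ball,
      ← lintegral_indicator₀ (nullMeasurableSet_le aemeasurable_const hvm),
      ← lintegral_add_left (measurable_const.indicator measurableSet_ball)]
    refine lintegral_mono_ae ?_
    filter_upwards [hvball] with x hx
    by_cases h1 : 1 ≤ v x
    · rw [indicator_of_mem (show x ∈ {x | 1 ≤ v x} from h1)]
      exact le_add_self
    · by_cases h2 : x ∈ ball (0 : Rn n) R
      · rw [indicator_of_mem h2]
        refine le_add_right (ENNReal.ofReal_le_one.2 ?_)
        exact Real.rpow_le_one (hv0 x) (not_le.1 h1).le hm0.le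
      · rw [hx h2, Real.zero_rpow hm0.ne', ENNReal.ofReal_zero]
        exact zero_le
  have hbig' : ∫⁻ x in {x | 1 ≤ v x}, ENNReal.ofReal (v x ^ m) ≤
      ENNReal.ofReal (E.toReal / c' * X ^ θ) := by
    have h0 : 0 < c' * X ^ (-θ) := by positivity
    calc _ = ENNReal.ofReal (1 / (c' * X ^ (-θ))) * (ENNReal.ofReal (c' * X ^ (-θ)) *
          ∫⁻ x in {x | 1 ≤ v x}, ENNReal.ofReal (v x ^ m)) := by
          rw [← mul_assoc, ← ENNReal.ofReal_mul (by positivity), one_div_mul_cancel h0.ne',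
            ENNReal.ofReal_one, one_mul]
      _ ≤ ENNReal.ofReal (1 / (c' * X ^ (-θ))) * ENNReal.ofReal E.toReal := by
          rw [ENNReal.ofReal_toReal hE]
          exact mul_le_mul_right hbig _
      _ = _ := by
          rw [← ENNReal.ofReal_mul (by positivity)]
          congr 1
          rw [Real.rpow_neg hX0.le]
          field_simp
  have hfin : I ≤ ENNReal.ofReal (β + E.toReal / c' * X ^ θ) := by
    rw [ENNReal.ofReal_add hβ0.le (by positivity)]
    exact hsmall.trans (by gcongr)
  rw [hXI] at hfin ⊢
  exact ENNReal.ofReal_le_ofReal (hCX X hX0.le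
    ((ENNReal.ofReal_le_ofReal_iff (by positivity)).1 hfin))

end Moments

/-! ### Uniform estimates for solutions with measure data -/

section UniformEstimates

variable {n : ℕ} {s p Λ : ℝ} {Φ : ℝ → ℝ} {K : Rn n → Rn n → ℝ}

lemma one_lt_of_lt (hn : 2 ≤ n) (hs1 : s < 1) (hp : 2 - s / (n : ℝ) < p) : 1 < p := by
  have hn0 : (2 : ℝ) ≤ n := by exact_mod_cast hn
  have : s / n < 1 := by rw [div_lt_one (by linarith)]; linarith
  linarith

lemma qStar_lt_qBar (hn : 2 ≤ n) (hs : 0 < s) (hs1 : s < 1) (hp : 2 - s / (n : ℝ) < p) :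
    qStar p < qBar n s p := by
  have hn0 : (2 : ℝ) ≤ n := by exact_mod_cast hn
  have hp1 := one_lt_of_lt hn hs1 hp
  have hns : 0 < (n : ℝ) - s := by linarith
  refine max_lt (lt_min ?_ hp1) (lt_min ?_ (by linarith))
  · rw [lt_div_iff₀ hns]
    have h1 : (2 - s / n) * n < p * n := by gcongr
    have h2 : (2 - s / n) * n = 2 * n - s := by field_simp
    linarith
  · rw [lt_div_iff₀ hns]
    nlinarith

lemma exists_truncation_parameters (hn : 1 ≤ n) (hs : 0 < s) (hs1 : s < 1) (hp : 1 < p) {q : ℝ}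
    (hq : 0 < q) (hq' : q < qBar n s p) : ∃ ξ θ : ℝ, 1 < ξ ∧ ξ < p ∧ 0 < θ ∧ θ < 1 ∧
      θ ≤ s * p / n ∧ ξ * q / (p - q) ≤ (p - ξ) / (1 - θ) := by
  have hn0 : (1 : ℝ) ≤ n := by exact_mod_cast hn
  have hqp : q < p := hq'.trans_le (min_le_right _ _)
  have hns : 0 < (n : ℝ) - s := by linarith
  have hqn : q * (n - s) < n * (p - 1) := by
    rw [← lt_div_iff₀ hns]; exact hq'.trans_le (min_le_left _ _)
  set L := (p - 1) * (p - q) / q with hL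
  have hL0 : 0 < L := div_pos (mul_pos (by linarith) (by linarith)) hq
  have hLs : 1 - s * p / n < L := by
    rw [hL, lt_div_iff₀ hq, ← mul_lt_mul_iff_right₀ (show (0 : ℝ) < n by linarith)]
    have e : n * ((1 - s * p / n) * q) = q * (n - s * p) := by field_simp
    rw [e]
    nlinarith
  obtain ⟨θ, hθ0, hθ1, hθs, hθL⟩ : ∃ θ : ℝ, 0 < θ ∧ θ < 1 ∧ θ ≤ s * p / n ∧ 1 - θ < L := by
    refine ⟨min (s * p / n) (max (1 / 2) (1 - L / 2)), lt_min (by positivity)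
      (lt_max_of_lt_left (by norm_num)), min_lt_of_right_lt (max_lt (by norm_num) (by linarith)),
      min_le_left _ _, ?_⟩
    rcases min_choice (s * p / n) (max (1 / 2) (1 - L / 2)) with h | h <;> rw [h]
    · exact hLs
    · linarith [le_max_right (1 / 2) (1 - L / 2)]
  have hstrict : 1 * q * (1 - θ) < (p - 1) * (p - q) := by
    rw [hL, lt_div_iff₀ hq] at hθL
    linarith
  have hev : ∀ᶠ ξ in 𝓝[>] (1 : ℝ), ξ * q * (1 - θ) < (p - ξ) * (p - q) :=
    (ContinuousAt.eventually_lt (f := fun ξ => ξ * q * (1 - θ))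
      (g := fun ξ => (p - ξ) * (p - q)) (by fun_prop) (by fun_prop) hstrict).filter_mono
        nhdsWithin_le_nhds
  obtain ⟨ξ, hξ, hξI⟩ := (hev.and (Ioo_mem_nhdsGT hp)).exists
  refine ⟨ξ, θ, hξI.1, hξI.2, hθ0, hθ1, hθs, ?_⟩
  rw [div_le_div_iff₀ (by linarith) (by linarith)]
  exact hξ.le

/-- Uniform fractional Sobolev bounds for `w = u - g` in terms of the total mass of the datum. -/
lemma exists_uniform_bound (hn : 1 ≤ n) (hs : 0 < s) (hs1 : s < 1) (hp : 1 < p) (hΛ : 1 ≤ Λ)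
    (hK : KernelBounds n Λ s p K) (hΦ : PhiBounds Λ p Φ) {Ω : Set (Rn n)}
    (hΩ : MeasurableSet Ω) {R : ℝ} (hR : 0 < R) (hΩR : Ω ⊆ ball (0 : Rn n) R) {h q : ℝ}
    (hhs : h < s) (hq : 0 < q) (hq' : q < qBar n s p) {E : ℝ≥0∞} (hE : E ≠ ⊤) :
    ∃ C : ℝ≥0∞, C ≠ ⊤ ∧ ∀ w g f : Rn n → ℝ, memWspZero n s p Ω w → memWsp n s p univ g →
      (∀ φ, memWspZero n s p Ω φ →
        nonlocalForm n Φ K (fun x => w x + g x) φ = ∫ x, φ x * f x) →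
      (∫⁻ x in Ω, ENNReal.ofReal |f x|) + ∫⁻ z, ENNReal.ofReal (dataTerm n s p R g z) ≤ E →
      ∫⁻ z in ball (0 : Rn n) (2 * R) ×ˢ ball (0 : Rn n) (2 * R),
          ENNReal.ofReal (diffQuot n h q w z) ≤ C ∧
        (p - 1 ≤ q → ∫⁻ x, ENNReal.ofReal (|w x| ^ q) ≤ C) := by
  have hp0 : 0 < p := by linarith
  have hqp : q < p := hq'.trans_le (min_le_right _ _)
  obtain ⟨ξ, θ, hξ, hξp, hθ, hθ1, hθs, hle⟩ := exists_truncation_parameters hn hs hs1 hp hq hq'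
  set m := (p - ξ) / (1 - θ) with hm
  set e := ξ * q / (p - q) with he
  have he0 : 0 ≤ e := div_nonneg (by positivity) (by linarith)
  obtain ⟨C₁, hC₁, h₁⟩ := exists_weighted_energy_le hn hs hp hΛ hK hΦ hΩ hξ hΩR
  obtain ⟨C₂, hC₂, h₂⟩ := exists_moment_le (n := n) hn hs hp0 (by linarith) hξp hθ hθ1 hθs hR
    (ENNReal.mul_ne_top hC₁ hE)
  obtain ⟨C₃, hC₃, h₃⟩ := exists_lintegral_diffQuot_le (n := n) (s := s) hn hq hqp hhs
    (by linarith : 0 ≤ ξ) (2 * R)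
  have hball : volume (ball (0 : Rn n) (2 * R)) ≠ ⊤ := measure_ball_lt_top.ne
  refine ⟨C₁ * E + C₃ * (2 * volume (ball (0 : Rn n) (2 * R)) + C₂) +
    (volume (ball (0 : Rn n) (2 * R)) + C₂), ?_, fun w g f hw hg heq hEle => ?_⟩
  · simp only [ne_eq, ENNReal.add_eq_top, not_or]
    exact ⟨⟨ENNReal.mul_ne_top hC₁ hE, ENNReal.mul_ne_top hC₃ (ENNReal.add_ne_top.2
      ⟨ENNReal.mul_ne_top (by norm_num) hball, hC₂⟩)⟩, hball, hC₂⟩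
  have hwm := hw.1.aemeasurable
  have hw0 : ∀ᵐ x, x ∉ ball (0 : Rn n) R → w x = 0 := by
    filter_upwards [hw.2] with x hx h
    exact hx fun h' => h (hΩR h')
  have hen : ∫⁻ z, ENNReal.ofReal (weightedQuot n s p ξ w z) ≤ C₁ * E :=
    (h₁ w g f hw hg heq).trans (mul_le_mul_right hEle _)
  have hmom := h₂ w hwm hw0 hen
  constructor
  · refine (h₃ w hwm).trans (le_add_right (add_le_add ?_ (mul_le_mul_right ?_ _)))
    · exact (setLIntegral_le_lintegral _ _).trans hen
    · calc _ ≤ ∫⁻ x in ball (0 : Rn n) (2 * R), (2 + ENNReal.ofReal (|w x| ^ m)) := by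
            refine lintegral_mono fun x => ?_
            rw [← ENNReal.ofReal_ofNat, ← ENNReal.ofReal_add (by norm_num) (by positivity)]
            refine ENNReal.ofReal_le_ofReal ?_
            linarith [rpow_le_one_add_rpow he0 hle (abs_nonneg (w x))]
        _ = 2 * volume (ball (0 : Rn n) (2 * R)) +
            ∫⁻ x in ball (0 : Rn n) (2 * R), ENNReal.ofReal (|w x| ^ m) := by
            rw [lintegral_add_left measurable_const, setLIntegral_const]
        _ ≤ _ := by
            gcongr
            exact (setLIntegral_le_lintegral _ _).trans hmom
  · intro hpq
    have hqe : q ≤ e := by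
      rw [he, le_div_iff₀ (by linarith)]
      nlinarith
    have hw2 : ∀ᵐ x, x ∉ ball (0 : Rn n) (2 * R) → ENNReal.ofReal (|w x| ^ q) = 0 := by
      filter_upwards [hw0] with x hx h
      rw [hx fun h' => h (ball_subset_ball (by linarith) h'), abs_zero, Real.zero_rpow hq.ne',
        ENNReal.ofReal_zero]
    rw [lintegral_eq_setLIntegral_of_ae_zero measurableSet_ball hw2]
    refine le_add_left ?_
    calc _ ≤ ∫⁻ x in ball (0 : Rn n) (2 * R), (1 + ENNReal.ofReal (|w x| ^ m)) := by
          refine lintegral_mono fun x => ?_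
          rw [← ENNReal.ofReal_one, ← ENNReal.ofReal_add (by norm_num) (by positivity)]
          exact ENNReal.ofReal_le_ofReal
            (rpow_le_one_add_rpow hq.le (hqe.trans hle) (abs_nonneg (w x)))
      _ = volume (ball (0 : Rn n) (2 * R)) +
          ∫⁻ x in ball (0 : Rn n) (2 * R), ENNReal.ofReal (|w x| ^ m) := by
          rw [lintegral_add_left measurable_const, setLIntegral_const, one_mul]
      _ ≤ _ := by
          gcongr
          exact (setLIntegral_le_lintegral _ _).trans hmom

end UniformEstimates

/-- The bump function supported in the ball of radius `1 / (j + 1)`. -/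
def smallBump (n j : ℕ) : ContDiffBump (0 : Rn n) where
  rIn := 1 / (2 * ((j : ℝ) + 1))
  rOut := 1 / ((j : ℝ) + 1)
  rIn_pos := by positivity
  rIn_lt_rOut := by
    have : (0 : ℝ) < (j : ℝ) + 1 := by positivity
    apply one_div_lt_one_div_of_lt this
    linarith

/-- The cutoff equal to `1` on the ball of radius `j + 1`. -/
def largeBump (n j : ℕ) : ContDiffBump (0 : Rn n) where
  rIn := (j : ℝ) + 1
  rOut := (j : ℝ) + 2
  rIn_pos := by positivity
  rIn_lt_rOut := by linarith

/-- The standard mollifier with support of radius `1 / (j + 1)`. -/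
def mollifier (n j : ℕ) : Rn n → ℝ := (smallBump n j).normed volume

lemma mollifier_nonneg (n j : ℕ) (x : Rn n) : 0 ≤ mollifier n j x :=
  (smallBump n j).nonneg_normed x

lemma continuous_mollifier (n j : ℕ) : Continuous (mollifier n j) :=
  (smallBump n j).continuous_normed

lemma mollifier_eq_zero {n j : ℕ} {x : Rn n} (hx : 1 / ((j : ℝ) + 1) ≤ ‖x‖) :
    mollifier n j x = 0 := by
  by_contra h
  have h1 : x ∈ Function.support (mollifier n j) := h
  rw [mollifier, ContDiffBump.support_normed_eq, mem_ball_zero_iff] at h1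
  exact absurd h1 (not_lt.2 hx)

lemma tendsto_smallBump_rOut (n : ℕ) :
    Tendsto (fun j => (smallBump n j).rOut) atTop (𝓝 0) :=
  tendsto_one_div_add_atTop_nhds_zero_nat

lemma lintegral_mollifier (n j : ℕ) : ∫⁻ x, ENNReal.ofReal (mollifier n j x) = 1 := by
  rw [← ofReal_integral_eq_lintegral_ofReal (f := mollifier n j) (smallBump n j).integrable_normed
    (Eventually.of_forall (mollifier_nonneg n j))]
  simp [mollifier, ContDiffBump.integral_normed]

lemma lintegral_mollifier_sub_right (n j : ℕ) (y : Rn n) :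
    ∫⁻ x, ENNReal.ofReal (mollifier n j (x - y)) = 1 := by
  rw [lintegral_sub_right_eq_self (fun x => ENNReal.ofReal (mollifier n j x)) y,
    lintegral_mollifier]

/-- The mollification of the measure with density `f` with respect to `ν`. -/
def mollify (n j : ℕ) (ν : Measure (Rn n)) (f : Rn n → ℝ) (x : Rn n) : ℝ :=
  ∫ y, f y * mollifier n j (x - y) ∂ν

lemma contDiff_mollify {n : ℕ} (j : ℕ) {ν : Measure (Rn n)} {f : Rn n → ℝ}
    (hf : LocallyIntegrable f ν) : ContDiff ℝ (⊤ : ℕ∞) (mollify n j ν f) :=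
  HasCompactSupport.contDiff_convolution_right (ContinuousLinearMap.mul ℝ ℝ)
    (smallBump n j).hasCompactSupport_normed hf (smallBump n j).contDiff_normed

lemma contDiff_cutoff_mul {n : ℕ} (j : ℕ) {F : Rn n → ℝ} (hF : ContDiff ℝ (⊤ : ℕ∞) F) :
    ContDiff ℝ (⊤ : ℕ∞) (fun x => largeBump n j x * F x) :=
  (largeBump n j).contDiff.mul hF

lemma hasCompactSupport_cutoff_mul {n : ℕ} (j : ℕ) (F : Rn n → ℝ) :
    HasCompactSupport (fun x => largeBump n j x * F x) :=
  (largeBump n j).hasCompactSupport.mul_right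

lemma largeBump_eq_one {n j : ℕ} {x : Rn n} (hx : ‖x‖ ≤ (j : ℝ) + 1) : largeBump n j x = 1 :=
  (largeBump n j).one_of_mem_closedBall (mem_closedBall_zero_iff.2 hx)

lemma abs_largeBump_mul_le (n j : ℕ) (x : Rn n) (t : ℝ) : |largeBump n j x * t| ≤ |t| := by
  rw [abs_mul, abs_of_nonneg (largeBump n j).nonneg]
  exact mul_le_of_le_one_left (abs_nonneg _) (largeBump n j).le_one

lemma measurable_mollifier_sub (n j : ℕ) :
    Measurable (fun z : Rn n × Rn n => mollifier n j (z.1 - z.2)) :=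
  ((continuous_mollifier n j).comp (continuous_fst.sub continuous_snd)).measurable

lemma setLIntegral_mollify_one_le {n : ℕ} (j : ℕ) (ν : Measure (Rn n)) [IsFiniteMeasure ν]
    {A A' : Set (Rn n)} (hA : MeasurableSet A) (hA' : MeasurableSet A')
    (h : ∀ x ∈ A, ∀ y, ‖x - y‖ < 1 / ((j : ℝ) + 1) → y ∈ A') :
    ∫⁻ x in A, ENNReal.ofReal |mollify n j ν (fun _ => 1) x| ≤ ν A' := by
  have hm : Measurable (fun z : Rn n × Rn n => ENNReal.ofReal (mollifier n j (z.1 - z.2))) :=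
    (measurable_mollifier_sub n j).ennreal_ofReal
  calc ∫⁻ x in A, ENNReal.ofReal |mollify n j ν (fun _ => 1) x|
      ≤ ∫⁻ x in A, ∫⁻ y, ENNReal.ofReal (mollifier n j (x - y)) ∂ν := by
        refine lintegral_mono fun x => ?_
        have := enorm_integral_le_lintegral_enorm (μ := ν)
          (fun y => (1 : ℝ) * mollifier n j (x - y))
        rw [← ofReal_norm, Real.norm_eq_abs] at this
        refine this.trans (lintegral_mono fun y => ?_)
        rw [← ofReal_norm, Real.norm_eq_abs, one_mul, abs_of_nonneg (mollifier_nonneg n j _)]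
    _ = ∫⁻ y, (∫⁻ x in A, ENNReal.ofReal (mollifier n j (x - y))) ∂ν :=
        lintegral_lintegral_swap hm.aemeasurable
    _ ≤ ∫⁻ y, A'.indicator 1 y ∂ν := by
        refine lintegral_mono fun y => ?_
        by_cases hy : y ∈ A'
        · rw [indicator_of_mem hy, Pi.one_apply, ← lintegral_mollifier_sub_right n j y]
          exact setLIntegral_le_lintegral _ _
        · rw [indicator_of_notMem hy]
          rw [setLIntegral_congr_fun (g := fun _ => 0) hA]
          · simp
          · intro x hx
            have : mollifier n j (x - y) = 0 := by
              refine mollifier_eq_zero (not_lt.1 fun hlt => hy (h x hx y hlt))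
            simp [this]
    _ = ν A' := by rw [lintegral_indicator_one hA']

lemma integrable_mollifier_sub_prod {n : ℕ} (j : ℕ) (ν : Measure (Rn n)) [IsFiniteMeasure ν] :
    Integrable (fun z : Rn n × Rn n => mollifier n j (z.1 - z.2)) (volume.prod ν) := by
  refine ⟨(measurable_mollifier_sub n j).aestronglyMeasurable, ?_⟩
  rw [hasFiniteIntegral_iff_ofReal (Eventually.of_forall fun z => mollifier_nonneg n j _),
    lintegral_prod_symm _ (measurable_mollifier_sub n j).ennreal_ofReal.aemeasurable]
  simp [lintegral_mollifier_sub_right]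

lemma tendsto_integral_mul_mollify {n : ℕ} (ν : Measure (Rn n)) [IsFiniteMeasure ν]
    {φ : Rn n → ℝ} (hφ : Continuous φ) (hc : HasCompactSupport φ) :
    Tendsto (fun j => ∫ x, φ x * mollify n j ν (fun _ => 1) x) atTop (𝓝 (∫ x, φ x ∂ν)) := by
  obtain ⟨M, hM⟩ := hφ.bounded_above_of_compact_support hc
  have heq : ∀ j, ∫ x, φ x * mollify n j ν (fun _ => 1) x =
      ∫ y, (∫ x, φ x * mollifier n j (x - y)) ∂ν := by
    intro j
    rw [← integral_integral_swap
      (f := fun x y => φ x * mollifier n j (x - y)) (μ := volume) (ν := ν)]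
    · refine integral_congr_ae (Eventually.of_forall fun x => ?_)
      simp only [mollify, one_mul]
      rw [integral_const_mul]
    · exact (integrable_mollifier_sub_prod j ν).bdd_mul
        (hφ.comp continuous_fst).aestronglyMeasurable
        (Eventually.of_forall fun z => hM z.1)
  simp_rw [heq]
  have hswap : ∀ j y, ∫ x, φ x * mollifier n j (x - y) =
      (convolution ((smallBump n j).normed volume) φ (ContinuousLinearMap.lsmul ℝ ℝ) volume) y := by
    intro j y
    rw [convolution_lsmul_swap]
    refine integral_congr_ae (Eventually.of_forall fun x => ?_)
    simp only [smul_eq_mul]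
    rw [← (smallBump n j).normed_neg, neg_sub, mul_comm]
    rfl
  refine tendsto_integral_of_dominated_convergence (fun _ => M) ?_ (integrable_const M) ?_ ?_
  · intro j
    simp_rw [hswap]
    exact (HasCompactSupport.continuous_convolution_left _ (smallBump n j).hasCompactSupport_normed
      (smallBump n j).continuous_normed
      (hφ.locallyIntegrable)).aestronglyMeasurable
  · intro j
    refine Eventually.of_forall fun y => ?_
    refine (norm_integral_le_integral_norm _).trans ?_
    have hi : Integrable (fun x => mollifier n j (x - y)) :=
      (smallBump n j).integrable_normed.comp_sub_right y
    calc ∫ x, ‖φ x * mollifier n j (x - y)‖ ≤ ∫ x, M * mollifier n j (x - y) := by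
          refine integral_mono_of_nonneg (Eventually.of_forall fun _ => norm_nonneg _)
            (hi.const_mul M) (Eventually.of_forall fun x => ?_)
          beta_reduce
          rw [norm_mul, Real.norm_of_nonneg (mollifier_nonneg n j _)]
          exact mul_le_mul_of_nonneg_right (hM x) (mollifier_nonneg n j _)
      _ = M := by
          rw [integral_const_mul, integral_sub_right_eq_self (mollifier n j) y]
          simp [mollifier, ContDiffBump.integral_normed]
  · refine Eventually.of_forall fun y => ?_
    simp_rw [hswap]
    exact ContDiffBump.convolution_tendsto_right_of_continuous (tendsto_smallBump_rOut n) hφ y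

/-- Smooth compactly supported approximations of a signed measure. -/
lemma exists_smooth_approx_measure {n : ℕ} (μ : SignedMeasure (Rn n)) :
    ∃ f : ℕ → Rn n → ℝ,
      (∀ j, ContDiff ℝ (⊤ : ℕ∞) (f j) ∧ HasCompactSupport (f j)) ∧
      (∀ j, ∫⁻ x, ENNReal.ofReal |f j x| ≤ μ.totalVariation univ) ∧
      (∀ φ : Rn n → ℝ, Continuous φ → HasCompactSupport φ →
        Tendsto (fun j => ∫ x, φ x * f j x) atTop (𝓝 (sintegral n μ φ))) ∧
      ∀ (z : Rn n) (r : ℝ),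
        Filter.limsup (fun j => ∫⁻ x in ball z r, ENNReal.ofReal |f j x|) atTop
          ≤ μ.totalVariation (closedBall z r) := by
  set P := μ.toJordanDecomposition.posPart with hP
  set N := μ.toJordanDecomposition.negPart with hN
  have hPf : IsFiniteMeasure P := by rw [hP]; infer_instance
  have hNf : IsFiniteMeasure N := by rw [hN]; infer_instance
  have htv : μ.totalVariation = P + N := rfl
  have hli : ∀ ν : Measure (Rn n), IsFiniteMeasure ν →
      LocallyIntegrable (fun _ : Rn n => (1 : ℝ)) ν := fun ν _ =>
    (integrable_const 1).locallyIntegrable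
  have hcd : ∀ (ν : Measure (Rn n)) (_ : IsFiniteMeasure ν) j,
      ContDiff ℝ (⊤ : ℕ∞) (mollify n j ν (fun _ => 1)) := fun ν hν j =>
    contDiff_mollify j (hli ν hν)
  let f : ℕ → Rn n → ℝ := fun j x => largeBump n j x *
    (mollify n j P (fun _ => 1) x - mollify n j N (fun _ => 1) x)
  have hbound : ∀ (j : ℕ) (A A' : Set (Rn n)), MeasurableSet A → MeasurableSet A' →
      (∀ x ∈ A, ∀ y, ‖x - y‖ < 1 / ((j : ℝ) + 1) → y ∈ A') →
      ∫⁻ x in A, ENNReal.ofReal |f j x| ≤ μ.totalVariation A' := by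
    intro j A A' hA hA' h
    rw [htv, Measure.add_apply]
    refine le_trans ?_ (add_le_add (setLIntegral_mollify_one_le j P hA hA' h)
      (setLIntegral_mollify_one_le j N hA hA' h))
    rw [← lintegral_add_left ((hcd P hPf j).continuous.abs.measurable.ennreal_ofReal)]
    refine lintegral_mono fun x => ?_
    rw [← ENNReal.ofReal_add (abs_nonneg _) (abs_nonneg _)]
    exact ENNReal.ofReal_le_ofReal ((abs_largeBump_mul_le n j x _).trans (abs_sub _ _))
  refine ⟨f, fun j => ⟨contDiff_cutoff_mul j ((hcd P hPf j).sub (hcd N hNf j)),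
    hasCompactSupport_cutoff_mul j _⟩, fun j => ?_, fun φ hφ hc => ?_, fun z r => ?_⟩
  · have := hbound j univ univ MeasurableSet.univ MeasurableSet.univ (fun _ _ y _ => mem_univ y)
    rwa [Measure.restrict_univ] at this
  · have h1 := (tendsto_integral_mul_mollify P hφ hc).sub (tendsto_integral_mul_mollify N hφ hc)
    refine h1.congr' ?_
    obtain ⟨R, hR⟩ := hc.isCompact.isBounded.subset_ball 0
    filter_upwards [tendsto_natCast_atTop_atTop.eventually_ge_atTop R] with j hj
    have hInt : ∀ (ν : Measure (Rn n)) (_ : IsFiniteMeasure ν),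
        Integrable (fun x => φ x * mollify n j ν (fun _ => 1) x) := fun ν hν =>
      (hφ.mul (hcd ν hν j).continuous).integrable_of_hasCompactSupport hc.mul_right
    rw [← integral_sub (hInt P hPf) (hInt N hNf)]
    refine integral_congr_ae (Eventually.of_forall fun x => ?_)
    by_cases hx : x ∈ tsupport φ
    · have := mem_ball_zero_iff.1 (hR hx)
      simp only [f]
      rw [largeBump_eq_one (by linarith)]
      ring
    · simp [image_eq_zero_of_notMem_tsupport hx]
  · have htend : Tendsto (fun j : ℕ => μ.totalVariation (closedBall z (r + 1 / ((j : ℝ) + 1))))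
        atTop (𝓝 (μ.totalVariation (closedBall z r))) := by
      have hfin : IsFiniteMeasure μ.totalVariation := by rw [htv]; infer_instance
      have := tendsto_measure_iInter_atTop (μ := μ.totalVariation)
        (s := fun j : ℕ => closedBall z (r + 1 / ((j : ℝ) + 1)))
        (fun j => measurableSet_closedBall.nullMeasurableSet)
        (fun i j hij => closedBall_subset_closedBall (by gcongr))
        ⟨0, measure_ne_top _ _⟩
      have hI : ⋂ j : ℕ, closedBall z (r + 1 / ((j : ℝ) + 1)) = closedBall z r := by
        ext x
        simp only [mem_iInter, mem_closedBall]
        refine ⟨fun h => ?_, fun h j => h.trans (le_add_of_nonneg_right (by positivity))⟩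
        have hr : Tendsto (fun j : ℕ => r + 1 / ((j : ℝ) + 1)) atTop (𝓝 (r + 0)) :=
          tendsto_const_nhds.add tendsto_one_div_add_atTop_nhds_zero_nat
        rw [add_zero] at hr
        exact ge_of_tendsto' hr h
      rwa [hI] at this
    rw [← htend.limsup_eq]
    refine limsup_le_limsup (Eventually.of_forall fun j => ?_)
    refine hbound j _ _ measurableSet_ball measurableSet_closedBall fun x hx y hxy => ?_
    rw [mem_ball] at hx
    rw [mem_closedBall]
    calc dist y z ≤ dist y x + dist x z := dist_triangle _ _ _
      _ ≤ 1 / ((j : ℝ) + 1) + r := by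
        rw [dist_comm, dist_eq_norm]
        exact add_le_add hxy.le hx.le
      _ = _ := add_comm _ _

lemma exists_nat_setLIntegral_sub_le {X : Type*} [MeasurableSpace X] {m : Measure X}
    {B : Set X} {E : X → ℝ≥0∞} (hE : Measurable E) (hfin : ∫⁻ x in B, E x ∂m ≠ ⊤) {ε : ℝ≥0∞}
    (hε : 0 < ε) : ∃ M : ℕ, ∫⁻ x in B, (E x - (M : ℝ≥0∞)) ∂m ≤ ε := by
  have h : Tendsto (fun M : ℕ => ∫⁻ x in B, (E x - (M : ℝ≥0∞)) ∂m) atTop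
      (𝓝 (∫⁻ x in B, 0 ∂m)) := by
    refine tendsto_lintegral_of_dominated_convergence E (fun M => hE.sub_const _)
      (fun M => Eventually.of_forall fun x => tsub_le_self) hfin ?_
    filter_upwards [ae_lt_top hE hfin] with x hx
    refine tendsto_const_nhds.congr' ?_
    obtain ⟨N, hN⟩ := ENNReal.exists_nat_gt hx.ne
    filter_upwards [eventually_ge_atTop N] with M hM
    rw [eq_comm, tsub_eq_zero_iff_le]
    exact hN.le.trans (by exact_mod_cast hM)
  rw [lintegral_zero] at h
  exact (h.eventually_le_const hε).exists

/-- A mollified family dominated by translates of one integrable function and converging to zero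
almost everywhere converges to zero in `L¹`. -/
lemma tendsto_setLIntegral_zero_of_mollify {n : ℕ} {X : Type*} [AddCommGroup X]
    [MeasurableSpace X] [MeasurableAdd₂ X] [MeasurableNeg X] {m : Measure X} [SFinite m]
    [m.IsAddRightInvariant] {v : Rn n → X} (hv : Measurable v) {B B' : Set X}
    (hB : MeasurableSet B) (hB' : MeasurableSet B') (hBB : B ⊆ B')
    (hBv : ∀ x ∈ B, ∀ t : Rn n, ‖t‖ < 1 → x - v t ∈ B') (hmB : m B ≠ ⊤)
    {E : X → ℝ≥0∞} (hE : Measurable E) (hfin : ∫⁻ x in B', E x ∂m ≠ ⊤)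
    {F : ℕ → X → ℝ≥0∞} (hF : ∀ k, AEMeasurable (F k) (m.restrict B)) {C : ℝ≥0∞} (hC : C ≠ ⊤)
    (hle : ∀ k, ∀ᵐ x ∂m.restrict B, F k x ≤
      C * ((∫⁻ t, E (x - v t) * ENNReal.ofReal (mollifier n k t)) + E x))
    (h0 : ∀ᵐ x ∂m.restrict B, Tendsto (fun k => F k x) atTop (𝓝 0)) :
    Tendsto (fun k => ∫⁻ x in B, F k x ∂m) atTop (𝓝 0) := by
  refine tendsto_lintegral_zero_of_small_remainder hF h0 fun ε hε => ?_
  obtain ⟨δ, hδ, hδC⟩ : ∃ δ : ℝ≥0∞, 0 < δ ∧ C * (δ + δ) ≤ ε := by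
    refine ⟨ε / (2 * (C + 1)), ENNReal.div_pos hε.ne' (by finiteness), ?_⟩
    rw [← two_mul, ← mul_assoc, mul_comm C 2]
    calc 2 * C * (ε / (2 * (C + 1))) ≤ 2 * (C + 1) * (ε / (2 * (C + 1))) := by
          gcongr; exact le_self_add
      _ ≤ ε := ENNReal.mul_div_le
  obtain ⟨M, hM⟩ := exists_nat_setLIntegral_sub_le hE hfin hδ
  have hrm : Measurable (fun x => E x - (M : ℝ≥0∞)) := hE.sub_const _
  have hmoll : ∀ k, Measurable (fun t => ENNReal.ofReal (mollifier n k t)) := fun k =>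
    (continuous_mollifier n k).measurable.ennreal_ofReal
  have hjoint : ∀ k, Measurable (fun z : X × Rn n =>
      (E (z.1 - v z.2) - (M : ℝ≥0∞)) * ENNReal.ofReal (mollifier n k z.2)) := by
    intro k
    refine (hrm.comp ?_).mul ((hmoll k).comp measurable_snd)
    simp_rw [sub_eq_add_neg]
    exact measurable_fst.add (hv.comp measurable_snd).neg
  refine ⟨fun _ => C * (M + M), fun k x =>
    C * ((∫⁻ t, (E (x - v t) - (M : ℝ≥0∞)) * ENNReal.ofReal (mollifier n k t))
      + (E x - (M : ℝ≥0∞))), ?_, fun k => ?_, fun k => ?_, Eventually.of_forall fun k => ?_⟩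
  · rw [setLIntegral_const]
    finiteness
  · exact (((hjoint k).lintegral_prod_right').add hrm).const_mul C |>.aemeasurable
  · filter_upwards [hle k] with x hx
    refine hx.trans ?_
    beta_reduce
    rw [← mul_add]
    refine mul_le_mul_right ?_ C
    have h1 : ∫⁻ t, E (x - v t) * ENNReal.ofReal (mollifier n k t) ≤
        M + ∫⁻ t, (E (x - v t) - (M : ℝ≥0∞)) * ENNReal.ofReal (mollifier n k t) := by
      calc ∫⁻ t, E (x - v t) * ENNReal.ofReal (mollifier n k t)
          ≤ ∫⁻ t, (M * ENNReal.ofReal (mollifier n k t) +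
              (E (x - v t) - (M : ℝ≥0∞)) * ENNReal.ofReal (mollifier n k t)) := by
            refine lintegral_mono fun t => ?_
            rw [← add_mul]
            gcongr
            exact le_add_tsub
        _ = _ := by
            rw [lintegral_add_left ((hmoll k).const_mul _), lintegral_const_mul _ (hmoll k),
              lintegral_mollifier, mul_one]
    calc (∫⁻ t, E (x - v t) * ENNReal.ofReal (mollifier n k t)) + E x
        ≤ (M + ∫⁻ t, (E (x - v t) - (M : ℝ≥0∞)) * ENNReal.ofReal (mollifier n k t)) +
          (M + (E x - (M : ℝ≥0∞))) := add_le_add h1 le_add_tsub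
      _ = _ := by ring
  · have hadd : Measurable (fun x =>
        (∫⁻ t, (E (x - v t) - (M : ℝ≥0∞)) * ENNReal.ofReal (mollifier n k t))
          + (E x - (M : ℝ≥0∞))) := ((hjoint k).lintegral_prod_right').add hrm
    beta_reduce
    rw [lintegral_const_mul _ hadd, lintegral_add_right _ hrm]
    refine le_trans ?_ hδC
    gcongr
    · rw [lintegral_lintegral_swap (hjoint k).aemeasurable]
      calc ∫⁻ t, (∫⁻ x in B, (E (x - v t) - (M : ℝ≥0∞)) *
              ENNReal.ofReal (mollifier n k t) ∂m)
          ≤ ∫⁻ t, δ * ENNReal.ofReal (mollifier n k t) := by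
            refine lintegral_mono fun t => ?_
            by_cases ht : ‖t‖ < 1
            · rw [lintegral_mul_const' _ _ ENNReal.ofReal_ne_top]
              gcongr
              refine le_trans ?_ hM
              rw [← lintegral_indicator hB, ← lintegral_indicator hB',
                ← lintegral_sub_right_eq_self (μ := m)
                  (B'.indicator fun x => E x - (M : ℝ≥0∞)) (v t)]
              refine lintegral_mono fun x => ?_
              by_cases hx : x ∈ B
              · rw [indicator_of_mem hx, indicator_of_mem (hBv x hx t ht)]
              · rw [indicator_of_notMem hx]
                exact zero_le
            · have : mollifier n k t = 0 := by
                refine mollifier_eq_zero (le_trans ?_ (not_lt.1 ht))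
                rw [div_le_one (by positivity)]
                linarith [(Nat.cast_nonneg k : (0 : ℝ) ≤ k)]
              simp [this]
        _ = δ := by rw [lintegral_const_mul _ (hmoll k), lintegral_mollifier, mul_one]
    · exact (lintegral_mono_set hBB).trans hM

/-- Jensen's inequality for averages with respect to the mollifier. -/
lemma ofReal_abs_integral_mul_mollifier_rpow_le {n : ℕ} (k : ℕ) {p : ℝ} (hp : 1 ≤ p)
    {f : Rn n → ℝ} (hf : AEStronglyMeasurable f volume) :
    ENNReal.ofReal (|∫ t, f t * mollifier n k t| ^ p) ≤
      ∫⁻ t, ENNReal.ofReal (|f t| ^ p) * ENNReal.ofReal (mollifier n k t) := by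
  have hmm : Measurable (fun t => ENNReal.ofReal (mollifier n k t)) :=
    (continuous_mollifier n k).measurable.ennreal_ofReal
  set P : Measure (Rn n) := volume.withDensity (fun t => ENNReal.ofReal (mollifier n k t)) with hP
  have hprob : IsProbabilityMeasure P := by
    refine ⟨?_⟩
    rw [hP, withDensity_apply _ MeasurableSet.univ, Measure.restrict_univ, lintegral_mollifier]
  have hfP : AEStronglyMeasurable f P := hf.mono_ac (withDensity_absolutelyContinuous _ _)
  have h1 : ‖∫ t, f t * mollifier n k t‖ₑ ≤ ∫⁻ t, ‖f t‖ₑ ∂P := by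
    refine (enorm_integral_le_lintegral_enorm _).trans (le_of_eq ?_)
    rw [hP, lintegral_withDensity_eq_lintegral_mul₀ hmm.aemeasurable hf.enorm]
    refine lintegral_congr fun t => ?_
    rw [enorm_mul, Pi.mul_apply, mul_comm, ← ofReal_norm (mollifier n k t),
      Real.norm_of_nonneg (mollifier_nonneg n k t)]
  have h2 : (∫⁻ t, ‖f t‖ₑ ∂P) ≤ (∫⁻ t, ‖f t‖ₑ ^ p ∂P) ^ (1 / p) := by
    have := eLpNorm'_le_eLpNorm'_of_exponent_le (μ := P) (p := 1) (q := p) zero_lt_one hp hfP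
    simpa [eLpNorm'] using this
  have hp0 : 0 < p := by linarith
  have h3 : ‖∫ t, f t * mollifier n k t‖ₑ ^ p ≤ ∫⁻ t, ‖f t‖ₑ ^ p ∂P := by
    calc _ ≤ ((∫⁻ t, ‖f t‖ₑ ^ p ∂P) ^ (1 / p)) ^ p := by
          exact ENNReal.rpow_le_rpow (h1.trans h2) hp0.le
      _ = _ := by rw [← ENNReal.rpow_mul, one_div_mul_cancel hp0.ne', ENNReal.rpow_one]
  have he : ∀ a : ℝ, ENNReal.ofReal (|a| ^ p) = ‖a‖ₑ ^ p := fun a => by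
    rw [← ENNReal.ofReal_rpow_of_nonneg (abs_nonneg a) hp0.le, ← Real.norm_eq_abs, ofReal_norm]
  rw [he]
  refine h3.trans (le_of_eq ?_)
  rw [hP, lintegral_withDensity_eq_lintegral_mul₀ hmm.aemeasurable (hf.enorm.pow_const p)]
  refine lintegral_congr fun t => ?_
  rw [Pi.mul_apply, mul_comm, he]

lemma mollify_volume_eq {n : ℕ} (k : ℕ) (g : Rn n → ℝ) (x : Rn n) :
    mollify n k volume g x = ∫ t, g (x - t) * mollifier n k t := by
  rw [mollify, ← integral_sub_left_eq_self (fun y => g y * mollifier n k (x - y)) volume x]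
  simp

lemma integrable_mul_mollifier {n : ℕ} (k : ℕ) {g : Rn n → ℝ}
    (hg : LocallyIntegrable g volume) (x : Rn n) :
    Integrable (fun t => g (x - t) * mollifier n k t) := by
  have h : ConvolutionExists g (mollifier n k) (ContinuousLinearMap.mul ℝ ℝ) volume :=
    HasCompactSupport.convolutionExists_right _ (smallBump n k).hasCompactSupport_normed hg
      (continuous_mollifier n k)
  have h1 : Integrable (fun t => g t * mollifier n k (x - t)) := h x
  have h2 := h1.comp_sub_left x
  simpa using h2

lemma ae_tendsto_mollify {n : ℕ} {g : Rn n → ℝ} (hg : LocallyIntegrable g volume) :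
    ∀ᵐ x, Tendsto (fun k => mollify n k volume g x) atTop (𝓝 (g x)) := by
  have hr : ∀ᶠ k in (atTop : Filter ℕ), (smallBump n k).rOut ≤ 2 * (smallBump n k).rIn := by
    refine Eventually.of_forall fun k => le_of_eq ?_
    simp only [smallBump]
    field_simp
  filter_upwards [ContDiffBump.ae_convolution_tendsto_right_of_locallyIntegrable
    (tendsto_smallBump_rOut n) hr hg] with x hx
  refine hx.congr fun k => ?_
  rw [mollify_volume_eq]
  refine integral_congr_ae (Eventually.of_forall fun t => ?_)
  simp only [mollifier, ContinuousLinearMap.lsmul_apply, smul_eq_mul, mul_comm]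

lemma locallyIntegrable_of_lintegral_rpow {n : ℕ} {p : ℝ} (hp : 1 ≤ p) {g : Rn n → ℝ}
    (hg : AEMeasurable g) (hfin : ∀ R : ℝ, ∫⁻ x in ball (0 : Rn n) R, ENNReal.ofReal (|g x| ^ p) < ⊤) :
    LocallyIntegrable g volume := by
  intro x
  refine ⟨ball 0 (‖x‖ + 1), isOpen_ball.mem_nhds (by simp), ?_⟩
  refine ⟨hg.restrict.aestronglyMeasurable, ?_⟩
  rw [hasFiniteIntegral_iff_norm]
  have h1 : ∀ y, ENNReal.ofReal ‖g y‖ ≤ 1 + ENNReal.ofReal (|g y| ^ p) := fun y => by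
    rw [← ENNReal.ofReal_one, ← ENNReal.ofReal_add zero_le_one (by positivity)]
    refine ENNReal.ofReal_le_ofReal ?_
    simpa using rpow_le_one_add_rpow zero_le_one hp (abs_nonneg (g y))
  refine (lintegral_mono h1).trans_lt ?_
  rw [lintegral_add_left measurable_const, setLIntegral_const, one_mul]
  exact ENNReal.add_lt_top.2 ⟨measure_ball_lt_top, hfin _⟩

section Mollification

variable {n : ℕ} {s p : ℝ} {g : Rn n → ℝ}

lemma tendsto_lintegral_mollify_sub (hp : 1 ≤ p) (hg : Measurable g)
    (hfin : ∀ R : ℝ, ∫⁻ x in ball (0 : Rn n) R, ENNReal.ofReal (|g x| ^ p) < ⊤) (R : ℝ) :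
    Tendsto (fun k => ∫⁻ x in ball (0 : Rn n) R,
      ENNReal.ofReal (|mollify n k volume g x - g x| ^ p)) atTop (𝓝 0) := by
  have hp0 : 0 < p := by linarith
  have hloc := locallyIntegrable_of_lintegral_rpow hp hg.aemeasurable hfin
  have hmeas : ∀ k, Measurable (mollify n k volume g) := fun k =>
    (contDiff_mollify k hloc).continuous.measurable
  refine tendsto_setLIntegral_zero_of_mollify (v := id) (B' := ball 0 (R + 1))
    (E := fun x => ENNReal.ofReal (|g x| ^ p)) (C := ENNReal.ofReal (2 ^ p)) measurable_id
    measurableSet_ball measurableSet_ball (ball_subset_ball (by linarith)) ?_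
    measure_ball_lt_top.ne (by fun_prop) (hfin _).ne (fun k => ?_) ENNReal.ofReal_ne_top
    (fun k => Eventually.of_forall fun x => ?_) ?_
  · intro x hx t ht
    rw [mem_ball_zero_iff] at hx ⊢
    exact (norm_sub_le _ _).trans_lt (add_lt_add hx ht)
  · exact aemeasurable_ofReal_abs_rpow ((hmeas k).sub hg).aemeasurable p
  · calc ENNReal.ofReal (|mollify n k volume g x - g x| ^ p)
        ≤ ENNReal.ofReal (2 ^ p) * (ENNReal.ofReal (|mollify n k volume g x| ^ p) +
          ENNReal.ofReal (|g x| ^ p)) := by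
          rw [← ENNReal.ofReal_add (by positivity) (by positivity),
            ← ENNReal.ofReal_mul (by positivity)]
          exact ENNReal.ofReal_le_ofReal (abs_sub_rpow_le hp0.le _ _)
      _ ≤ _ := by
          gcongr
          rw [mollify_volume_eq]
          exact ofReal_abs_integral_mul_mollifier_rpow_le k hp
            (hg.comp (measurable_const.sub measurable_id)).aestronglyMeasurable
  · filter_upwards [ae_restrict_of_ae (ae_tendsto_mollify hloc)] with x hx
    have h1 : Tendsto (fun k => |mollify n k volume g x - g x| ^ p) atTop (𝓝 (|g x - g x| ^ p)) :=
      ((hx.sub_const _).abs).rpow_const (Or.inr hp0.le)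
    rw [sub_self, abs_zero, Real.zero_rpow hp0.ne'] at h1
    simpa using ENNReal.tendsto_ofReal h1

lemma tendsto_lintegral_diffQuot_mollify_sub (hp : 1 ≤ p) (hg : Measurable g)
    (hfin : ∀ R : ℝ, ∫⁻ x in ball (0 : Rn n) R, ENNReal.ofReal (|g x| ^ p) < ⊤)
    (hfin2 : ∀ R : ℝ, ∫⁻ z in ball (0 : Rn n) R ×ˢ ball (0 : Rn n) R,
      ENNReal.ofReal (diffQuot n s p g z) < ⊤) (R : ℝ) :
    Tendsto (fun k => ∫⁻ z in ball (0 : Rn n) R ×ˢ ball (0 : Rn n) R,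
      ENNReal.ofReal (diffQuot n s p (fun x => mollify n k volume g x - g x) z)) atTop (𝓝 0) := by
  have hp0 : 0 < p := by linarith
  have hloc := locallyIntegrable_of_lintegral_rpow hp hg.aemeasurable hfin
  have hmeas : ∀ k, Measurable (mollify n k volume g) := fun k =>
    (contDiff_mollify k hloc).continuous.measurable
  have hE : Measurable (fun z => ENNReal.ofReal (diffQuot n s p g z)) := by
    unfold diffQuot
    fun_prop
  have hinv : (volume : Measure (Rn n × Rn n)).IsAddRightInvariant := by
    rw [Measure.volume_eq_prod]
    infer_instance
  refine tendsto_setLIntegral_zero_of_mollify (v := fun t => (t, t))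
    (B' := ball 0 (R + 1) ×ˢ ball 0 (R + 1))
    (E := fun z => ENNReal.ofReal (diffQuot n s p g z)) (C := ENNReal.ofReal (2 ^ p))
    (measurable_id.prodMk measurable_id)
    (measurableSet_ball.prod measurableSet_ball) (measurableSet_ball.prod measurableSet_ball)
    (prod_mono (ball_subset_ball (by linarith)) (ball_subset_ball (by linarith))) ?_
    ?_ hE (hfin2 _).ne (fun k => ?_) ENNReal.ofReal_ne_top
    (fun k => Eventually.of_forall fun z => ?_) ?_
  · intro x hx t ht
    have h1 := mem_ball_zero_iff.1 hx.1
    have h2 := mem_ball_zero_iff.1 hx.2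
    exact ⟨mem_ball_zero_iff.2 ((norm_sub_le _ _).trans_lt (add_lt_add h1 ht)),
      mem_ball_zero_iff.2 ((norm_sub_le _ _).trans_lt (add_lt_add h2 ht))⟩
  · rw [Measure.volume_eq_prod, Measure.prod_prod]
    exact ENNReal.mul_ne_top measure_ball_lt_top.ne measure_ball_lt_top.ne
  · exact (aemeasurable_ofReal_diffQuot ((hmeas k).sub hg).aemeasurable).restrict
  · calc ENNReal.ofReal (diffQuot n s p (fun x => mollify n k volume g x - g x) z)
        ≤ ENNReal.ofReal (2 ^ p) * (ENNReal.ofReal (diffQuot n s p (mollify n k volume g) z) +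
          ENNReal.ofReal (diffQuot n s p g z)) := by
          rw [← ENNReal.ofReal_add (diffQuot_nonneg _ _) (diffQuot_nonneg _ _),
            ← ENNReal.ofReal_mul (by positivity)]
          exact ENNReal.ofReal_le_ofReal (diffQuot_sub_le hp0.le _ _ _)
      _ ≤ _ := by
          gcongr
          have hd : mollify n k volume g z.1 - mollify n k volume g z.2 =
              ∫ t, (g (z.1 - t) - g (z.2 - t)) * mollifier n k t := by
            rw [mollify_volume_eq, mollify_volume_eq,
              ← integral_sub (integrable_mul_mollifier k hloc _) (integrable_mul_mollifier k hloc _)]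
            simp_rw [sub_mul]
          have hm1 : Measurable (fun t => g (z.1 - t) - g (z.2 - t)) :=
            (hg.comp (measurable_const.sub measurable_id)).sub
              (hg.comp (measurable_const.sub measurable_id))
          have h1 := ofReal_abs_integral_mul_mollifier_rpow_le k hp hm1.aestronglyMeasurable
          rw [← hd] at h1
          unfold diffQuot
          simp only [Prod.fst_sub, Prod.snd_sub, sub_sub_sub_cancel_right]
          simp_rw [div_eq_mul_inv,
            ENNReal.ofReal_mul (Real.rpow_nonneg (abs_nonneg _) p)]
          refine (mul_le_mul_left h1 _).trans (le_of_eq ?_)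
          rw [← lintegral_mul_const' _ _ ENNReal.ofReal_ne_top]
          refine lintegral_congr fun t => ?_
          ring
  · filter_upwards [ae_restrict_of_ae (ae_comp_fst (ae_tendsto_mollify hloc)),
      ae_restrict_of_ae (ae_comp_snd (ae_tendsto_mollify hloc))] with z hz1 hz2
    have h1 : Tendsto (fun k => diffQuot n s p (fun x => mollify n k volume g x - g x) z) atTop
        (𝓝 (|(g z.1 - g z.1) - (g z.2 - g z.2)| ^ p / ‖z.1 - z.2‖ ^ ((n : ℝ) + s * p))) :=
      ((((hz1.sub_const _).sub (hz2.sub_const _)).abs).rpow_const (Or.inr hp0.le)).div_const _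
    simp only [sub_self, abs_zero, Real.zero_rpow hp0.ne', zero_div] at h1
    simpa using ENNReal.tendsto_ofReal h1

end Mollification

lemma exists_rpow_le_add_rpow {p q ε : ℝ} (hq : 0 < q) (hqp : q < p) (hε : 0 < ε) :
    ∃ C : ℝ, 0 < C ∧ ∀ t : ℝ, 0 ≤ t → t ^ q ≤ ε + C * t ^ p := by
  set δ := ε ^ (1 / q) with hδ
  have hδ0 : 0 < δ := by positivity
  have hpq : 0 < p - q := by linarith
  refine ⟨1 / δ ^ (p - q), by positivity, fun t ht => ?_⟩
  rcases le_total t δ with h | h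
  · calc t ^ q ≤ δ ^ q := Real.rpow_le_rpow ht h hq.le
      _ = ε := by rw [hδ, ← Real.rpow_mul hε.le, one_div_mul_cancel hq.ne', Real.rpow_one]
      _ ≤ _ := le_add_of_nonneg_right (by positivity)
  · have ht0 : 0 < t := hδ0.trans_le h
    calc t ^ q = t ^ p / t ^ (p - q) := by rw [← Real.rpow_sub ht0, sub_sub_cancel]
      _ ≤ t ^ p / δ ^ (p - q) := by gcongr
      _ = 1 / δ ^ (p - q) * t ^ p := by ring
      _ ≤ _ := le_add_of_nonneg_left hε.le

lemma tendsto_lintegral_rpow_zero_of_lt {α : Type*} [MeasurableSpace α] {ν : Measure α}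
    [IsFiniteMeasure ν] {p q : ℝ} (hq : 0 < q) (hqp : q < p) {f : ℕ → α → ℝ}
    (h : Tendsto (fun k => ∫⁻ x, ENNReal.ofReal (|f k x| ^ p) ∂ν) atTop (𝓝 0)) :
    Tendsto (fun k => ∫⁻ x, ENNReal.ofReal (|f k x| ^ q) ∂ν) atTop (𝓝 0) := by
  rw [ENNReal.tendsto_nhds_zero]
  intro ε hε
  obtain ⟨δ, hδ0, hδ⟩ : ∃ δ : ℝ, 0 < δ ∧ ENNReal.ofReal δ * ν univ ≤ ε / 2 := by
    obtain ⟨δ, h1, h2⟩ := ENNReal.exists_nnreal_pos_mul_lt (measure_ne_top ν univ)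
      (ENNReal.half_pos hε.ne').ne'
    exact ⟨δ, h1, by simpa using h2.le⟩
  obtain ⟨C, hC, hle⟩ := exists_rpow_le_add_rpow hq hqp hδ0
  have h2 : Tendsto (fun k => ENNReal.ofReal C * ∫⁻ x, ENNReal.ofReal (|f k x| ^ p) ∂ν) atTop
      (𝓝 0) := by
    simpa using ENNReal.Tendsto.const_mul h (Or.inr (ENNReal.ofReal_ne_top (r := C)))
  filter_upwards [ENNReal.tendsto_nhds_zero.1 h2 (ε / 2) (ENNReal.half_pos hε.ne')] with k hk
  calc ∫⁻ x, ENNReal.ofReal (|f k x| ^ q) ∂ν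
      ≤ ∫⁻ x, (ENNReal.ofReal δ + ENNReal.ofReal C * ENNReal.ofReal (|f k x| ^ p)) ∂ν := by
        refine lintegral_mono fun x => ?_
        rw [← ENNReal.ofReal_mul hC.le, ← ENNReal.ofReal_add hδ0.le (by positivity)]
        exact ENNReal.ofReal_le_ofReal (hle _ (abs_nonneg _))
    _ = ENNReal.ofReal δ * ν univ + ENNReal.ofReal C * ∫⁻ x, ENNReal.ofReal (|f k x| ^ p) ∂ν := by
        rw [lintegral_add_left measurable_const, lintegral_const,
          lintegral_const_mul' _ _ ENNReal.ofReal_ne_top]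
    _ ≤ ε / 2 + ε / 2 := add_le_add hδ hk
    _ = ε := ENNReal.add_halves ε

section Datum

variable {n : ℕ} {s p : ℝ} {g : Rn n → ℝ}

/-- Convergence of functions in `W^{s,p}` on balls and in the tail space. -/
structure ConvDatum (n : ℕ) (s p : ℝ) (gj : ℕ → Rn n → ℝ) (g : Rn n → ℝ) : Prop where
  ae : ∀ᵐ x, Tendsto (fun j => gj j x) atTop (𝓝 (g x))
  lp : ∀ R : ℝ, Tendsto (fun j => ∫⁻ x in ball (0 : Rn n) R,
    ENNReal.ofReal (|gj j x - g x| ^ p)) atTop (𝓝 0)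
  quot : ∀ R : ℝ, Tendsto (fun j => ∫⁻ z in ball (0 : Rn n) R ×ˢ ball (0 : Rn n) R,
    ENNReal.ofReal (diffQuot n s p (fun x => gj j x - g x) z)) atTop (𝓝 0)
  tail : Tendsto (fun j => ∫⁻ x in (ball (0 : Rn n) 1)ᶜ,
    ENNReal.ofReal (|gj j x - g x| ^ (p - 1) * (1 / ‖x‖ ^ ((n : ℝ) + s * p)))) atTop (𝓝 0)

lemma ConvDatum.congr {gj : ℕ → Rn n → ℝ} {g' : Rn n → ℝ} (h : ConvDatum n s p gj g)
    (hgg : g =ᵐ[volume] g') : ConvDatum n s p gj g' where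
  ae := by
    filter_upwards [h.ae, hgg] with x hx hx'
    rwa [← hx']
  lp R := by
    refine (h.lp R).congr fun j => lintegral_congr_ae (ae_restrict_of_ae ?_)
    filter_upwards [hgg] with x hx
    rw [hx]
  quot R := by
    refine (h.quot R).congr fun j => lintegral_congr_ae (ae_restrict_of_ae ?_)
    filter_upwards [ae_comp_fst hgg, ae_comp_snd hgg] with z hz1 hz2
    simp only [diffQuot, hz1, hz2]
  tail := by
    refine h.tail.congr fun j => lintegral_congr_ae (ae_restrict_of_ae ?_)
    filter_upwards [hgg] with x hx
    rw [hx]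

lemma ConvDatum.comp {gj : ℕ → Rn n → ℝ} (h : ConvDatum n s p gj g) {φ : ℕ → ℕ}
    (hφ : StrictMono φ) : ConvDatum n s p (fun j => gj (φ j)) g where
  ae := by
    filter_upwards [h.ae] with x hx
    exact hx.comp hφ.tendsto_atTop
  lp R := (h.lp R).comp hφ.tendsto_atTop
  quot R := (h.quot R).comp hφ.tendsto_atTop
  tail := h.tail.comp hφ.tendsto_atTop

lemma exists_smooth_approx_of_measurable (hs : 0 < s) (hp : 1 < p) (hg : Measurable g)
    (hfin : ∀ R : ℝ, ∫⁻ x in ball (0 : Rn n) R, ENNReal.ofReal (|g x| ^ p) < ⊤)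
    (hfin2 : ∀ R : ℝ, ∫⁻ z in ball (0 : Rn n) R ×ˢ ball (0 : Rn n) R,
      ENNReal.ofReal (diffQuot n s p g z) < ⊤)
    (htail : ∫⁻ x in (ball (0 : Rn n) 1)ᶜ,
      ENNReal.ofReal (|g x| ^ (p - 1) * (1 / ‖x‖ ^ ((n : ℝ) + s * p))) < ⊤) :
    ∃ gj : ℕ → Rn n → ℝ, (∀ j, ContDiff ℝ (⊤ : ℕ∞) (gj j) ∧ HasCompactSupport (gj j)) ∧
      ConvDatum n s p gj g := by
  have hloc := locallyIntegrable_of_lintegral_rpow hp.le hg.aemeasurable hfin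
  set G : ℕ → Rn n → ℝ := fun k => mollify n k volume g with hG
  have hGs : ∀ k, ContDiff ℝ (⊤ : ℕ∞) (G k) := fun k => contDiff_mollify k hloc
  have hGm : ∀ k, Measurable (G k) := fun k => (hGs k).continuous.measurable
  have h1 := tendsto_lintegral_mollify_sub hp.le hg hfin
  have h2 := tendsto_lintegral_diffQuot_mollify_sub hp.le hg hfin hfin2
  have h3 : ∀ R : ℝ, Tendsto (fun k => ∫⁻ x in ball (0 : Rn n) R,
      ENNReal.ofReal (|G k x - g x| ^ (p - 1))) atTop (𝓝 0) := fun R => by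
    have : IsFiniteMeasure (volume.restrict (ball (0 : Rn n) R)) :=
      ⟨by rw [Measure.restrict_apply_univ]; exact measure_ball_lt_top⟩
    exact tendsto_lintegral_rpow_zero_of_lt (sub_pos.2 hp) (by linarith) (h1 R)
  have hε : ∀ j : ℕ, (0 : ℝ≥0∞) < (2⁻¹ : ℝ≥0∞) ^ j := fun j =>
    ENNReal.pow_pos (by simp) j
  have hε0 : Tendsto (fun j : ℕ => (2⁻¹ : ℝ≥0∞) ^ j) atTop (𝓝 0) :=
    ENNReal.tendsto_pow_atTop_nhds_zero_of_lt_one (by simp)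
  have hex : ∀ j : ℕ, ∃ k : ℕ, j ≤ k ∧
      ∫⁻ x in ball (0 : Rn n) (j + 2), ENNReal.ofReal (|G k x - g x| ^ p) ≤ 2⁻¹ ^ j ∧
      ∫⁻ z in ball (0 : Rn n) (j + 2) ×ˢ ball (0 : Rn n) (j + 2),
        ENNReal.ofReal (diffQuot n s p (fun x => G k x - g x) z) ≤ 2⁻¹ ^ j ∧
      ∫⁻ x in ball (0 : Rn n) (j + 2), ENNReal.ofReal (|G k x - g x| ^ (p - 1)) ≤ 2⁻¹ ^ j :=
    fun j => ((eventually_ge_atTop j).and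
      (((h1 (j + 2)).eventually_le_const (hε j)).and
        (((h2 (j + 2)).eventually_le_const (hε j)).and
          ((h3 (j + 2)).eventually_le_const (hε j))))).exists
  choose k hkj hk1 hk2 hk3 using hex
  have hktop : Tendsto k atTop atTop := tendsto_atTop_mono hkj tendsto_id
  have hnear : ∀ {j : ℕ} {x : Rn n}, ‖x‖ ≤ (j : ℝ) + 1 →
      largeBump n j x * G (k j) x = G (k j) x := fun {j x} hx => by
    rw [largeBump_eq_one hx, one_mul]
  refine ⟨fun j x => largeBump n j x * G (k j) x, fun j =>
    ⟨contDiff_cutoff_mul j (hGs _), hasCompactSupport_cutoff_mul j _⟩, ?_, fun R => ?_,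
    fun R => ?_, ?_⟩
  · filter_upwards [ae_tendsto_mollify hloc] with x hx
    refine (hx.comp hktop).congr' ?_
    filter_upwards [tendsto_natCast_atTop_atTop.eventually_ge_atTop ‖x‖] with j hj
    rw [hnear (by linarith)]
    rfl
  · refine tendsto_of_tendsto_of_tendsto_of_le_of_le' tendsto_const_nhds hε0
      (Eventually.of_forall fun _ => zero_le) ?_
    filter_upwards [tendsto_natCast_atTop_atTop.eventually_ge_atTop R] with j hj
    refine le_trans ?_ (hk1 j)
    refine le_trans (le_of_eq ?_) (lintegral_mono_set (ball_subset_ball (by linarith : R ≤ j + 2)))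
    refine setLIntegral_congr_fun measurableSet_ball fun x hx => ?_
    have := mem_ball_zero_iff.1 hx
    beta_reduce
    rw [hnear (by linarith)]
  · refine tendsto_of_tendsto_of_tendsto_of_le_of_le' tendsto_const_nhds hε0
      (Eventually.of_forall fun _ => zero_le) ?_
    filter_upwards [tendsto_natCast_atTop_atTop.eventually_ge_atTop R] with j hj
    refine le_trans ?_ (hk2 j)
    have hsub := ball_subset_ball (x := (0 : Rn n)) (by linarith : R ≤ j + 2)
    refine le_trans (le_of_eq ?_) (lintegral_mono_set (prod_mono hsub hsub))
    refine setLIntegral_congr_fun (measurableSet_ball.prod measurableSet_ball) fun z hz => ?_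
    have hz1 := mem_ball_zero_iff.1 hz.1
    have hz2 := mem_ball_zero_iff.1 hz.2
    simp only [diffQuot]
    rw [hnear (by linarith), hnear (by linarith)]
  · set W : Rn n → ℝ := fun x => |g x| ^ (p - 1) * (1 / ‖x‖ ^ ((n : ℝ) + s * p)) with hW
    have hWm : Measurable (fun x => ENNReal.ofReal (W x)) := by fun_prop
    have htend : Tendsto (fun j : ℕ => ∫⁻ x in (ball (0 : Rn n) 1)ᶜ,
        (ball (0 : Rn n) ((j : ℝ) + 1))ᶜ.indicator (fun x => ENNReal.ofReal (W x)) x) atTop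
        (𝓝 (∫⁻ x in (ball (0 : Rn n) 1)ᶜ, 0)) := by
      refine tendsto_lintegral_of_dominated_convergence (fun x => ENNReal.ofReal (W x))
        (fun j => hWm.indicator measurableSet_ball.compl)
        (fun j => Eventually.of_forall fun x => indicator_le_self _ _ x) htail.ne
        (Eventually.of_forall fun x => ?_)
      refine tendsto_const_nhds.congr' ?_
      filter_upwards [tendsto_natCast_atTop_atTop.eventually_ge_atTop ‖x‖] with j hj
      rw [indicator_of_notMem]
      rw [notMem_compl_iff, mem_ball_zero_iff]
      linarith
    rw [lintegral_zero] at htend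
    have hsum := ENNReal.Tendsto.const_mul (hε0.add htend)
      (Or.inr (ENNReal.ofReal_ne_top (r := 2 ^ (p - 1))))
    rw [add_zero, mul_zero] at hsum
    refine tendsto_of_tendsto_of_tendsto_of_le_of_le tendsto_const_nhds hsum
      (fun _ => zero_le) fun j => ?_
    have hm3 : Measurable (fun x => ENNReal.ofReal (|G (k j) x - g x| ^ (p - 1))) :=
      (((hGm _).sub hg).abs.pow_const _).ennreal_ofReal
    calc ∫⁻ x in (ball (0 : Rn n) 1)ᶜ, ENNReal.ofReal
          (|largeBump n j x * G (k j) x - g x| ^ (p - 1) * (1 / ‖x‖ ^ ((n : ℝ) + s * p)))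
        ≤ ∫⁻ x in (ball (0 : Rn n) 1)ᶜ, ENNReal.ofReal (2 ^ (p - 1)) *
          ((ball (0 : Rn n) ((j : ℝ) + 2)).indicator
              (fun x => ENNReal.ofReal (|G (k j) x - g x| ^ (p - 1))) x +
            (ball (0 : Rn n) ((j : ℝ) + 1))ᶜ.indicator (fun x => ENNReal.ofReal (W x)) x) := by
          refine setLIntegral_mono' measurableSet_ball.compl fun x hx => ?_
          rw [mem_compl_iff, mem_ball_zero_iff, not_lt] at hx
          have hw : 1 / ‖x‖ ^ ((n : ℝ) + s * p) ≤ 1 := by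
            rw [div_le_one (by positivity)]
            exact Real.one_le_rpow hx (by positivity)
          have hp1 : 0 ≤ p - 1 := by linarith
          by_cases hx1 : ‖x‖ < (j : ℝ) + 1
          · rw [hnear hx1.le, indicator_of_mem (mem_ball_zero_iff.2 (by linarith))]
            calc ENNReal.ofReal (|G (k j) x - g x| ^ (p - 1) * (1 / ‖x‖ ^ ((n : ℝ) + s * p)))
                ≤ 1 * ENNReal.ofReal (|G (k j) x - g x| ^ (p - 1)) := by
                  rw [one_mul]
                  exact ENNReal.ofReal_le_ofReal (mul_le_of_le_one_right (by positivity) hw)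
              _ ≤ _ := by
                  gcongr
                  · rw [← ENNReal.ofReal_one]
                    exact ENNReal.ofReal_le_ofReal (Real.one_le_rpow one_le_two hp1)
                  · exact le_self_add
          · rw [indicator_of_mem (s := (ball (0 : Rn n) ((j : ℝ) + 1))ᶜ)
              (by rwa [mem_compl_iff, mem_ball_zero_iff])]
            have hχ0 := (largeBump n j).nonneg (x := x)
            have hχ1 := (largeBump n j).le_one (x := x)
            set χ := largeBump n j x with hχ
            have hbd : |χ * G (k j) x - g x| ^ (p - 1) ≤
                2 ^ (p - 1) * (|χ * (G (k j) x - g x)| ^ (p - 1) + |g x| ^ (p - 1)) := by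
              have h4 := abs_add_rpow_le hp1 (χ * (G (k j) x - g x)) (-((1 - χ) * g x))
              rw [show χ * (G (k j) x - g x) + -((1 - χ) * g x) = χ * G (k j) x - g x by ring,
                abs_neg] at h4
              refine h4.trans ?_
              have h5 : |(1 - χ) * g x| ≤ |g x| := by
                rw [abs_mul, abs_of_nonneg (by linarith : 0 ≤ 1 - χ)]
                exact mul_le_of_le_one_left (abs_nonneg _) (by linarith)
              have h6 := Real.rpow_le_rpow (abs_nonneg _) h5 hp1
              gcongr
            have hfirst : ENNReal.ofReal (|χ * (G (k j) x - g x)| ^ (p - 1)) ≤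
                (ball (0 : Rn n) ((j : ℝ) + 2)).indicator
                  (fun x => ENNReal.ofReal (|G (k j) x - g x| ^ (p - 1))) x := by
              by_cases hx2 : x ∈ ball (0 : Rn n) ((j : ℝ) + 2)
              · rw [indicator_of_mem hx2]
                refine ENNReal.ofReal_le_ofReal (Real.rpow_le_rpow (abs_nonneg _) ?_ hp1)
                exact abs_largeBump_mul_le n j x _
              · have hz : χ = 0 := by
                  refine (largeBump n j).zero_of_le_dist ?_
                  rw [dist_zero_right]
                  exact not_lt.1 fun h => hx2 (mem_ball_zero_iff.2 h)
                rw [hz, zero_mul, abs_zero, Real.zero_rpow (by linarith)]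
                simp
            refine le_trans ?_ (mul_le_mul_right (add_le_add_left hfirst _) _)
            rw [hW, ← ENNReal.ofReal_add (by positivity) (by positivity),
              ← ENNReal.ofReal_mul (by positivity)]
            refine ENNReal.ofReal_le_ofReal ?_
            calc |χ * G (k j) x - g x| ^ (p - 1) * (1 / ‖x‖ ^ ((n : ℝ) + s * p))
                ≤ (2 ^ (p - 1) * (|χ * (G (k j) x - g x)| ^ (p - 1) + |g x| ^ (p - 1))) *
                    (1 / ‖x‖ ^ ((n : ℝ) + s * p)) := by gcongr
              _ = 2 ^ (p - 1) * (|χ * (G (k j) x - g x)| ^ (p - 1) *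
                    (1 / ‖x‖ ^ ((n : ℝ) + s * p)) +
                    |g x| ^ (p - 1) * (1 / ‖x‖ ^ ((n : ℝ) + s * p))) := by ring
              _ ≤ _ := by
                  gcongr
                  exact mul_le_of_le_one_right (by positivity) hw
      _ = ENNReal.ofReal (2 ^ (p - 1)) *
          ((∫⁻ x in (ball (0 : Rn n) 1)ᶜ, (ball (0 : Rn n) ((j : ℝ) + 2)).indicator
              (fun x => ENNReal.ofReal (|G (k j) x - g x| ^ (p - 1))) x) +
            ∫⁻ x in (ball (0 : Rn n) 1)ᶜ,
              (ball (0 : Rn n) ((j : ℝ) + 1))ᶜ.indicator (fun x => ENNReal.ofReal (W x)) x) := by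
          rw [lintegral_const_mul' _ _ ENNReal.ofReal_ne_top,
            lintegral_add_left (hm3.indicator measurableSet_ball)]
      _ ≤ _ := by
          gcongr
          refine le_trans (setLIntegral_le_lintegral _ _) ?_
          rw [lintegral_indicator measurableSet_ball]
          exact hk3 j

end Datum

section BoundaryDatum

variable {n : ℕ} {s p : ℝ} {g : Rn n → ℝ}

lemma BoundaryDatum.aemeasurable (hg : BoundaryDatum n s p g) : AEMeasurable g := hg.2.1

lemma BoundaryDatum.lintegral_rpow (hg : BoundaryDatum n s p g) (R : ℝ) :
    ∫⁻ x in ball (0 : Rn n) R, ENNReal.ofReal (|g x| ^ p) < ⊤ := by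
  rcases lt_or_ge 0 R with hR | hR
  · exact (hg.1 0 R hR).2.1
  · simp [ball_eq_empty.2 hR]

lemma BoundaryDatum.lintegral_diffQuot (hg : BoundaryDatum n s p g) (R : ℝ) :
    ∫⁻ z in ball (0 : Rn n) R ×ˢ ball (0 : Rn n) R, ENNReal.ofReal (diffQuot n s p g z) < ⊤ := by
  rcases lt_or_ge 0 R with hR | hR
  · rw [← gagliardo_eq hg.aemeasurable]
    exact (hg.1 0 R hR).2.2
  · simp [ball_eq_empty.2 hR]

lemma BoundaryDatum.lintegral_tail (hp : 1 < p) (hg : BoundaryDatum n s p g) :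
    ∫⁻ x in (ball (0 : Rn n) 1)ᶜ,
      ENNReal.ofReal (|g x| ^ (p - 1) * (1 / ‖x‖ ^ ((n : ℝ) + s * p))) < ⊤ := by
  have hp1 : 0 < p - 1 := by linarith
  have h := hg.2.2.2 0 1 one_pos
  rw [tailFn, ENNReal.rpow_lt_top_iff_of_pos (by positivity), Real.one_rpow, ENNReal.ofReal_one,
    one_mul] at h
  simpa only [sub_zero, mul_one_div] using h

/-- Smooth compactly supported approximations of a boundary datum. -/
lemma exists_smooth_approx_datum (hs : 0 < s) (hp : 1 < p) (hg : BoundaryDatum n s p g) :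
    ∃ gj : ℕ → Rn n → ℝ, (∀ j, ContDiff ℝ (⊤ : ℕ∞) (gj j) ∧ HasCompactSupport (gj j)) ∧
      ConvDatum n s p gj g := by
  have hae := hg.aemeasurable.ae_eq_mk
  suffices h : ∃ gj : ℕ → Rn n → ℝ, (∀ j, ContDiff ℝ (⊤ : ℕ∞) (gj j) ∧
      HasCompactSupport (gj j)) ∧ ConvDatum n s p gj (hg.aemeasurable.mk g) by
    obtain ⟨gj, h1, h2⟩ := h
    exact ⟨gj, h1, h2.congr hae.symm⟩
  refine exists_smooth_approx_of_measurable hs hp hg.aemeasurable.measurable_mk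
    (fun R => ?_) (fun R => ?_) ?_
  · refine lt_of_eq_of_lt (lintegral_congr_ae (ae_restrict_of_ae ?_)) (hg.lintegral_rpow R)
    filter_upwards [hae] with x hx
    rw [hx]
  · refine lt_of_eq_of_lt (lintegral_congr_ae (ae_restrict_of_ae ?_)) (hg.lintegral_diffQuot R)
    filter_upwards [ae_comp_fst hae, ae_comp_snd hae] with z hz1 hz2
    simp only [diffQuot, hz1, hz2]
  · refine lt_of_eq_of_lt (lintegral_congr_ae (ae_restrict_of_ae ?_)) (hg.lintegral_tail hp)
    filter_upwards [hae] with x hx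
    rw [hx]

lemma tail_weight_le (hs : 0 ≤ s) (hp : 0 ≤ p) {z : Rn n} {r : ℝ} (hr : 0 < r) {v : Rn n → ℝ}
    {x : Rn n} (hx : x ∉ ball z r) :
    ENNReal.ofReal (|v x| ^ (p - 1) / ‖x - z‖ ^ ((n : ℝ) + s * p)) ≤
      ENNReal.ofReal (1 / r ^ ((n : ℝ) + s * p)) *
        (ball (0 : Rn n) (2 * (‖z‖ + 1))).indicator
          (fun x => ENNReal.ofReal (|v x| ^ (p - 1))) x +
      ENNReal.ofReal (2 ^ ((n : ℝ) + s * p)) * (ball (0 : Rn n) 1)ᶜ.indicator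
        (fun x => ENNReal.ofReal (|v x| ^ (p - 1) * (1 / ‖x‖ ^ ((n : ℝ) + s * p)))) x := by
  have hα : 0 ≤ (n : ℝ) + s * p := by positivity
  rw [mem_ball, not_lt, dist_eq_norm] at hx
  by_cases h : x ∈ ball (0 : Rn n) (2 * (‖z‖ + 1))
  · rw [indicator_of_mem h]
    refine le_trans ?_ le_self_add
    rw [← ENNReal.ofReal_mul (by positivity)]
    refine ENNReal.ofReal_le_ofReal ?_
    rw [div_eq_mul_one_div, mul_comm]
    gcongr
  · have h1 : x ∈ (ball (0 : Rn n) 1)ᶜ := fun h1 => h (ball_subset_ball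
      (by linarith [norm_nonneg z]) h1)
    rw [indicator_of_mem h1]
    refine le_trans ?_ le_add_self
    rw [← ENNReal.ofReal_mul (by positivity)]
    refine ENNReal.ofReal_le_ofReal ?_
    have h2 := one_div_norm_sub_rpow_le hα (x := z) (y := x) (R := ‖z‖ + 1)
      (by simp) h
    rw [norm_sub_rev] at h2
    rw [div_eq_mul_one_div]
    calc |v x| ^ (p - 1) * (1 / ‖x - z‖ ^ ((n : ℝ) + s * p))
        ≤ |v x| ^ (p - 1) * (2 ^ ((n : ℝ) + s * p) * (1 / ‖x‖ ^ ((n : ℝ) + s * p))) := by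
          gcongr
      _ = _ := by ring

lemma ConvDatum.lp_of_lt {q : ℝ} (hq : 0 < q) (hqp : q < p) {gj : ℕ → Rn n → ℝ}
    (h : ConvDatum n s p gj g) (R : ℝ) :
    Tendsto (fun j => ∫⁻ x in ball (0 : Rn n) R,
      ENNReal.ofReal (|gj j x - g x| ^ q)) atTop (𝓝 0) := by
  have : IsFiniteMeasure (volume.restrict (ball (0 : Rn n) R)) :=
    ⟨by rw [Measure.restrict_apply_univ]; exact measure_ball_lt_top⟩
  exact tendsto_lintegral_rpow_zero_of_lt hq hqp (h.lp R)

lemma ConvDatum.tendsto_tailFn (hs : 0 < s) (hp : 1 < p) {gj : ℕ → Rn n → ℝ}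
    (h : ConvDatum n s p gj g) (hgj : ∀ j, AEMeasurable (gj j)) (hg : AEMeasurable g)
    (z : Rn n) {r : ℝ} (hr : 0 < r) :
    Tendsto (fun j => tailFn n s p (fun x => gj j x - g x) z r) atTop (𝓝 0) := by
  have hp1 : 0 < p - 1 := by linarith
  set c₁ := ENNReal.ofReal (1 / r ^ ((n : ℝ) + s * p))
  set c₂ := ENNReal.ofReal ((2 : ℝ) ^ ((n : ℝ) + s * p))
  have hmain : Tendsto (fun j => ∫⁻ x in (ball z r)ᶜ,
      ENNReal.ofReal (|gj j x - g x| ^ (p - 1) / ‖x - z‖ ^ ((n : ℝ) + s * p))) atTop (𝓝 0) := by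
    have h1 := (ENNReal.Tendsto.const_mul (a := c₁) (h.lp_of_lt (sub_pos.2 hp) (by linarith) (2 * (‖z‖ + 1)))
      (Or.inr ENNReal.ofReal_ne_top)).add
      (ENNReal.Tendsto.const_mul (a := c₂) h.tail (Or.inr ENNReal.ofReal_ne_top))
    rw [mul_zero, mul_zero, add_zero] at h1
    refine tendsto_of_tendsto_of_tendsto_of_le_of_le tendsto_const_nhds h1
      (fun _ => zero_le) fun j => ?_
    have hm : AEMeasurable (fun x => ENNReal.ofReal (|gj j x - g x| ^ (p - 1))) :=
      aemeasurable_ofReal_abs_rpow ((hgj j).sub hg) _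
    calc _ ≤ ∫⁻ x in (ball z r)ᶜ, (c₁ *
        (ball (0 : Rn n) (2 * (‖z‖ + 1))).indicator
          (fun x => ENNReal.ofReal (|gj j x - g x| ^ (p - 1))) x +
      c₂ * (ball (0 : Rn n) 1)ᶜ.indicator
        (fun x => ENNReal.ofReal (|gj j x - g x| ^ (p - 1) *
          (1 / ‖x‖ ^ ((n : ℝ) + s * p)))) x) :=
          setLIntegral_mono' measurableSet_ball.compl fun x hx =>
            tail_weight_le (v := fun x => gj j x - g x) hs.le (by linarith) hr hx
      _ ≤ ∫⁻ x, (c₁ *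
        (ball (0 : Rn n) (2 * (‖z‖ + 1))).indicator
          (fun x => ENNReal.ofReal (|gj j x - g x| ^ (p - 1))) x +
      c₂ * (ball (0 : Rn n) 1)ᶜ.indicator
        (fun x => ENNReal.ofReal (|gj j x - g x| ^ (p - 1) *
          (1 / ‖x‖ ^ ((n : ℝ) + s * p)))) x) := setLIntegral_le_lintegral _ _
      _ = _ := by
          rw [lintegral_add_left' ((hm.indicator measurableSet_ball).const_mul _),
            lintegral_const_mul' _ _ ENNReal.ofReal_ne_top,
            lintegral_const_mul' _ _ ENNReal.ofReal_ne_top,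
            lintegral_indicator measurableSet_ball, lintegral_indicator measurableSet_ball.compl]
  have h2 := (ENNReal.Tendsto.const_mul (a := ENNReal.ofReal (r ^ (s * p))) hmain
    (Or.inr ENNReal.ofReal_ne_top)).ennrpow_const (1 / (p - 1))
  rwa [mul_zero, ENNReal.zero_rpow_of_pos (by positivity)] at h2

lemma ConvDatum.tendsto_sobolev {gj : ℕ → Rn n → ℝ}
    (h : ConvDatum n s p gj g) (hgj : ∀ j, AEMeasurable (gj j)) (hg : AEMeasurable g)
    (z : Rn n) (r : ℝ) :
    Tendsto (fun j => (∫⁻ x in ball z r, ENNReal.ofReal (|gj j x - g x| ^ p)) +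
      gagliardo n s p (ball z r) (fun x => gj j x - g x)) atTop (𝓝 0) := by
  have h1 := (h.lp (r + ‖z‖)).add (h.quot (r + ‖z‖))
  rw [add_zero] at h1
  refine tendsto_of_tendsto_of_tendsto_of_le_of_le tendsto_const_nhds h1
    (fun _ => zero_le) fun j => ?_
  have hsub : ball z r ⊆ ball (0 : Rn n) (r + ‖z‖) :=
    ball_subset_ball' (by rw [dist_zero_right])
  beta_reduce
  have hv : AEMeasurable (fun x => gj j x - g x) := (hgj j).sub hg
  rw [gagliardo_eq hv]
  exact add_le_add (lintegral_mono_set hsub) (lintegral_mono_set (prod_mono hsub hsub))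

lemma lintegral_dataTerm_le {R : ℝ} {v : Rn n → ℝ} (hv : AEMeasurable v) :
    ∫⁻ z, ENNReal.ofReal (dataTerm n s p R v z) ≤
      (∫⁻ z in ball (0 : Rn n) (2 * R) ×ˢ ball (0 : Rn n) (2 * R),
        ENNReal.ofReal (diffQuot n s p v z)) +
      2 * ((∫⁻ x in ball (0 : Rn n) R, ENNReal.ofReal (|v x| ^ (p - 1))) *
        (∫⁻ y in (ball (0 : Rn n) (2 * R))ᶜ, ENNReal.ofReal (1 / ‖y‖ ^ ((n : ℝ) + s * p))) +
        volume (ball (0 : Rn n) R) * ∫⁻ y in (ball (0 : Rn n) (2 * R))ᶜ,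
          ENNReal.ofReal (|v y| ^ (p - 1) * (1 / ‖y‖ ^ ((n : ℝ) + s * p)))) := by
  have hm1 : AEMeasurable (fun x => ENNReal.ofReal (|v x| ^ (p - 1))) :=
    aemeasurable_ofReal_abs_rpow hv _
  have hwm : Measurable (fun y : Rn n => ENNReal.ofReal (1 / ‖y‖ ^ ((n : ℝ) + s * p))) := by
    fun_prop
  have hm2 : AEMeasurable (fun y => ENNReal.ofReal (|v y| ^ (p - 1) *
      (1 / ‖y‖ ^ ((n : ℝ) + s * p)))) := by
    simp_rw [ENNReal.ofReal_mul (Real.rpow_nonneg (abs_nonneg _) (p - 1))]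
    exact hm1.mul hwm.aemeasurable
  have hfar : ∫⁻ z, ENNReal.ofReal (farTerm n s p R v z) =
      (∫⁻ x in ball (0 : Rn n) R, ENNReal.ofReal (|v x| ^ (p - 1))) *
        (∫⁻ y in (ball (0 : Rn n) (2 * R))ᶜ, ENNReal.ofReal (1 / ‖y‖ ^ ((n : ℝ) + s * p))) +
        volume (ball (0 : Rn n) R) * ∫⁻ y in (ball (0 : Rn n) (2 * R))ᶜ,
          ENNReal.ofReal (|v y| ^ (p - 1) * (1 / ‖y‖ ^ ((n : ℝ) + s * p))) := by
    have h1 : ∀ z, ENNReal.ofReal (farTerm n s p R v z) =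
        (ball (0 : Rn n) R ×ˢ (ball (0 : Rn n) (2 * R))ᶜ).indicator (fun z =>
          ENNReal.ofReal (|v z.1| ^ (p - 1)) *
            ENNReal.ofReal (1 / ‖z.2‖ ^ ((n : ℝ) + s * p)) +
          1 * ENNReal.ofReal (|v z.2| ^ (p - 1) * (1 / ‖z.2‖ ^ ((n : ℝ) + s * p)))) z := by
      intro z
      unfold farTerm
      by_cases hz : z ∈ ball (0 : Rn n) R ×ˢ (ball (0 : Rn n) (2 * R))ᶜ
      · rw [indicator_of_mem hz, indicator_of_mem hz, one_mul,
          ← ENNReal.ofReal_mul (by positivity), ← ENNReal.ofReal_add (by positivity)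
          (by positivity), add_mul]
      · rw [indicator_of_notMem hz, indicator_of_notMem hz, ENNReal.ofReal_zero]
    simp_rw [h1]
    rw [lintegral_indicator (measurableSet_ball.prod measurableSet_ball.compl),
      lintegral_add_left', lintegral_prod_mul_set hm1 hwm.aemeasurable,
      lintegral_prod_mul_set (a := fun _ => 1) aemeasurable_const hm2]
    · simp
    · have hw2 : AEMeasurable (fun z : Rn n × Rn n =>
          ENNReal.ofReal (1 / ‖z.2‖ ^ ((n : ℝ) + s * p))) := (hwm.comp measurable_snd).aemeasurable
      have hw1 : AEMeasurable (fun z : Rn n × Rn n => ENNReal.ofReal (|v z.1| ^ (p - 1))) :=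
        aemeasurable_ofReal_abs_rpow (aemeasurable_comp_fst hv) _
      exact (hw1.mul hw2).restrict
  have hswap : ∫⁻ z : Rn n × Rn n, ENNReal.ofReal (farTerm n s p R v z.swap) =
      ∫⁻ z, ENNReal.ofReal (farTerm n s p R v z) := by
    have := lintegral_prod_swap_set univ univ
      (fun z : Rn n × Rn n => ENNReal.ofReal (farTerm n s p R v z))
    rw [univ_prod_univ, Measure.restrict_univ] at this
    exact this.symm
  refine le_of_eq ?_
  calc ∫⁻ z, ENNReal.ofReal (dataTerm n s p R v z)
      = ∫⁻ z, ((ball (0 : Rn n) (2 * R) ×ˢ ball (0 : Rn n) (2 * R)).indicator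
          (fun z => ENNReal.ofReal (diffQuot n s p v z)) z +
          (ENNReal.ofReal (farTerm n s p R v z) + ENNReal.ofReal (farTerm n s p R v z.swap))) := by
        refine lintegral_congr fun z => ?_
        rw [dataTerm, ENNReal.ofReal_add (indicator_nonneg (fun z _ => diffQuot_nonneg v z) z)
          (add_nonneg (farTerm_nonneg R v z) (farTerm_nonneg R v _)),
          ENNReal.ofReal_add (farTerm_nonneg R v z) (farTerm_nonneg R v _)]
        congr 1
        by_cases hz : z ∈ ball (0 : Rn n) (2 * R) ×ˢ ball (0 : Rn n) (2 * R)
        · rw [indicator_of_mem hz, indicator_of_mem hz]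
        · rw [indicator_of_notMem hz, indicator_of_notMem hz, ENNReal.ofReal_zero]
    _ = _ := by
        rw [lintegral_add_left' ((aemeasurable_ofReal_diffQuot hv).indicator
          (measurableSet_ball.prod measurableSet_ball)),
          lintegral_indicator (measurableSet_ball.prod measurableSet_ball),
          lintegral_add_left' (aemeasurable_farTerm R hv).ennreal_ofReal, hswap, hfar, ← two_mul]

lemma dataTerm_add_le (hp : 1 ≤ p) (R : ℝ) (u v : Rn n → ℝ) (z : Rn n × Rn n) :
    dataTerm n s p R (fun x => u x + v x) z ≤
      2 ^ p * (dataTerm n s p R u z + dataTerm n s p R v z) := by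
  have hp0 : 0 ≤ p := by linarith
  have hfar : ∀ z, farTerm n s p R (fun x => u x + v x) z ≤
      2 ^ p * (farTerm n s p R u z + farTerm n s p R v z) := by
    intro z
    unfold farTerm
    by_cases hz : z ∈ ball (0 : Rn n) R ×ˢ (ball (0 : Rn n) (2 * R))ᶜ
    · rw [indicator_of_mem hz, indicator_of_mem hz, indicator_of_mem hz, ← add_mul, ← mul_assoc]
      gcongr
      have h1 : ∀ x, |u x + v x| ^ (p - 1) ≤ 2 ^ p * (|u x| ^ (p - 1) + |v x| ^ (p - 1)) :=
        fun x => (abs_add_rpow_le (by linarith) (u x) (v x)).trans (by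
          gcongr
          · exact one_le_two
          · linarith)
      linarith [h1 z.1, h1 z.2]
    · rw [indicator_of_notMem hz, indicator_of_notMem hz, indicator_of_notMem hz]
      simp
  have hnear : (ball (0 : Rn n) (2 * R) ×ˢ ball (0 : Rn n) (2 * R)).indicator
      (diffQuot n s p (fun x => u x + v x)) z ≤
      2 ^ p * ((ball (0 : Rn n) (2 * R) ×ˢ ball (0 : Rn n) (2 * R)).indicator
        (diffQuot n s p u) z + (ball (0 : Rn n) (2 * R) ×ˢ ball (0 : Rn n) (2 * R)).indicator
        (diffQuot n s p v) z) := by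
    by_cases hz : z ∈ ball (0 : Rn n) (2 * R) ×ˢ ball (0 : Rn n) (2 * R)
    · rw [indicator_of_mem hz, indicator_of_mem hz, indicator_of_mem hz]
      exact diffQuot_add_le hp0 u v z
    · rw [indicator_of_notMem hz, indicator_of_notMem hz, indicator_of_notMem hz]
      simp
  unfold dataTerm
  linarith [hfar z, hfar z.swap, hnear]

lemma ConvDatum.exists_dataTerm_bound (hs : 0 < s) (hp : 1 < p) (hg : BoundaryDatum n s p g)
    {gj : ℕ → Rn n → ℝ} (h : ConvDatum n s p gj g) (hgj : ∀ j, AEMeasurable (gj j)) {R : ℝ}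
    (hR : 1 ≤ R) :
    ∃ C : ℝ≥0∞, C ≠ ⊤ ∧
      ∀ᶠ j in atTop, ∫⁻ z, ENNReal.ofReal (dataTerm n s p R (gj j) z) ≤ C := by
  have hgm := hg.aemeasurable
  have hw := lintegral_compl_ball_rpow_lt_top (n := n) (τ := s * p)
    (mul_pos hs (by linarith)) (by linarith : 1 ≤ 2 * R)
  have hsub : (ball (0 : Rn n) (2 * R))ᶜ ⊆ (ball (0 : Rn n) 1)ᶜ :=
    compl_subset_compl.2 (ball_subset_ball (by linarith))
  have htail : Tendsto (fun j => ∫⁻ x in (ball (0 : Rn n) (2 * R))ᶜ,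
      ENNReal.ofReal (|gj j x - g x| ^ (p - 1) * (1 / ‖x‖ ^ ((n : ℝ) + s * p)))) atTop (𝓝 0) :=
    tendsto_of_tendsto_of_tendsto_of_le_of_le tendsto_const_nhds h.tail (fun _ => zero_le)
      fun j => lintegral_mono_set hsub
  have h1 : Tendsto (fun j => (∫⁻ z in ball (0 : Rn n) (2 * R) ×ˢ ball (0 : Rn n) (2 * R),
        ENNReal.ofReal (diffQuot n s p (fun x => gj j x - g x) z)) +
      2 * ((∫⁻ x in ball (0 : Rn n) R, ENNReal.ofReal (|gj j x - g x| ^ (p - 1))) *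
        (∫⁻ y in (ball (0 : Rn n) (2 * R))ᶜ, ENNReal.ofReal (1 / ‖y‖ ^ ((n : ℝ) + s * p))) +
        volume (ball (0 : Rn n) R) * ∫⁻ y in (ball (0 : Rn n) (2 * R))ᶜ,
          ENNReal.ofReal (|gj j y - g y| ^ (p - 1) * (1 / ‖y‖ ^ ((n : ℝ) + s * p)))))
      atTop (𝓝 (0 + 2 * (0 * (∫⁻ y in (ball (0 : Rn n) (2 * R))ᶜ,
        ENNReal.ofReal (1 / ‖y‖ ^ ((n : ℝ) + s * p))) + volume (ball (0 : Rn n) R) * 0))) := by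
    refine (h.quot _).add (ENNReal.Tendsto.const_mul ?_ (Or.inr (by simp)))
    exact (ENNReal.Tendsto.mul_const (h.lp_of_lt (sub_pos.2 hp) (by linarith) R) (Or.inr hw.ne)).add
      (ENNReal.Tendsto.const_mul htail (Or.inr measure_ball_lt_top.ne))
  rw [zero_mul, mul_zero, add_zero, mul_zero, add_zero] at h1
  have hgfin : ∫⁻ z, ENNReal.ofReal (dataTerm n s p R g z) ≠ ⊤ := by
    refine ((lintegral_dataTerm_le hgm).trans_lt ?_).ne
    have ha : ∫⁻ x in ball (0 : Rn n) R, ENNReal.ofReal (|g x| ^ (p - 1)) < ⊤ := hg.2.2.1 R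
    have hb := (lintegral_mono_set hsub).trans_lt (hg.lintegral_tail hp)
    have hc := hg.lintegral_diffQuot (2 * R)
    have hd : volume (ball (0 : Rn n) R) < ⊤ := measure_ball_lt_top
    exact ENNReal.add_lt_top.2 ⟨hc, ENNReal.mul_lt_top (by simp)
      (ENNReal.add_lt_top.2 ⟨ENNReal.mul_lt_top ha hw, ENNReal.mul_lt_top hd hb⟩)⟩
  refine ⟨ENNReal.ofReal (2 ^ p) * ((∫⁻ z, ENNReal.ofReal (dataTerm n s p R g z)) + 1),
    by finiteness, ?_⟩
  filter_upwards [h1.eventually_le_const zero_lt_one] with j hj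
  calc ∫⁻ z, ENNReal.ofReal (dataTerm n s p R (gj j) z)
      ≤ ∫⁻ z, ENNReal.ofReal (2 ^ p) * (ENNReal.ofReal (dataTerm n s p R g z) +
          ENNReal.ofReal (dataTerm n s p R (fun x => gj j x - g x) z)) := by
        refine lintegral_mono fun z => ?_
        rw [← ENNReal.ofReal_add (dataTerm_nonneg _ _ _) (dataTerm_nonneg _ _ _),
          ← ENNReal.ofReal_mul (by positivity)]
        refine ENNReal.ofReal_le_ofReal ?_
        have := dataTerm_add_le (s := s) hp.le R g (fun x => gj j x - g x) z
        simpa only [add_sub_cancel] using this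
    _ = ENNReal.ofReal (2 ^ p) * ((∫⁻ z, ENNReal.ofReal (dataTerm n s p R g z)) +
          ∫⁻ z, ENNReal.ofReal (dataTerm n s p R (fun x => gj j x - g x) z)) := by
        rw [lintegral_const_mul' _ _ ENNReal.ofReal_ne_top,
          lintegral_add_left' (aemeasurable_dataTerm R hgm).ennreal_ofReal]
    _ ≤ _ := by
        gcongr
        exact (lintegral_dataTerm_le ((hgj j).sub hgm)).trans hj

lemma ConvDatum.exists_lp_bound (hp : 0 ≤ p) (hg : BoundaryDatum n s p g)
    {gj : ℕ → Rn n → ℝ} (h : ConvDatum n s p gj g) (R : ℝ) :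
    ∃ C : ℝ≥0∞, C ≠ ⊤ ∧
      ∀ᶠ j in atTop, ∫⁻ x in ball (0 : Rn n) R, ENNReal.ofReal (|gj j x| ^ p) ≤ C := by
  have hgm := hg.aemeasurable
  have hfin := (hg.lintegral_rpow R).ne
  refine ⟨ENNReal.ofReal (2 ^ p) * ((∫⁻ x in ball (0 : Rn n) R, ENNReal.ofReal (|g x| ^ p)) + 1),
    by finiteness, ?_⟩
  filter_upwards [(h.lp R).eventually_le_const zero_lt_one] with j hj
  calc ∫⁻ x in ball (0 : Rn n) R, ENNReal.ofReal (|gj j x| ^ p)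
      ≤ ∫⁻ x in ball (0 : Rn n) R, ENNReal.ofReal (2 ^ p) * (ENNReal.ofReal (|g x| ^ p) +
          ENNReal.ofReal (|gj j x - g x| ^ p)) := by
        refine lintegral_mono fun x => ?_
        rw [← ENNReal.ofReal_add (by positivity) (by positivity),
          ← ENNReal.ofReal_mul (by positivity)]
        refine ENNReal.ofReal_le_ofReal ?_
        have := abs_add_rpow_le hp (g x) (gj j x - g x)
        rwa [add_sub_cancel] at this
    _ = ENNReal.ofReal (2 ^ p) * ((∫⁻ x in ball (0 : Rn n) R, ENNReal.ofReal (|g x| ^ p)) +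
          ∫⁻ x in ball (0 : Rn n) R, ENNReal.ofReal (|gj j x - g x| ^ p)) := by
        rw [lintegral_const_mul' _ _ ENNReal.ofReal_ne_top,
          lintegral_add_left' (aemeasurable_ofReal_abs_rpow hgm.restrict p)]
    _ ≤ _ := by gcongr

end BoundaryDatum

section EquiInt

variable {α : Type*} [MeasurableSpace α] {ν : Measure α}

/-- Up to a remainder that is eventually small in `L¹`, the sequence is dominated by an integrable
function. -/
def EquiInt (F : ℕ → α → ℝ≥0∞) (ν : Measure α) : Prop :=
  ∀ ε : ℝ≥0∞, 0 < ε → ∃ (G : α → ℝ≥0∞) (S : ℕ → α → ℝ≥0∞), AEMeasurable G ν ∧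
    ∫⁻ x, G x ∂ν ≠ ⊤ ∧ (∀ k, AEMeasurable (S k) ν) ∧ (∀ k, ∀ᵐ x ∂ν, F k x ≤ G x + S k x) ∧
    ∀ᶠ k in atTop, ∫⁻ x, S k x ∂ν ≤ ε

lemma EquiInt.mono {F F' : ℕ → α → ℝ≥0∞} (h : EquiInt F ν)
    (hle : ∀ k, ∀ᵐ x ∂ν, F' k x ≤ F k x) : EquiInt F' ν := by
  intro ε hε
  obtain ⟨G, S, hGm, hG, hS, hFS, hSε⟩ := h ε hε
  refine ⟨G, S, hGm, hG, hS, fun k => ?_, hSε⟩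
  filter_upwards [hle k, hFS k] with x h1 h2 using h1.trans h2

lemma EquiInt.add {F F' : ℕ → α → ℝ≥0∞} (h : EquiInt F ν) (h' : EquiInt F' ν) :
    EquiInt (fun k x => F k x + F' k x) ν := by
  intro ε hε
  obtain ⟨G, S, hGm, hG, hS, hFS, hSε⟩ := h (ε / 2) (ENNReal.half_pos hε.ne')
  obtain ⟨G', S', hGm', hG', hS', hFS', hSε'⟩ := h' (ε / 2) (ENNReal.half_pos hε.ne')
  refine ⟨fun x => G x + G' x, fun k x => S k x + S' k x, hGm.add hGm', ?_,
    fun k => (hS k).add (hS' k), fun k => ?_, ?_⟩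
  · rw [lintegral_add_left' hGm]
    exact ENNReal.add_ne_top.2 ⟨hG, hG'⟩
  · filter_upwards [hFS k, hFS' k] with x h1 h2
    calc _ ≤ (G x + S k x) + (G' x + S' k x) := add_le_add h1 h2
      _ = _ := by ring
  · filter_upwards [hSε, hSε'] with k h1 h2
    rw [lintegral_add_left' (hS k)]
    exact (add_le_add h1 h2).trans_eq (ENNReal.add_halves ε)

lemma EquiInt.const_mul {F : ℕ → α → ℝ≥0∞} (h : EquiInt F ν) {c : ℝ≥0∞} (hc : c ≠ ⊤) :
    EquiInt (fun k x => c * F k x) ν := by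
  intro ε hε
  have hc1 : c + 1 ≠ ⊤ := by finiteness
  obtain ⟨G, S, hGm, hG, hS, hFS, hSε⟩ := h (ε / (c + 1)) (ENNReal.div_pos hε.ne' hc1)
  refine ⟨fun x => c * G x, fun k x => c * S k x, hGm.const_mul c, ?_,
    fun k => (hS k).const_mul c, fun k => ?_, ?_⟩
  · rw [lintegral_const_mul' _ _ hc]
    exact ENNReal.mul_ne_top hc hG
  · filter_upwards [hFS k] with x h1
    rw [← mul_add]
    exact mul_le_mul_right h1 c
  · filter_upwards [hSε] with k h1
    rw [lintegral_const_mul' _ _ hc]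
    calc c * ∫⁻ x, S k x ∂ν ≤ (c + 1) * (ε / (c + 1)) := mul_le_mul' le_self_add h1
      _ ≤ ε := ENNReal.mul_div_le

lemma EquiInt.of_tendsto {F : ℕ → α → ℝ≥0∞} (hF : ∀ k, AEMeasurable (F k) ν)
    (h : Tendsto (fun k => ∫⁻ x, F k x ∂ν) atTop (𝓝 0)) : EquiInt F ν := fun ε hε =>
  ⟨0, F, aemeasurable_const, by simp, hF, fun k => by simp, ENNReal.tendsto_nhds_zero.1 h ε hε⟩

lemma EquiInt.of_const {G : α → ℝ≥0∞} (hGm : AEMeasurable G ν) (hG : ∫⁻ x, G x ∂ν ≠ ⊤) :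
    EquiInt (fun _ => G) ν := fun ε hε =>
  ⟨G, fun _ => 0, hGm, hG, fun _ => aemeasurable_const, fun k => by simp, by simp⟩

lemma EquiInt.of_young {F A : ℕ → α → ℝ≥0∞} {G : α → ℝ≥0∞} {C : ℝ≥0∞} (hC : C ≠ ⊤)
    (hA : ∀ k, AEMeasurable (A k) ν) (hAC : ∀ k, ∫⁻ x, A k x ∂ν ≤ C) (hGm : AEMeasurable G ν)
    (hG : ∫⁻ x, G x ∂ν ≠ ⊤)
    (h : ∀ ε : ℝ, 0 < ε → ∃ c : ℝ, ∀ k, ∀ᵐ x ∂ν,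
      F k x ≤ ENNReal.ofReal ε * A k x + ENNReal.ofReal c * G x) : EquiInt F ν := by
  intro ε hε
  obtain ⟨δ, hδ0, hδ⟩ := ENNReal.exists_nnreal_pos_mul_lt hC hε.ne'
  obtain ⟨c, hc⟩ := h δ hδ0
  refine ⟨fun x => ENNReal.ofReal c * G x, fun k x => ENNReal.ofReal δ * A k x,
    hGm.const_mul _, ?_, fun k => (hA k).const_mul _, fun k => ?_, Eventually.of_forall fun k => ?_⟩
  · rw [lintegral_const_mul' _ _ ENNReal.ofReal_ne_top]
    exact ENNReal.mul_ne_top ENNReal.ofReal_ne_top hG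
  · filter_upwards [hc k] with x hx
    rwa [add_comm]
  · rw [lintegral_const_mul' _ _ ENNReal.ofReal_ne_top]
    refine (mul_le_mul_right (hAC k) _).trans ?_
    simpa using hδ.le

lemma EquiInt.indicator {F : ℕ → α → ℝ≥0∞} {A : Set α} (hA : MeasurableSet A)
    (h : EquiInt F (ν.restrict A)) : EquiInt (fun k => A.indicator (F k)) ν := by
  intro ε hε
  obtain ⟨G, S, hGm, hG, hS, hFS, hSε⟩ := h ε hε
  refine ⟨A.indicator G, fun k => A.indicator (S k), (aemeasurable_indicator_iff hA).2 hGm, ?_,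
    fun k => (aemeasurable_indicator_iff hA).2 (hS k), fun k => ?_, ?_⟩
  · rwa [lintegral_indicator hA]
  · filter_upwards [(ae_restrict_iff' hA).1 (hFS k)] with x hx
    by_cases hxA : x ∈ A
    · simpa only [indicator_of_mem hxA] using hx hxA
    · simp [indicator_of_notMem hxA]
  · filter_upwards [hSε] with k hk
    rwa [lintegral_indicator hA]

lemma EquiInt.comp_measurePreserving {β : Type*} [MeasurableSpace β] {ν' : Measure β}
    {F : ℕ → α → ℝ≥0∞} (h : EquiInt F ν) {e : β ≃ᵐ α} (he : MeasurePreserving e ν' ν) :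
    EquiInt (fun k x => F k (e x)) ν' := by
  intro ε hε
  obtain ⟨G, S, hGm, hG, hS, hFS, hSε⟩ := h ε hε
  refine ⟨fun x => G (e x), fun k x => S k (e x),
    hGm.comp_quasiMeasurePreserving he.quasiMeasurePreserving, ?_,
    fun k => (hS k).comp_quasiMeasurePreserving he.quasiMeasurePreserving,
    fun k => he.quasiMeasurePreserving.ae (hFS k), ?_⟩
  · rwa [he.lintegral_comp_emb e.measurableEmbedding]
  · filter_upwards [hSε] with k hk
    rwa [he.lintegral_comp_emb e.measurableEmbedding]

lemma EquiInt.tendsto_zero {F : ℕ → α → ℝ≥0∞} (h : EquiInt F ν)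
    (hF : ∀ k, AEMeasurable (F k) ν) (h0 : ∀ᵐ x ∂ν, Tendsto (fun k => F k x) atTop (𝓝 0)) :
    Tendsto (fun k => ∫⁻ x, F k x ∂ν) atTop (𝓝 0) :=
  tendsto_lintegral_zero_of_small_remainder hF h0 fun ε hε => by
    obtain ⟨G, S, -, h⟩ := h ε hε
    exact ⟨G, S, h⟩

/-- Vitali's convergence theorem for Bochner integrals. -/
lemma EquiInt.integrable_and_tendsto {F : ℕ → α → ℝ} {F₀ : α → ℝ}
    (h : EquiInt (fun k x => ENNReal.ofReal |F k x|) ν) (hF : ∀ k, Integrable (F k) ν)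
    (h0 : ∀ᵐ x ∂ν, Tendsto (fun k => F k x) atTop (𝓝 (F₀ x))) :
    Integrable F₀ ν ∧ Tendsto (fun k => ∫ x, F k x ∂ν) atTop (𝓝 (∫ x, F₀ x ∂ν)) := by
  have hm : AEStronglyMeasurable F₀ ν :=
    aestronglyMeasurable_of_tendsto_ae atTop (fun k => (hF k).aestronglyMeasurable) h0
  have hInt : Integrable F₀ ν := by
    obtain ⟨G, S, hGm, hG, hS, hFS, hSε⟩ := h 1 one_pos
    obtain ⟨N, hN⟩ := eventually_atTop.1 hSε
    have hle := lintegral_ofReal_liminf_le (ν := ν) (F := fun k x => |F (k + N) x|)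
      (G := fun x => |F₀ x|) (C := (∫⁻ x, G x ∂ν) + 1)
      (fun k => (hF _).abs.aestronglyMeasurable.aemeasurable)
      (by filter_upwards [h0] with x hx using (hx.comp (tendsto_add_atTop_nat N)).abs)
      (fun k => by
        calc _ ≤ ∫⁻ x, (G x + S (k + N) x) ∂ν := lintegral_mono_ae (hFS _)
          _ = (∫⁻ x, G x ∂ν) + ∫⁻ x, S (k + N) x ∂ν := lintegral_add_left' hGm _
          _ ≤ _ := by gcongr; exact hN _ (Nat.le_add_left N k))
    refine ⟨hm, ?_⟩
    rw [HasFiniteIntegral]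
    simp_rw [Real.enorm_eq_ofReal_abs]
    exact hle.trans_lt (by finiteness)
  refine ⟨hInt, tendsto_integral_of_L1 F₀ hm (Eventually.of_forall hF) ?_⟩
  simp_rw [Real.enorm_eq_ofReal_abs]
  have hc : EquiInt (fun (_ : ℕ) x => ENNReal.ofReal |F₀ x|) ν := by
    refine EquiInt.of_const hInt.abs.aestronglyMeasurable.aemeasurable.ennreal_ofReal ?_
    have := hInt.2
    rw [HasFiniteIntegral] at this
    simp_rw [Real.enorm_eq_ofReal_abs] at this
    exact this.ne
  refine ((h.add hc).mono (F' := fun k x => ENNReal.ofReal |F k x - F₀ x|) fun k => ?_).tendsto_zero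
    (fun k => ((hF k).sub hInt).abs.aestronglyMeasurable.aemeasurable.ennreal_ofReal) ?_
  · filter_upwards with x
    rw [← ENNReal.ofReal_add (abs_nonneg _) (abs_nonneg _)]
    exact ENNReal.ofReal_le_ofReal (abs_sub _ _)
  · filter_upwards [h0] with x hx
    have := (ENNReal.continuous_ofReal.tendsto _).comp (hx.sub_const (F₀ x)).abs
    simpa [Function.comp_def] using this

end EquiInt

/-! ### Convergence of the nonlocal form -/

section FormConvergence

variable {n : ℕ} {s p Λ : ℝ} {Φ : ℝ → ℝ} {K : Rn n → Rn n → ℝ}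

lemma equiInt_near (hn : 1 ≤ n) (hp : 1 < p) {h q : ℝ} (hσ : 0 < 1 - s * p + h * (p - 1))
    (hq : p - 1 < q) (R : ℝ) {u : ℕ → Rn n → ℝ} (hu : ∀ k, AEMeasurable (u k)) {C : ℝ≥0∞}
    (hC : C ≠ ⊤) (huC : ∀ k, ∫⁻ z in ball (0 : Rn n) R ×ˢ ball (0 : Rn n) R,
      ENNReal.ofReal (diffQuot n h q (u k) z) ≤ C) :
    EquiInt (fun k z => ENNReal.ofReal (|u k z.1 - u k z.2| ^ (p - 1) *
        ‖z.1 - z.2‖ ^ (1 - ((n : ℝ) + s * p))))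
      (volume.restrict (ball (0 : Rn n) R ×ˢ ball (0 : Rn n) R)) := by
  have hp1 : 0 < p - 1 := by linarith
  have hq0 : 0 < q := by linarith
  have hθ0 : 0 < (p - 1) / q := by positivity
  have hθ1 : (p - 1) / q < 1 := (div_lt_one hq0).2 hq
  have hθ2 : 0 < 1 - (p - 1) / q := by linarith
  set σ := (1 - s * p + h * (p - 1)) / (1 - (p - 1) / q) with hσd
  have hσ0 : 0 < σ := by positivity
  obtain ⟨C', hC', hle⟩ := exists_lintegral_ball_prod_le hn hσ0 R
  have hfin : ∫⁻ z in ball (0 : Rn n) R ×ˢ ball (0 : Rn n) R,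
      ENNReal.ofReal (‖z.1 - z.2‖ ^ (σ - n)) ≠ ⊤ := by
    have h1 := hle (fun _ => 1) aemeasurable_const
    simp only [one_mul, lintegral_const, Measure.restrict_apply_univ] at h1
    exact ne_top_of_le_ne_top (ENNReal.mul_ne_top hC' measure_ball_lt_top.ne) h1
  have hm : Measurable (fun z : Rn n × Rn n => ENNReal.ofReal (‖z.1 - z.2‖ ^ (σ - n))) := by
    fun_prop
  refine EquiInt.of_young hC (fun k => (aemeasurable_ofReal_diffQuot (hu k)).restrict) huC
    hm.aemeasurable hfin fun ε hε => ?_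
  obtain ⟨c, hc0, hc⟩ := exists_weighted_young hθ0 hθ1 hε
  refine ⟨c, fun k => ae_restrict_of_ae ?_⟩
  filter_upwards [ae_fst_ne_snd hn] with z hz
  have hd : 0 < ‖z.1 - z.2‖ := norm_pos_iff.2 (sub_ne_zero.2 hz)
  rw [← ENNReal.ofReal_mul hε.le, ← ENNReal.ofReal_mul hc0.le,
    ← ENNReal.ofReal_add (mul_nonneg hε.le (diffQuot_nonneg _ _)) (by positivity)]
  refine ENNReal.ofReal_le_ofReal (le_trans (le_of_eq ?_)
    (hc _ (‖z.1 - z.2‖ ^ (σ - n)) (diffQuot_nonneg (u k) z) (by positivity)))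
  have hσ2 : σ * (1 - (p - 1) / q) = 1 - s * p + h * (p - 1) := div_mul_cancel₀ _ hθ2.ne'
  have hθ3 : q * ((p - 1) / q) = p - 1 := mul_div_cancel₀ _ hq0.ne'
  rw [diffQuot, div_eq_mul_inv, ← Real.rpow_neg hd.le, Real.mul_rpow (by positivity)
    (by positivity), ← Real.rpow_mul (abs_nonneg _), ← Real.rpow_mul hd.le,
    ← Real.rpow_mul hd.le, mul_assoc, ← Real.rpow_add hd, hθ3]
  congr 2
  linear_combination h * hθ3 - hσ2

lemma equiInt_far (hs : 0 < s) (hp : 1 < p) {q : ℝ} (hq : p - 1 < q) {R : ℝ} (hR : 1 ≤ R)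
    {u : ℕ → Rn n → ℝ} {u₀ : Rn n → ℝ} (hu : ∀ k, AEMeasurable (u k)) (hu₀ : AEMeasurable u₀)
    {C : ℝ≥0∞} (hC : C ≠ ⊤)
    (huC : ∀ k, ∫⁻ x in ball (0 : Rn n) R, ENNReal.ofReal (|u k x| ^ q) ≤ C)
    (hfin : ∫⁻ y in (ball (0 : Rn n) (2 * R))ᶜ,
      ENNReal.ofReal (|u₀ y| ^ (p - 1) * (1 / ‖y‖ ^ ((n : ℝ) + s * p))) ≠ ⊤)
    (hlim : Tendsto (fun k => ∫⁻ y in (ball (0 : Rn n) (2 * R))ᶜ,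
      ENNReal.ofReal (|u k y - u₀ y| ^ (p - 1) * (1 / ‖y‖ ^ ((n : ℝ) + s * p)))) atTop (𝓝 0)) :
    EquiInt (fun k z => ENNReal.ofReal (farTerm n s p R (u k) z)) volume := by
  have hp1 : 0 < p - 1 := by linarith
  set A := ball (0 : Rn n) R ×ˢ (ball (0 : Rn n) (2 * R))ᶜ with hA
  have hAm : MeasurableSet A := measurableSet_ball.prod measurableSet_ball.compl
  set W : Rn n → ℝ≥0∞ := fun y => ENNReal.ofReal (1 / ‖y‖ ^ ((n : ℝ) + s * p)) with hW
  have hWm : Measurable W := by fun_prop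
  have hWfin : ∫⁻ y in (ball (0 : Rn n) (2 * R))ᶜ, W y < ⊤ :=
    lintegral_compl_ball_rpow_lt_top (mul_pos hs (by linarith)) (by linarith)
  have hTm : ∀ v : Rn n → ℝ, AEMeasurable v → AEMeasurable fun y =>
      ENNReal.ofReal (|v y| ^ (p - 1) * (1 / ‖y‖ ^ ((n : ℝ) + s * p))) := by
    intro v hv
    simp_rw [ENNReal.ofReal_mul (Real.rpow_nonneg (abs_nonneg _) (p - 1))]
    exact (aemeasurable_ofReal_abs_rpow hv _).mul hWm.aemeasurable
  have hsnd : ∀ f : Rn n → ℝ≥0∞, AEMeasurable f → AEMeasurable fun z : Rn n × Rn n => f z.2 :=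
    fun f hf => hf.comp_quasiMeasurePreserving Measure.quasiMeasurePreserving_snd
  have hInt : ∀ f : Rn n → ℝ≥0∞, AEMeasurable f →
      ∫⁻ z in A, f z.2 = volume (ball (0 : Rn n) R) *
        ∫⁻ y in (ball (0 : Rn n) (2 * R))ᶜ, f y := by
    intro f hf
    have := lintegral_prod_mul_set (a := fun _ => 1) aemeasurable_const hf (ball (0 : Rn n) R)
      (ball (0 : Rn n) (2 * R))ᶜ
    simpa using this
  have hvol : volume (ball (0 : Rn n) R) ≠ ⊤ := measure_ball_lt_top.ne
  have h1 : EquiInt (fun k (z : Rn n × Rn n) => ENNReal.ofReal (|u k z.1| ^ (p - 1)) * W z.2)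
      (volume.restrict A) := by
    have hA1 : ∀ k, AEMeasurable (fun z : Rn n × Rn n => ENNReal.ofReal (|u k z.1| ^ q)) :=
      fun k => aemeasurable_ofReal_abs_rpow (aemeasurable_comp_fst (hu k)) q
    refine EquiInt.of_young (C := C * ∫⁻ y in (ball (0 : Rn n) (2 * R))ᶜ, W y)
      (A := fun k z => ENNReal.ofReal (|u k z.1| ^ q) * W z.2) (G := fun z => W z.2)
      (ENNReal.mul_ne_top hC hWfin.ne)
      (fun k => ((hA1 k).mul (hsnd W hWm.aemeasurable)).restrict) (fun k => ?_)
      (hsnd W hWm.aemeasurable).restrict ?_ fun ε hε => ?_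
    · rw [lintegral_prod_mul_set (a := fun x => ENNReal.ofReal (|u k x| ^ q))
        (aemeasurable_ofReal_abs_rpow (hu k) q) hWm.aemeasurable]
      exact mul_le_mul_left (huC k) _
    · rw [hInt W hWm.aemeasurable]
      exact ENNReal.mul_ne_top hvol hWfin.ne
    · obtain ⟨c, hc0, hc⟩ := exists_rpow_le_eps_rpow hp1 hq hε
      refine ⟨c, fun k => Eventually.of_forall fun z => ?_⟩
      rw [← mul_assoc, ← add_mul, ← ENNReal.ofReal_mul hε.le,
        ← ENNReal.ofReal_add (by positivity) hc0.le]
      exact mul_le_mul_left (ENNReal.ofReal_le_ofReal (hc _ (abs_nonneg _))) _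
  have h2 : EquiInt (fun k (z : Rn n × Rn n) =>
      ENNReal.ofReal (|u k z.2 - u₀ z.2| ^ (p - 1) * (1 / ‖z.2‖ ^ ((n : ℝ) + s * p))))
      (volume.restrict A) := by
    have hm : ∀ k, AEMeasurable fun y =>
        ENNReal.ofReal (|u k y - u₀ y| ^ (p - 1) * (1 / ‖y‖ ^ ((n : ℝ) + s * p))) :=
      fun k => hTm _ ((hu k).sub hu₀)
    refine EquiInt.of_tendsto (fun k => (hsnd _ (hm k)).restrict) ?_
    have := ENNReal.Tendsto.const_mul hlim (Or.inr hvol)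
    rw [mul_zero] at this
    exact this.congr fun k => (hInt _ (hm k)).symm
  have h3 : EquiInt (fun (_ : ℕ) (z : Rn n × Rn n) =>
      ENNReal.ofReal (|u₀ z.2| ^ (p - 1) * (1 / ‖z.2‖ ^ ((n : ℝ) + s * p))))
      (volume.restrict A) := by
    refine EquiInt.of_const (hsnd _ (hTm _ hu₀)).restrict ?_
    rw [hInt _ (hTm _ hu₀)]
    exact ENNReal.mul_ne_top hvol hfin
  have h4 := (h1.add ((h2.add h3).const_mul (c := ENNReal.ofReal (2 ^ p))
    ENNReal.ofReal_ne_top)).indicator hAm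
  refine h4.mono fun k => Eventually.of_forall fun z => ?_
  unfold farTerm
  by_cases hz : z ∈ A
  · rw [indicator_of_mem hz, indicator_of_mem hz, ← ENNReal.ofReal_mul (by positivity),
      ← ENNReal.ofReal_add (by positivity) (by positivity), ← ENNReal.ofReal_mul (by positivity),
      ← ENNReal.ofReal_add (by positivity) (by positivity)]
    refine ENNReal.ofReal_le_ofReal ?_
    rw [← add_mul, ← mul_assoc, ← add_mul]
    gcongr
    have h5 := abs_add_rpow_le (p := p - 1) hp1.le (u k z.2 - u₀ z.2) (u₀ z.2)
    rw [sub_add_cancel] at h5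
    refine h5.trans ?_
    gcongr
    · exact one_le_two
    · linarith
  · rw [indicator_of_notMem hz, ENNReal.ofReal_zero]
    exact zero_le

lemma exists_form_le (hn : 1 ≤ n) (hs : 0 < s) (hp : 1 < p) (hΛ : 1 ≤ Λ)
    (hK : KernelBounds n Λ s p K) (hΦ : PhiBounds Λ p Φ) {R : ℝ} (hR : 0 ≤ R) {φ : Rn n → ℝ}
    (hφ : ContDiff ℝ (⊤ : ℕ∞) φ) (hc : HasCompactSupport φ)
    (hφR : ∀ x, x ∉ ball (0 : Rn n) R → φ x = 0) :
    ∃ c : ℝ, ∀ᵐ z : Rn n × Rn n, ∀ u : Rn n → ℝ,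
      |Φ (u z.1 - u z.2) * (φ z.1 - φ z.2) * K z.1 z.2| ≤
        c * ((ball (0 : Rn n) (2 * R) ×ˢ ball (0 : Rn n) (2 * R)).indicator
          (fun z => |u z.1 - u z.2| ^ (p - 1) * ‖z.1 - z.2‖ ^ (1 - ((n : ℝ) + s * p))) z +
          (farTerm n s p R u z + farTerm n s p R u z.swap)) := by
  obtain ⟨L, hL⟩ := hφ.lipschitzWith_of_hasCompactSupport hc (by simp)
  obtain ⟨M, hM⟩ := hc.exists_bound_of_continuous hφ.continuous
  have hM0 : 0 ≤ M := (norm_nonneg _).trans (hM 0)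
  have hΛ0 : 0 < Λ := by linarith
  set c₁ := Λ * Λ * L
  set c₂ := Λ * (M + M) * (Λ * 2 ^ ((n : ℝ) + s * p) * 2 ^ (p - 1))
  have hc₁ : 0 ≤ c₁ := by positivity
  have hc₂ : 0 ≤ c₂ := by positivity
  refine ⟨c₁ + c₂, ?_⟩
  filter_upwards [hK.ae_bounds hn hΛ] with z ⟨hd, hK0, _, hK1⟩ u
  have hf1 := farTerm_nonneg (s := s) (p := p) R u z
  have hf2 := farTerm_nonneg (s := s) (p := p) R u z.swap
  have hn0 : 0 ≤ (ball (0 : Rn n) (2 * R) ×ˢ ball (0 : Rn n) (2 * R)).indicator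
      (fun z => |u z.1 - u z.2| ^ (p - 1) * ‖z.1 - z.2‖ ^ (1 - ((n : ℝ) + s * p))) z :=
    indicator_nonneg (fun z _ => by positivity) z
  have hφM : |φ z.1 - φ z.2| ≤ M + M :=
    (abs_sub _ _).trans (add_le_add (hM z.1) (hM z.2))
  rw [abs_mul, abs_mul, abs_of_nonneg hK0]
  have hfar : |Φ (u z.1 - u z.2)| * |φ z.1 - φ z.2| * K z.1 z.2 ≤
      Λ * (M + M) * (K z.1 z.2 * |u z.1 - u z.2| ^ (p - 1)) := by
    calc _ ≤ Λ * |u z.1 - u z.2| ^ (p - 1) * (M + M) * K z.1 z.2 := by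
          gcongr
          exact hΦ.abs_le hΛ hp _
      _ = _ := by ring
  by_cases h1 : z ∈ ball (0 : Rn n) (2 * R) ×ˢ ball (0 : Rn n) (2 * R)
  · rw [indicator_of_mem h1] at hn0 ⊢
    have hlip : |φ z.1 - φ z.2| ≤ L * ‖z.1 - z.2‖ := by
      simpa [dist_eq_norm] using hL.dist_le_mul z.1 z.2
    calc |Φ (u z.1 - u z.2)| * |φ z.1 - φ z.2| * K z.1 z.2
        ≤ Λ * |u z.1 - u z.2| ^ (p - 1) * (L * ‖z.1 - z.2‖) *
          (Λ * (1 / ‖z.1 - z.2‖ ^ (n + s * p))) := by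
          gcongr
          exact hΦ.abs_le hΛ hp _
      _ = c₁ * (|u z.1 - u z.2| ^ (p - 1) * ‖z.1 - z.2‖ ^ (1 - ((n : ℝ) + s * p))) := by
          rw [Real.rpow_sub hd, Real.rpow_one]
          ring
      _ ≤ (c₁ + c₂) * (|u z.1 - u z.2| ^ (p - 1) * ‖z.1 - z.2‖ ^ (1 - ((n : ℝ) + s * p))) :=
          mul_le_mul_of_nonneg_right (by linarith) hn0
      _ ≤ _ := mul_le_mul_of_nonneg_left (by linarith) (by positivity)
  · rw [indicator_of_notMem h1, zero_add]
    have hsub : ball (0 : Rn n) R ⊆ ball (0 : Rn n) (2 * R) := ball_subset_ball (by linarith)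
    by_cases hx : z.1 ∈ ball (0 : Rn n) R
    · have hy : z.2 ∈ (ball (0 : Rn n) (2 * R))ᶜ := fun hy => h1 ⟨hsub hx, hy⟩
      have h2 := far_bound (b₁ := u z.1) (b₂ := u z.2) hn hs hp hΛ hx hy hK1
      have h3 : farTerm n s p R u z =
          (|u z.1| ^ (p - 1) + |u z.2| ^ (p - 1)) * (1 / ‖z.2‖ ^ (n + s * p)) :=
        indicator_of_mem (Set.mem_prod.2 ⟨hx, hy⟩) _
      rw [← h3] at h2
      calc _ ≤ _ := hfar
        _ ≤ c₂ * farTerm n s p R u z :=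
            (mul_le_mul_of_nonneg_left h2 (by positivity)).trans_eq (by ring)
        _ ≤ _ := by gcongr <;> linarith
    · by_cases hy : z.2 ∈ ball (0 : Rn n) R
      · have hx' : z.1 ∈ (ball (0 : Rn n) (2 * R))ᶜ := fun hx' => h1 ⟨hx', hsub hy⟩
        have h2 := far_bound (b₁ := u z.2) (b₂ := u z.1) hn hs hp hΛ hy hx'
          (norm_sub_rev z.1 z.2 ▸ hK1)
        have h3 : farTerm n s p R u z.swap =
            (|u z.2| ^ (p - 1) + |u z.1| ^ (p - 1)) * (1 / ‖z.1‖ ^ (n + s * p)) :=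
          indicator_of_mem (Set.mem_prod.2 ⟨hy, hx'⟩) _
        rw [← h3, abs_sub_comm] at h2
        calc _ ≤ _ := hfar
          _ ≤ c₂ * farTerm n s p R u z.swap :=
              (mul_le_mul_of_nonneg_left h2 (by positivity)).trans_eq (by ring)
          _ ≤ _ := by gcongr <;> linarith
      · rw [hφR _ hx, hφR _ hy]
        simp only [sub_self, abs_zero, mul_zero, zero_mul]
        positivity

lemma tendsto_form (hn : 1 ≤ n) (hs : 0 < s) (hp : 1 < p) (hΛ : 1 ≤ Λ)
    (hK : KernelBounds n Λ s p K) (hΦ : PhiBounds Λ p Φ) {R h q : ℝ} (hR : 1 ≤ R)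
    (hσ : 0 < 1 - s * p + h * (p - 1)) (hq : p - 1 < q) {φ : Rn n → ℝ}
    (hφ : ContDiff ℝ (⊤ : ℕ∞) φ) (hc : HasCompactSupport φ)
    (hφR : ∀ x, x ∉ ball (0 : Rn n) R → φ x = 0) (hφW : memWsp n s p univ φ)
    {u : ℕ → Rn n → ℝ} {u₀ : Rn n → ℝ} (hu : ∀ k, memWsp n s p univ (u k))
    (hu₀ : AEMeasurable u₀) (hae : ∀ᵐ x, Tendsto (fun k => u k x) atTop (𝓝 (u₀ x)))
    {C : ℝ≥0∞} (hC : C ≠ ⊤)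
    (huC : ∀ k, ∫⁻ z in ball (0 : Rn n) (2 * R) ×ˢ ball (0 : Rn n) (2 * R),
      ENNReal.ofReal (diffQuot n h q (u k) z) ≤ C)
    (huC' : ∀ k, ∫⁻ x in ball (0 : Rn n) R, ENNReal.ofReal (|u k x| ^ q) ≤ C)
    (hfin : ∫⁻ y in (ball (0 : Rn n) (2 * R))ᶜ,
      ENNReal.ofReal (|u₀ y| ^ (p - 1) * (1 / ‖y‖ ^ ((n : ℝ) + s * p))) ≠ ⊤)
    (hlim : Tendsto (fun k => ∫⁻ y in (ball (0 : Rn n) (2 * R))ᶜ,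
      ENNReal.ofReal (|u k y - u₀ y| ^ (p - 1) * (1 / ‖y‖ ^ ((n : ℝ) + s * p)))) atTop (𝓝 0)) :
    Tendsto (fun k => nonlocalForm n Φ K (u k) φ) atTop (𝓝 (nonlocalForm n Φ K u₀ φ)) := by
  have hum : ∀ k, AEMeasurable (u k) := fun k => (hu k).aemeasurable
  obtain ⟨c, hle⟩ := exists_form_le hn hs hp hΛ hK hΦ (by linarith : 0 ≤ R) hφ hc hφR
  have hfar := equiInt_far hs hp hq hR hum hu₀ hC huC' hfin hlim
  have hfar' := hfar.comp_measurePreserving (e := MeasurableEquiv.prodComm)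
    (ν' := (volume : Measure (Rn n × Rn n))) Measure.measurePreserving_swap
  have hnear := (equiInt_near hn hp hσ hq (2 * R) hum hC huC).indicator
    (measurableSet_ball.prod measurableSet_ball)
  have hE : EquiInt (fun k (z : Rn n × Rn n) =>
      ENNReal.ofReal |Φ (u k z.1 - u k z.2) * (φ z.1 - φ z.2) * K z.1 z.2|) volume := by
    refine ((hnear.add (hfar.add hfar')).const_mul (c := ENNReal.ofReal c)
      ENNReal.ofReal_ne_top).mono fun k => ?_
    filter_upwards [hle] with z hz
    have hf1 := farTerm_nonneg (s := s) (p := p) R (u k) z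
    have hf2 := farTerm_nonneg (s := s) (p := p) R (u k) z.swap
    have hn0 : 0 ≤ (ball (0 : Rn n) (2 * R) ×ˢ ball (0 : Rn n) (2 * R)).indicator
        (fun z => |u k z.1 - u k z.2| ^ (p - 1) * ‖z.1 - z.2‖ ^ (1 - ((n : ℝ) + s * p))) z :=
      indicator_nonneg (fun z _ => by positivity) z
    refine (ENNReal.ofReal_le_ofReal (hz (u k))).trans ?_
    rw [ENNReal.ofReal_mul' (by positivity), ENNReal.ofReal_add hn0 (by positivity),
      ENNReal.ofReal_add hf1 hf2]
    refine mul_le_mul_right (add_le_add (le_of_eq ?_) le_rfl) _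
    by_cases h1 : z ∈ ball (0 : Rn n) (2 * R) ×ˢ ball (0 : Rn n) (2 * R)
    · rw [indicator_of_mem h1, indicator_of_mem h1]
    · rw [indicator_of_notMem h1, indicator_of_notMem h1, ENNReal.ofReal_zero]
  obtain ⟨hInt, hT⟩ := hE.integrable_and_tendsto
    (F₀ := fun z => Φ (u₀ z.1 - u₀ z.2) * (φ z.1 - φ z.2) * K z.1 z.2)
    (fun k => integrable_form hn hp hΛ hK hΦ (hu k) hφW) (by
      filter_upwards [ae_comp_fst hae, ae_comp_snd hae] with z h1 h2
      exact (((hΦ.1.tendsto _).comp (h1.sub h2)).mul_const _).mul_const _)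
  rw [nonlocalForm, ← integral_prod _ hInt]
  exact hT.congr fun k => (nonlocalForm_eq hn hp hΛ hK hΦ (hu k) hφW).symm

end FormConvergence

/-! ### Passage to the limit -/

section Limit

variable {n : ℕ} {s p Λ : ℝ} {Φ : ℝ → ℝ} {K : Rn n → Rn n → ℝ}

lemma exists_lintegral_diffQuot_le_add (hn : 1 ≤ n) {h q : ℝ} (hq : 0 < q) (hqp : q < p)
    (hhs : h < s) (R : ℝ) :
    ∃ C : ℝ≥0∞, C ≠ ⊤ ∧ ∀ w : Rn n → ℝ, AEMeasurable w →
      ∫⁻ z in ball (0 : Rn n) R ×ˢ ball (0 : Rn n) R, ENNReal.ofReal (diffQuot n h q w z) ≤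
      (∫⁻ z in ball (0 : Rn n) R ×ˢ ball (0 : Rn n) R,
        ENNReal.ofReal (diffQuot n s p w z)) + C := by
  obtain ⟨C, hC, hle⟩ := exists_lintegral_diffQuot_le (s := s) hn hq hqp hhs le_rfl R
  refine ⟨C * ∫⁻ _ in ball (0 : Rn n) R, ENNReal.ofReal (1 + 1), ?_, fun w hw => ?_⟩
  · rw [lintegral_const, Measure.restrict_apply_univ]
    exact ENNReal.mul_ne_top hC (ENNReal.mul_ne_top ENNReal.ofReal_ne_top measure_ball_lt_top.ne)
  · simpa using hle w hw

lemma lintegral_abs_add_rpow_le {α : Type*} [MeasurableSpace α] {ν : Measure α} {q : ℝ}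
    (hq : 0 ≤ q) {a b : α → ℝ} (ha : AEMeasurable a ν) :
    ∫⁻ x, ENNReal.ofReal (|a x + b x| ^ q) ∂ν ≤ ENNReal.ofReal (2 ^ q) *
      ((∫⁻ x, ENNReal.ofReal (|a x| ^ q) ∂ν) + ∫⁻ x, ENNReal.ofReal (|b x| ^ q) ∂ν) :=
  lintegral_ofReal_le_of_le_two_rpow (g := fun x => |a x| ^ q) (h := fun x => |b x| ^ q)
    (by positivity) (fun _ => by positivity) (fun _ => by positivity)
    ((continuous_abs.measurable.comp_aemeasurable ha).pow_const q)
    (Eventually.of_forall fun x => abs_add_rpow_le hq (a x) (b x))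

lemma lintegral_diffQuot_add_le {q h : ℝ} (hq : 0 ≤ q) {a b : Rn n → ℝ} (ha : AEMeasurable a)
    (A : Set (Rn n × Rn n)) :
    ∫⁻ z in A, ENNReal.ofReal (diffQuot n h q (fun x => a x + b x) z) ≤ ENNReal.ofReal (2 ^ q) *
      ((∫⁻ z in A, ENNReal.ofReal (diffQuot n h q a z)) +
        ∫⁻ z in A, ENNReal.ofReal (diffQuot n h q b z)) :=
  lintegral_ofReal_le_of_le_two_rpow (g := diffQuot n h q a) (h := diffQuot n h q b)
    (by positivity) (diffQuot_nonneg a) (diffQuot_nonneg b) (aemeasurable_diffQuot ha).restrict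
    (Eventually.of_forall fun z => diffQuot_add_le hq a b z)

lemma lintegral_rpow_limit_le {α : Type*} [MeasurableSpace α] {ν : Measure α} {q : ℝ}
    (hq : 0 ≤ q) {w : ℕ → α → ℝ} {w₀ : α → ℝ} (hw : ∀ k, AEMeasurable (w k) ν)
    (hae : ∀ᵐ x ∂ν, Tendsto (fun k => w k x) atTop (𝓝 (w₀ x))) {C : ℝ≥0∞}
    (hC : ∀ k, ∫⁻ x, ENNReal.ofReal (|w k x| ^ q) ∂ν ≤ C) :
    ∫⁻ x, ENNReal.ofReal (|w₀ x| ^ q) ∂ν ≤ C := by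
  refine lintegral_ofReal_liminf_le
    (fun k => (continuous_abs.measurable.comp_aemeasurable (hw k)).pow_const q) ?_ hC
  filter_upwards [hae] with x hx
  exact hx.abs.rpow_const (Or.inr hq)

lemma lintegral_diffQuot_limit_le {q h : ℝ} (hq : 0 ≤ q) {w : ℕ → Rn n → ℝ} {w₀ : Rn n → ℝ}
    (hw : ∀ k, AEMeasurable (w k)) (hae : ∀ᵐ x, Tendsto (fun k => w k x) atTop (𝓝 (w₀ x)))
    {A : Set (Rn n × Rn n)} {C : ℝ≥0∞}
    (hC : ∀ k, ∫⁻ z in A, ENNReal.ofReal (diffQuot n h q (w k) z) ≤ C) :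
    ∫⁻ z in A, ENNReal.ofReal (diffQuot n h q w₀ z) ≤ C := by
  refine lintegral_ofReal_liminf_le (fun k => (aemeasurable_diffQuot (hw k)).restrict)
    (ae_restrict_of_ae ?_) hC
  filter_upwards [ae_comp_fst hae, ae_comp_snd hae] with z h1 h2
  exact ((h1.sub h2).abs.rpow_const (Or.inr hq)).div_const _

lemma tendsto_lintegral_sub_rpow_zero {α : Type*} [MeasurableSpace α] {ν : Measure α}
    [IsFiniteMeasure ν] {q q' : ℝ} (hq : 0 < q) (hqq : q < q') {w : ℕ → α → ℝ} {w₀ : α → ℝ}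
    (hw : ∀ k, AEMeasurable (w k) ν) (hw₀ : AEMeasurable w₀ ν)
    (hae : ∀ᵐ x ∂ν, Tendsto (fun k => w k x) atTop (𝓝 (w₀ x))) {C : ℝ≥0∞} (hC : C ≠ ⊤)
    (hwC : ∀ k, ∫⁻ x, ENNReal.ofReal (|w k x| ^ q') ∂ν ≤ C) :
    Tendsto (fun k => ∫⁻ x, ENNReal.ofReal (|w k x - w₀ x| ^ q) ∂ν) atTop (𝓝 0) := by
  have hq'0 : 0 ≤ q' := by linarith
  have h0 := lintegral_rpow_limit_le hq'0 hw hae hwC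
  have hA : ∀ k, ∫⁻ x, ENNReal.ofReal (|w k x - w₀ x| ^ q') ∂ν ≤
      ENNReal.ofReal (2 ^ q') * (C + C) := by
    intro k
    have h1 := lintegral_abs_add_rpow_le hq'0 (hw k) (b := fun x => - w₀ x)
    simp only [← sub_eq_add_neg, abs_neg] at h1
    exact h1.trans (mul_le_mul_right (add_le_add (hwC k) h0) _)
  have hE : EquiInt (fun k x => ENNReal.ofReal (|w k x - w₀ x| ^ q)) ν := by
    refine EquiInt.of_young (A := fun k x => ENNReal.ofReal (|w k x - w₀ x| ^ q'))
      (G := fun _ => 1) (by finiteness)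
      (fun k => aemeasurable_ofReal_abs_rpow ((hw k).sub hw₀) q') hA aemeasurable_const
      (by simp) fun ε hε => ?_
    obtain ⟨c, hc0, hc⟩ := exists_rpow_le_eps_rpow hq hqq hε
    refine ⟨c, fun k => Eventually.of_forall fun x => ?_⟩
    rw [mul_one, ← ENNReal.ofReal_mul hε.le, ← ENNReal.ofReal_add (by positivity) hc0.le]
    exact ENNReal.ofReal_le_ofReal (hc _ (abs_nonneg _))
  refine hE.tendsto_zero (fun k => aemeasurable_ofReal_abs_rpow ((hw k).sub hw₀) q) ?_
  filter_upwards [hae] with x hx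
  have h2 := (ENNReal.continuous_ofReal.tendsto _).comp
    ((hx.sub_const (w₀ x)).abs.rpow_const (Or.inr hq.le) (p := q))
  simpa [Function.comp_def, Real.zero_rpow hq.ne'] using h2

/-- A bounded sequence of energy solutions `w k + g k` converging almost everywhere, with the
a priori estimates of exponents below `(s, q̄)`. -/
structure SolSeq (n : ℕ) (Φ : ℝ → ℝ) (K : Rn n → Rn n → ℝ) (s p R : ℝ) (Ω : Set (Rn n))
    (f g w : ℕ → Rn n → ℝ) (w₀ : Rn n → ℝ) : Prop where
  memWspZero : ∀ k, memWspZero n s p Ω (w k)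
  eq : ∀ k φ, _root_.memWspZero n s p Ω φ →
    nonlocalForm n Φ K (fun x => w k x + g k x) φ = ∫ x, φ x * f k x
  aemeasurable : AEMeasurable w₀
  ae : ∀ᵐ x, Tendsto (fun k => w k x) atTop (𝓝 (w₀ x))
  bound : ∀ h q : ℝ, h < s → 0 < q → q < qBar n s p → ∃ C : ℝ≥0∞, C ≠ ⊤ ∧ ∀ k,
    ∫⁻ z in ball (0 : Rn n) (2 * R) ×ˢ ball (0 : Rn n) (2 * R),
      ENNReal.ofReal (diffQuot n h q (w k) z) ≤ C ∧
    (p - 1 ≤ q → ∫⁻ x, ENNReal.ofReal (|w k x| ^ q) ≤ C)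

lemma exists_solSeq (hn : 2 ≤ n) (hs : 0 < s) (hs1 : s < 1) (hp : 2 - s / (n : ℝ) < p)
    (hΛ : 1 ≤ Λ) (hK : KernelBounds n Λ s p K) (hΦ : PhiBounds Λ p Φ) {Ω : Set (Rn n)}
    (hΩ : MeasurableSet Ω) {R : ℝ} (hR : (n : ℝ) ≤ R) (hΩR : Ω ⊆ ball (0 : Rn n) R)
    {f g : ℕ → Rn n → ℝ} (hf : ∀ j, ContDiff ℝ (⊤ : ℕ∞) (f j) ∧ HasCompactSupport (f j))
    (hg : ∀ j, ContDiff ℝ (⊤ : ℕ∞) (g j) ∧ HasCompactSupport (g j)) {E : ℝ≥0∞} (hE : E ≠ ⊤)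
    (hfg : ∀ j, (∫⁻ x in Ω, ENNReal.ofReal |f j x|) +
      ∫⁻ z, ENNReal.ofReal (dataTerm n s p R (g j) z) ≤ E) :
    ∃ ψ : ℕ → ℕ, StrictMono ψ ∧ ∃ (w : ℕ → Rn n → ℝ) (w₀ : Rn n → ℝ),
      SolSeq n Φ K s p R Ω (fun k => f (ψ k)) (fun k => g (ψ k)) w w₀ := by
  have hn1 : 1 ≤ n := by omega
  have hp1 : 1 < p := one_lt_of_lt hn hs1 hp
  have hR0 : 0 < R := lt_of_lt_of_le (by exact_mod_cast hn1) hR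
  have hqq := qStar_lt_qBar hn hs hs1 hp
  have h1q : 1 ≤ qStar p := le_max_left _ _
  have hgW : ∀ j, memWsp n s p univ (g j) := fun j =>
    memWsp_univ_of_contDiff hn1 hs hs1 hp1 (hg j).1 (hg j).2
  have hex : ∀ j, ∃ w, memWspZero n s p Ω w ∧ ∀ φ, memWspZero n s p Ω φ →
      nonlocalForm n Φ K (fun x => w x + g j x) φ = ∫ x, φ x * f j x := by
    intro j
    obtain ⟨M, hM⟩ := (hf j).2.exists_bound_of_continuous (hf j).1.continuous
    exact exists_weakSol hn1 hs hp1 hΛ hK hΦ hΩ (isBounded_ball.subset hΩR) (hgW j)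
      (hf j).1.continuous.aemeasurable hM
  choose w hw hweq using hex
  have hbound : ∀ h q : ℝ, h < s → 0 < q → q < qBar n s p → ∃ C : ℝ≥0∞, C ≠ ⊤ ∧ ∀ k,
      ∫⁻ z in ball (0 : Rn n) (2 * R) ×ˢ ball (0 : Rn n) (2 * R),
        ENNReal.ofReal (diffQuot n h q (w k) z) ≤ C ∧
      (p - 1 ≤ q → ∫⁻ x, ENNReal.ofReal (|w k x| ^ q) ≤ C) := by
    intro h q hhs hq hq'
    obtain ⟨C, hC, hle⟩ := exists_uniform_bound hn1 hs hs1 hp1 hΛ hK hΦ hΩ hR0 hΩR hhs hq hq' hE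
    exact ⟨C, hC, fun k => hle (w k) (g k) (f k) (hw k) (hgW k) (hweq k) (hfg k)⟩
  obtain ⟨C₁, hC₁, h1⟩ := hbound (s / 2) 1 (by linarith) one_pos (h1q.trans_lt hqq)
  obtain ⟨C₂, hC₂, h2⟩ := hbound (s / 2) (qStar p) (by linarith) (by linarith) hqq
  have hw0 : ∀ k, ∀ᵐ x, x ∉ ball (0 : Rn n) R → w k x = 0 := by
    intro k
    filter_upwards [(hw k).2] with x hx hxR
    exact hx fun h => hxR (hΩR h)
  have hL1 : ∀ k, ∫⁻ x, ENNReal.ofReal |w k x| ≤ volume (ball (0 : Rn n) R) + C₂ := by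
    intro k
    rw [lintegral_eq_setLIntegral_of_ae_zero (A := ball (0 : Rn n) R) measurableSet_ball
      (by filter_upwards [hw0 k] with x hx hxR; simp [hx hxR])]
    calc ∫⁻ x in ball (0 : Rn n) R, ENNReal.ofReal |w k x|
        ≤ ∫⁻ x in ball (0 : Rn n) R, (1 + ENNReal.ofReal (|w k x| ^ qStar p)) := by
          refine lintegral_mono fun x => ?_
          rw [← ENNReal.ofReal_one, ← ENNReal.ofReal_add zero_le_one (by positivity)]
          refine ENNReal.ofReal_le_ofReal ?_
          simpa using rpow_le_one_add_rpow zero_le_one h1q (abs_nonneg (w k x))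
      _ = volume (ball (0 : Rn n) R) +
          ∫⁻ x in ball (0 : Rn n) R, ENNReal.ofReal (|w k x| ^ qStar p) := by
          rw [lintegral_add_left measurable_const, lintegral_const, one_mul,
            Measure.restrict_apply_univ]
      _ ≤ _ := by
          gcongr
          exact (setLIntegral_le_lintegral _ _).trans ((h2 k).2 (le_max_right _ _))
  obtain ⟨ψ, hψ, w₀, hw₀, hlim⟩ := exists_subseq_ae_tendsto (half_pos hs) hR
    (fun k => (hw k).1.aemeasurable) hw0
    (C := C₁ + (volume (ball (0 : Rn n) R) + C₂))
    (ENNReal.add_ne_top.2 ⟨hC₁, ENNReal.add_ne_top.2 ⟨measure_ball_lt_top.ne, hC₂⟩⟩)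
    (fun k => (hL1 k).trans le_add_self) (fun k => (h1 k).1.trans le_self_add)
  refine ⟨ψ, hψ, fun k => w (ψ k), w₀, fun k => hw _, fun k => hweq _, hw₀.aemeasurable, hlim, ?_⟩
  intro h q hhs hq hq'
  obtain ⟨C, hC, hle⟩ := hbound h q hhs hq hq'
  exact ⟨C, hC, fun k => hle _⟩

end Limit

/-! ### Properties of the limit -/

section SOLA

variable {n : ℕ} {s p Λ R : ℝ} {Φ : ℝ → ℝ} {K : Rn n → Rn n → ℝ} {Ω : Set (Rn n)}
  {f G w : ℕ → Rn n → ℝ} {g w₀ : Rn n → ℝ}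

lemma lintegral_rpow_le_volume_add {q : ℝ} (hq : 0 ≤ q) (hqp : q ≤ p) (v : Rn n → ℝ) (r : ℝ) :
    ∫⁻ x in ball (0 : Rn n) r, ENNReal.ofReal (|v x| ^ q) ≤
      volume (ball (0 : Rn n) r) + ∫⁻ x in ball (0 : Rn n) r, ENNReal.ofReal (|v x| ^ p) := by
  have h : ∀ x, ENNReal.ofReal (|v x| ^ q) ≤ 1 + ENNReal.ofReal (|v x| ^ p) := fun x => by
    rw [← ENNReal.ofReal_one, ← ENNReal.ofReal_add zero_le_one (by positivity)]
    exact ENNReal.ofReal_le_ofReal (rpow_le_one_add_rpow hq hqp (abs_nonneg _))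
  calc ∫⁻ x in ball (0 : Rn n) r, ENNReal.ofReal (|v x| ^ q)
      ≤ ∫⁻ x in ball (0 : Rn n) r, (1 + ENNReal.ofReal (|v x| ^ p)) := lintegral_mono h
    _ = _ := by
      rw [lintegral_add_left measurable_const, lintegral_const, one_mul,
        Measure.restrict_apply_univ]

lemma qBar_le (n : ℕ) (s p : ℝ) : qBar n s p ≤ p := min_le_right _ _

lemma SolSeq.aemeasurable_seq (h : SolSeq n Φ K s p R Ω f G w w₀) (k : ℕ) :
    AEMeasurable (w k) := (h.memWspZero k).1.aemeasurable

lemma SolSeq.limit_eq_zero (h : SolSeq n Φ K s p R Ω f G w w₀) :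
    ∀ᵐ x, x ∉ Ω → w₀ x = 0 := by
  filter_upwards [h.ae, ae_all_iff.2 fun k => (h.memWspZero k).2] with x hx hk hxΩ
  exact tendsto_nhds_unique hx (by simp [hk _ hxΩ])

lemma SolSeq.memWsp_limit (hn : 1 ≤ n) (h : SolSeq n Φ K s p R Ω f G w w₀)
    (hg : BoundaryDatum n s p g) (hR : 0 ≤ R) (hΩR : Ω ⊆ ball (0 : Rn n) R) {t q : ℝ}
    (ht : t < s) (hq : qStar p ≤ q) (hq' : q < qBar n s p) :
    memWsp n t q Ω fun x => w₀ x + g x := by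
  have hq0 : 0 < q := lt_of_lt_of_le one_pos ((le_max_left _ _).trans hq)
  have hqp : q < p := hq'.trans_le (qBar_le n s p)
  have hgm := hg.aemeasurable
  obtain ⟨C, hC, hb⟩ := h.bound t q ht hq0 hq'
  have hΩ2 : Ω ⊆ ball (0 : Rn n) (2 * R) := hΩR.trans (ball_subset_ball (by linarith))
  have hm : AEMeasurable fun x => w₀ x + g x := h.aemeasurable.add hgm
  refine ⟨hm.restrict, ?_, ?_⟩
  · refine (lintegral_mono_set hΩ2).trans_lt <|
      (lintegral_abs_add_rpow_le hq0.le h.aemeasurable.restrict).trans_lt ?_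
    refine ENNReal.mul_lt_top ENNReal.ofReal_lt_top (ENNReal.add_lt_top.2 ⟨?_, ?_⟩)
    · refine lt_of_le_of_lt ?_ hC.lt_top
      refine (setLIntegral_le_lintegral _ _).trans ?_
      exact lintegral_rpow_limit_le hq0.le h.aemeasurable_seq h.ae
        fun k => (hb k).2 ((le_max_right _ _).trans hq)
    · exact (lintegral_rpow_le_volume_add hq0.le hqp.le g _).trans_lt
        (ENNReal.add_lt_top.2 ⟨measure_ball_lt_top, hg.lintegral_rpow _⟩)
  · rw [gagliardo_eq hm]
    refine (lintegral_mono_set (prod_mono hΩ2 hΩ2)).trans_lt <|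
      (lintegral_diffQuot_add_le hq0.le h.aemeasurable _).trans_lt ?_
    refine ENNReal.mul_lt_top ENNReal.ofReal_lt_top (ENNReal.add_lt_top.2 ⟨?_, ?_⟩)
    · exact (lintegral_diffQuot_limit_le hq0.le h.aemeasurable_seq h.ae
        fun k => (hb k).1).trans_lt hC.lt_top
    · obtain ⟨C', hC', hle⟩ := exists_lintegral_diffQuot_le_add hn hq0 hqp ht (2 * R)
      exact (hle g hgm).trans_lt
        (ENNReal.add_lt_top.2 ⟨hg.lintegral_diffQuot _, hC'.lt_top⟩)

lemma SolSeq.tendsto_lp (h : SolSeq n Φ K s p R Ω f G w w₀) (hs : 0 < s)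
    (hG : ConvDatum n s p G g) {q : ℝ} (hq : qStar p ≤ q) (hq' : q < qBar n s p)
    (z : Rn n) (r : ℝ) :
    Tendsto (fun k => ∫⁻ x in ball z r,
      ENNReal.ofReal (|(w k x + G k x) - (w₀ x + g x)| ^ q)) atTop (𝓝 0) := by
  have hq0 : 0 < q := lt_of_lt_of_le one_pos ((le_max_left _ _).trans hq)
  have hqp : q < p := hq'.trans_le (qBar_le n s p)
  obtain ⟨C, hC, hb⟩ := h.bound 0 ((q + qBar n s p) / 2) hs (by linarith) (by linarith)
  have hq1 : p - 1 ≤ q := (le_max_right _ _).trans hq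
  have hfin : IsFiniteMeasure (volume.restrict (ball z r)) :=
    ⟨by rw [Measure.restrict_apply_univ]; exact measure_ball_lt_top⟩
  have h1 := tendsto_lintegral_sub_rpow_zero (ν := volume.restrict (ball z r)) hq0
    (by linarith : q < (q + qBar n s p) / 2) (fun k => (h.aemeasurable_seq k).restrict)
    h.aemeasurable.restrict (ae_restrict_of_ae h.ae) hC
    fun k => (setLIntegral_le_lintegral _ _).trans ((hb k).2 (by linarith))
  have h2 : Tendsto (fun k => ∫⁻ x in ball z r, ENNReal.ofReal (|G k x - g x| ^ q))
      atTop (𝓝 0) := by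
    refine tendsto_of_tendsto_of_tendsto_of_le_of_le tendsto_const_nhds
      (hG.lp_of_lt hq0 hqp (r + ‖z‖)) (fun _ => zero_le) fun k => lintegral_mono_set ?_
    exact ball_subset_ball' (by simp)
  have h3 := ENNReal.Tendsto.const_mul (a := ENNReal.ofReal (2 ^ q)) (h1.add h2)
    (Or.inr ENNReal.ofReal_ne_top)
  rw [add_zero, mul_zero] at h3
  refine tendsto_of_tendsto_of_tendsto_of_le_of_le tendsto_const_nhds h3 (fun _ => zero_le)
    fun k => ?_
  have ha : AEMeasurable (fun x => w k x - w₀ x) := (h.aemeasurable_seq k).sub h.aemeasurable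
  simp only [add_sub_add_comm]
  exact lintegral_abs_add_rpow_le hq0.le ha.restrict

lemma setLIntegral_diffQuot_le_dataTerm (R : ℝ) (v : Rn n → ℝ) :
    ∫⁻ z in ball (0 : Rn n) (2 * R) ×ˢ ball (0 : Rn n) (2 * R),
      ENNReal.ofReal (diffQuot n s p v z) ≤ ∫⁻ z, ENNReal.ofReal (dataTerm n s p R v z) := by
  rw [← lintegral_indicator (measurableSet_ball.prod measurableSet_ball)]
  refine lintegral_mono fun z => ?_
  by_cases hz : z ∈ ball (0 : Rn n) (2 * R) ×ˢ ball (0 : Rn n) (2 * R)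
  · rw [indicator_of_mem hz, dataTerm, indicator_of_mem hz]
    exact ENNReal.ofReal_le_ofReal (le_add_of_nonneg_right
      (add_nonneg (farTerm_nonneg R v z) (farTerm_nonneg R v _)))
  · rw [indicator_of_notMem hz]
    exact zero_le

lemma SolSeq.tendsto_form (h : SolSeq n Φ K s p R Ω f G w w₀) (hn : 2 ≤ n) (hs : 0 < s)
    (hs1 : s < 1) (hp : 2 - s / (n : ℝ) < p) (hΛ : 1 ≤ Λ) (hK : KernelBounds n Λ s p K)
    (hΦ : PhiBounds Λ p Φ) (hR : 1 ≤ R) (hΩR : Ω ⊆ ball (0 : Rn n) R)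
    (hg : BoundaryDatum n s p g) (hG : ConvDatum n s p G g)
    (hGs : ∀ k, ContDiff ℝ (⊤ : ℕ∞) (G k) ∧ HasCompactSupport (G k)) {E : ℝ≥0∞} (hE : E ≠ ⊤)
    (hGE : ∀ k, ∫⁻ z, ENNReal.ofReal (dataTerm n s p R (G k) z) ≤ E)
    (hGE' : ∀ k, ∫⁻ x in ball (0 : Rn n) R, ENNReal.ofReal (|G k x| ^ p) ≤ E)
    {φ : Rn n → ℝ} (hφ : IsTestFun n Ω φ) :
    Tendsto (fun k => nonlocalForm n Φ K (fun x => w k x + G k x) φ) atTop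
      (𝓝 (nonlocalForm n Φ K (fun x => w₀ x + g x) φ)) := by
  have hn1 : 1 ≤ n := by omega
  have hp1 : 1 < p := one_lt_of_lt hn hs1 hp
  have hqq := qStar_lt_qBar hn hs hs1 hp
  obtain ⟨q, hq, hq'⟩ := exists_between hqq
  have hq0 : 0 < q := lt_of_lt_of_le one_pos ((le_max_left _ _).trans hq.le)
  have hqp1 : p - 1 < q := lt_of_le_of_lt (le_max_right _ _) hq
  have hqp : q < p := hq'.trans_le (qBar_le n s p)
  set t : ℝ := s - (1 - s) / (2 * (p - 1)) with ht
  have hts : t < s := by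
    have : 0 < (1 - s) / (2 * (p - 1)) := div_pos (by linarith) (by linarith)
    linarith
  have htp : 0 < 1 - s * p + t * (p - 1) := by
    have : t * (p - 1) = s * (p - 1) - (1 - s) / 2 := by
      rw [ht]
      field_simp [(by linarith : p - 1 ≠ 0)]
    rw [this]
    linarith
  obtain ⟨C₁, hC₁, hb⟩ := h.bound t q hts hq0 hq'
  obtain ⟨C₂, hC₂, hle⟩ := exists_lintegral_diffQuot_le_add (s := s) hn1 hq0 hqp hts (2 * R)
  have hGm : ∀ k, AEMeasurable (G k) := fun k => (hGs k).1.continuous.aemeasurable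
  have hGW : ∀ k, memWsp n s p univ (G k) := fun k =>
    memWsp_univ_of_contDiff hn1 hs hs1 hp1 (hGs k).1 (hGs k).2
  have hoff : (ball (0 : Rn n) (2 * R))ᶜ ⊆ Ωᶜ :=
    compl_subset_compl.2 (hΩR.trans (ball_subset_ball (by linarith)))
  have hone : (ball (0 : Rn n) (2 * R))ᶜ ⊆ (ball (0 : Rn n) 1)ᶜ :=
    compl_subset_compl.2 (ball_subset_ball (by linarith))
  have hcongr : ∀ {a b : Rn n → ℝ}, (∀ᵐ x, x ∉ Ω → a x = b x) →
      ∫⁻ y in (ball (0 : Rn n) (2 * R))ᶜ,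
        ENNReal.ofReal (|a y| ^ (p - 1) * (1 / ‖y‖ ^ ((n : ℝ) + s * p))) ≤
      ∫⁻ y in (ball (0 : Rn n) 1)ᶜ,
        ENNReal.ofReal (|b y| ^ (p - 1) * (1 / ‖y‖ ^ ((n : ℝ) + s * p))) := by
    intro a b hab
    refine le_trans (le_of_eq ?_) (lintegral_mono_set hone)
    refine setLIntegral_congr_fun_ae measurableSet_ball.compl ?_
    filter_upwards [hab] with x hx hxb
    rw [hx (hoff hxb)]
  refine _root_.tendsto_form (C := ENNReal.ofReal (2 ^ q) *
      (C₁ + (E + C₂ + (volume (ball (0 : Rn n) R) + E)))) (R := R) (h := t) (q := q) hn1 hs hp1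
    hΛ hK hΦ hR htp hqp1 hφ.1 hφ.2.1
    (fun x hx => image_eq_zero_of_notMem_tsupport fun hx' => hx (hΩR (hφ.2.2 hx')))
    (memWsp_univ_of_contDiff hn1 hs hs1 hp1 hφ.1 hφ.2.1)
    (fun k => memWsp_univ_add (by linarith) (h.memWspZero k).1 (hGW k))
    (h.aemeasurable.add hg.aemeasurable) ?_ ?_ (fun k => ?_) (fun k => ?_) ?_ ?_
  · filter_upwards [h.ae, hG.ae] with x h1 h2
    exact h1.add h2
  · exact ENNReal.mul_ne_top ENNReal.ofReal_ne_top (ENNReal.add_ne_top.2 ⟨hC₁,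
      ENNReal.add_ne_top.2 ⟨ENNReal.add_ne_top.2 ⟨hE, hC₂⟩,
        ENNReal.add_ne_top.2 ⟨measure_ball_lt_top.ne, hE⟩⟩⟩)
  · refine (lintegral_diffQuot_add_le hq0.le (h.aemeasurable_seq k) _).trans ?_
    gcongr
    · exact (hb k).1
    · refine (hle _ (hGm k)).trans (le_trans ?_ le_self_add)
      gcongr
      exact (setLIntegral_diffQuot_le_dataTerm R (G k)).trans (hGE k)
  · refine (lintegral_abs_add_rpow_le hq0.le (h.aemeasurable_seq k).restrict).trans ?_
    gcongr
    · exact (setLIntegral_le_lintegral _ _).trans ((hb k).2 hqp1.le)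
    · refine (lintegral_rpow_le_volume_add hq0.le hqp.le (G k) R).trans
        (le_trans ?_ le_add_self)
      gcongr
      exact hGE' k
  · refine ((hcongr ?_).trans_lt (hg.lintegral_tail hp1)).ne
    filter_upwards [h.limit_eq_zero] with x hx hxΩ
    rw [hx hxΩ, zero_add]
  · refine tendsto_of_tendsto_of_tendsto_of_le_of_le tendsto_const_nhds hG.tail
      (fun _ => zero_le) fun k => hcongr ?_
    filter_upwards [h.limit_eq_zero, (h.memWspZero k).2] with x hx hk hxΩ
    rw [hx hxΩ, hk hxΩ, zero_add, zero_add]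

end SOLA

/-- Theorem 1.1, Solvability: existence of a SOLA. -/
theorem existence_of_SOLA
    (n : ℕ) (s p Λ : ℝ) (Φ : ℝ → ℝ) (K : Rn n → Rn n → ℝ)
    (Ω : Set (Rn n)) (μ : MeasureTheory.SignedMeasure (Rn n)) (g : Rn n → ℝ)
    (hn : 2 ≤ n) (hs : 0 < s) (hs1 : s < 1) (hp : 2 - s / (n : ℝ) < p) (hΛ : 1 ≤ Λ)
    (hK : KernelBounds n Λ s p K) (hΦ : PhiBounds Λ p Φ)
    (hΩo : IsOpen Ω) (hΩb : Bornology.IsBounded Ω)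
    (hg : BoundaryDatum n s p g) :
    ∃ u : Rn n → ℝ, IsSOLA n Φ K s p Ω μ g u := by
  have hn1 : 1 ≤ n := by omega
  have hp1 : 1 < p := one_lt_of_lt hn hs1 hp
  obtain ⟨R, hnR, hΩR⟩ := hΩb.subset_ball_lt (n : ℝ) 0
  have hR1 : 1 ≤ R := le_trans (by exact_mod_cast hn1) hnR.le
  obtain ⟨f, hfs, hfμ, hfw, hfl⟩ := exists_smooth_approx_measure μ
  obtain ⟨gj, hgs, hgc⟩ := exists_smooth_approx_datum hs hp1 hg
  have hgm : ∀ j, AEMeasurable (gj j) := fun j => (hgs j).1.continuous.aemeasurable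
  obtain ⟨C₁, hC₁, hb₁⟩ := hgc.exists_dataTerm_bound hs hp1 hg hgm hR1
  obtain ⟨C₂, hC₂, hb₂⟩ := hgc.exists_lp_bound (by linarith) hg R
  obtain ⟨N, hN⟩ := eventually_atTop.1 (hb₁.and hb₂)
  have hμ : μ.totalVariation univ ≠ ⊤ := by
    rw [SignedMeasure.totalVariation, Measure.add_apply]
    exact ENNReal.add_ne_top.2 ⟨measure_ne_top _ _, measure_ne_top _ _⟩
  obtain ⟨ψ, hψ, w, w₀, hw⟩ := exists_solSeq hn hs hs1 hp hΛ hK hΦ hΩo.measurableSet hnR.le hΩR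
    (f := fun j => f (j + N)) (g := fun j => gj (j + N)) (fun j => hfs _) (fun j => hgs _)
    (E := μ.totalVariation univ + C₁) (ENNReal.add_ne_top.2 ⟨hμ, hC₁⟩)
    fun j => add_le_add ((setLIntegral_le_lintegral _ _).trans (hfμ _)) (hN _ (by omega)).1
  set θ : ℕ → ℕ := fun k => ψ k + N with hθ_def
  have hθ : StrictMono θ := fun a b hab => Nat.add_lt_add_right (hψ hab) N
  have hG : ConvDatum n s p (fun k => gj (θ k)) g := hgc.comp hθ
  have hGW : ∀ k, memWsp n s p univ (gj k) := fun k =>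
    memWsp_univ_of_contDiff hn1 hs hs1 hp1 (hgs k).1 (hgs k).2
  have heq : ∀ k φ, IsTestFun n Ω φ →
      nonlocalForm n Φ K (fun x => w k x + gj (θ k) x) φ = ∫ x, φ x * f (θ k) x := by
    intro k φ hφ
    exact hw.eq k φ ⟨memWsp_univ_of_contDiff hn1 hs hs1 hp1 hφ.1 hφ.2.1,
      Eventually.of_forall fun x hx =>
        image_eq_zero_of_notMem_tsupport fun hx' => hx (hφ.2.2 hx')⟩
  refine ⟨fun x => w₀ x + g x, ?_, ?_, ?_, fun k x => w k x + gj (θ k) x, fun k => f (θ k),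
    fun k => gj (θ k), fun k => hfs _, fun k => hgs _, fun k => ⟨?_, ?_, heq k⟩, ?_, ?_, ?_, ?_, ?_⟩
  · intro h q _ hhs hq hq'
    exact hw.memWsp_limit hn1 hg (by linarith) hΩR hhs hq hq'
  · intro φ hφ
    have h1 := hw.tendsto_form hn hs hs1 hp hΛ hK hΦ hR1 hΩR hg hG (fun k => hgs _)
      (E := C₁ + C₂) (ENNReal.add_ne_top.2 ⟨hC₁, hC₂⟩)
      (fun k => (hN (θ k) (Nat.le_add_left _ _)).1.trans le_self_add)
      (fun k => (hN (θ k) (Nat.le_add_left _ _)).2.trans le_add_self) hφ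
    refine tendsto_nhds_unique h1 ?_
    exact ((hfw φ hφ.1.continuous hφ.2.1).comp hθ.tendsto_atTop).congr fun k => (heq k φ hφ).symm
  · filter_upwards [hw.limit_eq_zero] with x hx hxΩ
    rw [hx hxΩ, zero_add]
  · exact memWsp_univ_add (by linarith) (hw.memWspZero k).1 (hGW _)
  · filter_upwards [(hw.memWspZero k).2] with x hx hxΩ
    rw [hx hxΩ, zero_add]
  · filter_upwards [hw.ae, hG.ae] with x h1 h2
    exact h1.add h2
  · intro q hq hq' z r _
    exact hw.tendsto_lp hs hG hq hq' z r
  · intro φ hφ hc _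
    exact (hfw φ hφ hc).comp hθ.tendsto_atTop
  · intro z r _
    exact (hθ.tendsto_atTop.limsup_comp_le_limsup).trans (hfl z r)
  · intro z r hr
    exact ⟨hG.tendsto_sobolev (fun k => hgm _) hg.aemeasurable z r,
      hG.tendsto_tailFn hs hp1 (fun k => hgm _) hg.aemeasurable z hr⟩
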